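/- arXiv:2508.17438 — 2 statements merged into one kernel-verified Lean document; each statement's English description precedes it below -/
import Mathlib

section
/- There exists a constant c > 0 such that every connected vertex-transitive graph on n ≥ 3 vertices contains a cycle of length at least c·n^(5/8). -/
open SimpleGraph

/-- `G` is vertex-transitive: any vertex can be mapped to any other by an automorphism. -/
def IsVertexTransitive {V : Type*} (G : SimpleGraph V) : Prop :=
  ∀ u v : V, ∃ g : G ≃g G, g u = v

section

inductive PathOn {V : Type} [DecidableEq V] (G : SimpleGraph V) : V → V → Finset V → Prop
  | single (x : V) : PathOn G x x {x}
  | cons {x y z : V} {S : Finset V} (h : G.Adj x y) (p : PathOn G y z S) (hx : x ∉ S) :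
      PathOn G x z (insert x S)

namespace PathOn
variable {V : Type} [DecidableEq V] {G : SimpleGraph V} {x y z w a b : V} {S T P : Finset V}

theorem left_mem (h : PathOn G x y S) : x ∈ S := by
  cases h <;> simp

theorem right_mem (h : PathOn G x y S) : y ∈ S := by
  induction h <;> simp_all

theorem append (h : PathOn G x y S) (e : G.Adj y z) (h' : PathOn G z w T) (hd : Disjoint S T) :
    PathOn G x w (S ∪ T) := by
  induction h with
  | single x =>
    rw [← Finset.insert_eq]
    exact cons e h' (by simpa using hd)
  | cons h p hx ih =>
    rw [Finset.disjoint_insert_left] at hd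
    rw [Finset.insert_union]
    exact cons h (ih e hd.2) (by simp [hx, hd.1])

theorem symm (h : PathOn G x y S) : PathOn G y x S := by
  induction h with
  | single x => exact single x
  | @cons x y z S h p hx ih =>
    rw [Finset.insert_eq, Finset.union_comm]
    exact ih.append h.symm (single x) (by simpa using hx)

theorem mono {G' : SimpleGraph V} (hG : G ≤ G') (h : PathOn G x y S) : PathOn G' x y S := by
  induction h with
  | single x => exact single x
  | cons h p hx ih => exact cons (hG h) ih hx

/-- split at a vertex -/
theorem split (h : PathOn G x y S) (hv : a ∈ S) :
    ∃ S₁ S₂, PathOn G x a S₁ ∧ PathOn G a y S₂ ∧ S₁ ∪ S₂ = S ∧ S₁ ∩ S₂ = {a} := by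
  induction h with
  | single x =>
    have : a = x := by simpa using hv
    subst this
    exact ⟨{a}, {a}, single a, single a, by simp, by simp⟩
  | @cons x y z S h p hx ih =>
    by_cases hax : a = x
    · subst hax
      refine ⟨{a}, insert a S, single a, cons h p hx, by simp, Finset.inter_eq_left.2 (by simp)⟩
    · obtain ⟨S₁, S₂, h1, h2, h3, h4⟩ := ih (by simpa [hax] using hv)
      refine ⟨insert x S₁, S₂, cons h h1 ?_, h2, ?_, ?_⟩
      · intro h; apply hx; rw [← h3]; simp [h]
      · rw [Finset.insert_union, h3]
      · rw [Finset.insert_inter_of_notMem, h4]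
        intro h; apply hx; rw [← h3]; simp [h]

/-- gluing at a vertex -/
theorem glue (h : PathOn G x a S) (h' : PathOn G a y T) (hi : S ∩ T = {a}) :
    PathOn G x y (S ∪ T) := by
  induction h with
  | single x =>
    rw [Finset.union_eq_right.2]
    · exact h'
    · simpa using h'.left_mem
  | @cons x b z S h p hx ih =>
    have hz : z ∈ S := p.right_mem
    have hxz : x ≠ z := fun h => hx (h ▸ hz)
    have hxT : x ∉ T := by
      intro hT
      have : x ∈ insert x S ∩ T := by simp [hT]
      rw [hi] at this
      exact hxz (by simpa using this)
    rw [Finset.insert_inter_of_notMem hxT] at hi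
    rw [Finset.insert_union]
    exact cons h (ih h' hi) (by simp [hx, hxT])

theorem map {W : Type} [DecidableEq W] {H : SimpleGraph W} (f : V → W) (hf : Function.Injective f)
    (hH : ∀ u v, G.Adj u v → H.Adj (f u) (f v)) (h : PathOn G x y S) :
    PathOn H (f x) (f y) (S.image f) := by
  induction h with
  | single x => simpa using single (f x)
  | cons h p hx ih =>
    rw [Finset.image_insert]
    exact cons (hH _ _ h) ih (by simpa [hf.eq_iff] using hx)

/-- there is a walk with this support -/
theorem exists_walk (h : PathOn G x y S) :
    ∃ p : G.Walk x y, p.IsPath ∧ p.length + 1 = S.card ∧ ∀ v, v ∈ p.support ↔ v ∈ S := by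
  induction h with
  | single x => exact ⟨Walk.nil, by simp, by simp, by simp⟩
  | cons h p hx ih =>
    obtain ⟨q, h1, h2, h3⟩ := ih
    refine ⟨Walk.cons h q, ?_, ?_, ?_⟩
    · rw [Walk.cons_isPath_iff]; exact ⟨h1, by rwa [h3]⟩
    · rw [Walk.length_cons, h2, Finset.card_insert_of_notMem hx]
    · intro v; simp [h3]

theorem of_walk (p : G.Walk x y) (hp : p.IsPath) : PathOn G x y p.support.toFinset := by
  induction p with
  | nil => simpa using single _
  | cons h q ih =>
    rw [Walk.cons_isPath_iff] at hp
    rw [Walk.support_cons, List.toFinset_cons]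
    exact cons h (ih hp.1) (by simpa using hp.2)

/-- closing up to a cycle -/
theorem exists_cycle (h : PathOn G x y S) (e : G.Adj y x) (hS : 3 ≤ S.card) :
    ∃ (W : G.Walk y y), W.IsCycle ∧ W.length = S.card := by
  obtain ⟨p, h1, h2, h3⟩ := h.exists_walk
  refine ⟨Walk.cons e p, ?_, by simpa using h2⟩
  rw [Walk.cons_isCycle_iff]
  refine ⟨h1, fun he => ?_⟩
  cases h with
  | single => simp at hS
  | @cons _ u _ S h q hx =>
  -- use the path structure directly
    cases p with
    | nil => simp at he
    | @cons _ v _ h' p' =>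
      rw [Walk.cons_isPath_iff] at h1
      rw [Walk.edges_cons, List.mem_cons] at he
      rcases he with he | he
      · rw [Sym2.eq_iff] at he
        rcases he with ⟨h5, h6⟩ | ⟨h5, h6⟩
        · exact e.ne h5
        · subst h5
          have := h1.1
          have h7 := Walk.isPath_iff_nil.1 this
          have h8 := Walk.length_eq_zero_iff.2 h7
          simp [h8] at h2
          omega
      · exact h1.2 (Walk.snd_mem_support_of_mem_edges _ he)

/-- parametrisation -/
theorem exists_param (h : PathOn G x y S) :
    ∃ c : ℕ → V, Set.InjOn c (Set.Iio S.card) ∧ (Finset.range S.card).image c = S ∧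
      (∀ i, i + 1 < S.card → G.Adj (c i) (c (i+1))) ∧ c 0 = x ∧ c (S.card - 1) = y := by
  induction h with
  | single x => exact ⟨fun _ => x, by simp [Set.InjOn], by simp, by simp, rfl, rfl⟩
  | @cons x y z S h p hx ih =>
    obtain ⟨c, h1, h2, h3, h4, h5⟩ := ih
    have hpos : 0 < S.card := Finset.card_pos.2 ⟨_, p.left_mem⟩
    have hc : ∀ i, i < S.card → c i ∈ S := fun i hi => by
      rw [← h2]; exact Finset.mem_image_of_mem _ (by simpa using hi)
    rw [Finset.card_insert_of_notMem hx]
    refine ⟨fun i => Nat.casesOn i x c, ?_, ?_, ?_, rfl, ?_⟩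
    · rintro (_ | i) hi (_ | j) hj hij
      · rfl
      · exact absurd (hc j (by simpa using hj)) (by simp only at hij; rwa [← hij])
      · exact absurd (hc i (by simpa using hi)) (by simp only at hij; rwa [hij])
      · rw [h1 (by simpa using hi) (by simpa using hj) hij]
    · ext v
      simp only [Finset.mem_image, Finset.mem_range, Finset.mem_insert]
      constructor
      · rintro ⟨_ | i, hi, rfl⟩
        · simp
        · right; exact hc i (by omega)
      · rintro (rfl | hv)
        · exact ⟨0, by omega, rfl⟩
        · rw [← h2] at hv
          simp only [Finset.mem_image, Finset.mem_range] at hv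
          obtain ⟨i, hi, rfl⟩ := hv
          exact ⟨i+1, by omega, rfl⟩
    · rintro (_ | i) hi
      · simpa [h4] using h
      · exact h3 i (by omega)
    · obtain ⟨k, hk⟩ : ∃ k, S.card = k + 1 := ⟨S.card - 1, by omega⟩
      rw [hk] at h5 ⊢
      simpa using h5

theorem seg {c : ℕ → V} {ℓ : ℕ} (hc : Set.InjOn c (Set.Iio ℓ))
    (ha : ∀ i, i + 1 < ℓ → G.Adj (c i) (c (i+1))) {i j : ℕ} (hij : i ≤ j) (hj : j < ℓ) :
    PathOn G (c i) (c j) ((Finset.Icc i j).image c) := by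
  induction j, hij using Nat.le_induction with
  | base => simpa using single (c i)
  | succ j hij ih =>
    have := (ih (by omega)).append (ha j hj) (single (c (j+1))) (by
      rw [Finset.disjoint_singleton_right]
      simp only [Finset.mem_image, Finset.mem_Icc, not_exists, not_and]
      intro k hk h
      have := hc (by simp; omega) (by simp; omega) h
      omega)
    rwa [← Finset.image_singleton c, ← Finset.image_union,
      show Finset.Icc i j ∪ {j+1} = Finset.Icc i (j+1) by ext; simp; omega] at this

end PathOn

end

section

section Menger
variable {V : Type} [DecidableEq V] {G G' : SimpleGraph V} {x y z w a b : V}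
  {A B X Z S T P : Finset V} {k : ℕ}

theorem PathOn.first (h : PathOn G a b S) (hb : ∃ v ∈ S, v ∈ T) :
    ∃ v S₁, v ∈ T ∧ S₁ ⊆ S ∧ PathOn G a v S₁ ∧ S₁ ∩ T = {v} := by
  induction h with
  | single x =>
    obtain ⟨v, hv, hT⟩ := hb
    obtain rfl : v = x := by simpa using hv
    exact ⟨v, {v}, hT, by simp, .single v, by simpa using hT⟩
  | @cons x y z S h p hx ih =>
    by_cases hxT : x ∈ T
    · exact ⟨x, {x}, hxT, by simp, .single x, by simpa using hxT⟩
    · obtain ⟨v, S₁, h1, h2, h3, h4⟩ := ih (by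
        obtain ⟨v, hv, hT⟩ := hb
        rcases Finset.mem_insert.1 hv with rfl | hv
        · exact absurd hT hxT
        · exact ⟨v, hv, hT⟩)
      exact ⟨v, insert x S₁, h1, Finset.insert_subset_insert _ h2, .cons h h3 (fun h => hx (h2 h)),
        by rw [Finset.insert_inter_of_notMem hxT, h4]⟩

theorem PathOn.join (h : PathOn G a x S) (h' : PathOn G x b T) :
    ∃ R, R ⊆ S ∪ T ∧ PathOn G a b R := by
  obtain ⟨v, S₁, h1, h2, h3, h4⟩ := h.first ⟨x, h.right_mem, h'.left_mem⟩
  obtain ⟨T₁, T₂, h5, h6, h7, h8⟩ := h'.split h1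
  have h9 : T₂ ⊆ T := by rw [← h7]; exact Finset.subset_union_right
  refine ⟨S₁ ∪ T₂, Finset.union_subset_union h2 h9, h3.glue h6 ?_⟩
  apply Finset.Subset.antisymm
  · rw [← h4]; exact Finset.inter_subset_inter_left h9
  · simp [h3.right_mem, h6.left_mem]

def VSep (G : SimpleGraph V) (A B X : Finset V) : Prop :=
  ∀ a ∈ A, ∀ b ∈ B, ∀ S, PathOn G a b S → ∃ v ∈ S, v ∈ X

theorem VSep.symm (h : VSep G A B X) : VSep G B A X :=
  fun b hb a ha S hS => h a ha b hb S hS.symm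

def Linkage (G : SimpleGraph V) (A B : Finset V) (k : ℕ) : Prop :=
  ∃ (I : Finset V) (a b : V → V) (S : V → Finset V), I.card = k ∧
    (∀ i ∈ I, a i ∈ A ∧ b i ∈ B ∧ PathOn G (a i) (b i) (S i)) ∧
    ∀ i ∈ I, ∀ j ∈ I, i ≠ j → Disjoint (S i) (S j)

theorem Linkage.onto (h : Linkage G A T k) (hT : T.card = k) :
    ∃ (a : V → V) (S : V → Finset V), (∀ t ∈ T, a t ∈ A ∧ PathOn G (a t) t (S t)) ∧
    ∀ i ∈ T, ∀ j ∈ T, i ≠ j → Disjoint (S i) (S j) := by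
  obtain ⟨I, a, b, S, h1, h2, h3⟩ := h
  have hinj : Set.InjOn b I := by
    intro i hi j hj hij
    by_contra hne
    have := h3 i hi j hj hne
    exact Finset.disjoint_left.1 this (h2 i hi).2.2.right_mem (hij ▸ (h2 j hj).2.2.right_mem)
  have hsurj : ∀ t ∈ T, ∃ i ∈ I, b i = t := by
    have := Finset.surj_on_of_inj_on_of_card_le (s := I) (t := T) (fun i _ => b i)
      (fun i hi => (h2 i hi).2.1) (fun i j hi hj h => hinj hi hj h) (by omega)
    intro t ht
    obtain ⟨i, hi, h⟩ := this t ht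
    exact ⟨i, hi, h.symm⟩
  choose! f hf1 hf2 using hsurj
  refine ⟨a ∘ f, S ∘ f, fun t ht => ⟨(h2 _ (hf1 t ht)).1, ?_⟩, fun i hi j hj hij => ?_⟩
  · have := (h2 _ (hf1 t ht)).2.2
    rwa [hf2 t ht] at this
  · refine h3 _ (hf1 i hi) _ (hf1 j hj) (fun h => hij ?_)
    rw [← hf2 i hi, ← hf2 j hj, h]

theorem PathOn.of_adj (h : PathOn G a b S) (hG : ∀ u ∈ S, ∀ v ∈ S, G.Adj u v → G'.Adj u v) :
    PathOn G' a b S := by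
  induction h with
  | single x => exact .single x
  | @cons x y z S h p hx ih =>
    exact .cons (hG _ (by simp) _ (by simp [p.left_mem]) h)
      (ih fun u hu v hv => hG u (by simp [hu]) v (by simp [hv])) hx

theorem sep_side (hG : ∀ u v, G.Adj u v → s(u, v) ≠ s(x, y) → G'.Adj u v)
    (hsep : VSep G A B (insert x X)) (hy : ∀ a ∈ A, ∀ S, PathOn G' a y S → ∃ v ∈ S, v ∈ X)
    (hxX : x ∉ X) (hZ : VSep G' A (insert x X) Z) : VSep G A B Z := by
  intro a ha b hb S hS
  obtain ⟨v, S₁, h1, h2, h3, h4⟩ := hS.first (hsep a ha b hb S hS)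
  suffices h : PathOn G' a v S₁ by
    obtain ⟨u, hu, huZ⟩ := hZ a ha v h1 S₁ h
    exact ⟨u, h2 hu, huZ⟩
  have key : ∀ u ∈ S₁, u ∈ insert x X → u = v := fun u hu hu' => by
    have : u ∈ S₁ ∩ insert x X := by simp only [Finset.mem_inter]; exact ⟨hu, hu'⟩
    rw [h4] at this; simpa using this
  by_cases hvx : v = x
  · subst hvx
    refine PathOn.symm ?_
    have h3' := h3.symm
    cases h3' with
    | single => exact .single _
    | @cons _ u _ R h p hx =>
      have hp : PathOn G' u a R := p.of_adj (fun u hu v hv h => hG u v h (by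
        intro he
        rw [Sym2.eq_iff] at he
        rcases he with ⟨rfl, rfl⟩ | ⟨rfl, rfl⟩ <;> exact hx ‹_›))
      by_cases huy : u = y
      · subst huy
        exfalso
        obtain ⟨q, hq, hqX⟩ := hy a ha R hp.symm
        have := key q (by simp [hq]) (by simp [hqX])
        subst this
        exact hx hq
      · refine .cons (hG _ _ h ?_) hp hx
        intro he
        rw [Sym2.eq_iff] at he
        rcases he with ⟨_, h⟩ | ⟨_, h⟩
        · exact huy h
        · subst h
          exact hx p.left_mem
  · have hxS : x ∉ S₁ := fun h => hvx (key x h (by simp)).symm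
    refine h3.of_adj (fun u hu v hv h => hG u v h ?_)
    intro he
    rw [Sym2.eq_iff] at he
    rcases he with ⟨rfl, rfl⟩ | ⟨rfl, rfl⟩ <;> exact hxS ‹_›

/-- A path using the edge xy in G avoiding X -/
theorem exists_orient (hG : ∀ u v, G.Adj u v → s(u, v) ≠ s(x, y) → G'.Adj u v)
    (h : PathOn G a b S) (hn : ¬ ∃ R ⊆ S, PathOn G' a b R) :
    ∃ S₁ S₂, S₁ ⊆ S ∧ S₂ ⊆ S ∧ ((PathOn G' a x S₁ ∧ PathOn G' y b S₂) ∨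
      (PathOn G' a y S₁ ∧ PathOn G' x b S₂)) := by
  induction h with
  | single x => exact absurd ⟨_, subset_rfl, .single x⟩ hn
  | @cons u v b S h p hx ih =>
    by_cases he : s(u, v) = s(x, y)
    · have hp : PathOn G' v b S := p.of_adj (fun u' hu v' hv h => hG u' v' h (by
        intro he'
        rw [← he, Sym2.eq_iff] at he'
        rcases he' with ⟨rfl, rfl⟩ | ⟨rfl, rfl⟩ <;> exact hx ‹_›))
      rw [Sym2.eq_iff] at he
      rcases he with ⟨rfl, rfl⟩ | ⟨rfl, rfl⟩
      · exact ⟨{u}, S, by simp, by simp, .inl ⟨.single _, hp⟩⟩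
      · exact ⟨{u}, S, by simp, by simp, .inr ⟨.single _, hp⟩⟩
    · have h' := hG _ _ h he
      obtain ⟨S₁, S₂, h1, h2, h3⟩ := ih (by
        rintro ⟨R, hR, hp⟩
        exact hn ⟨insert u R, Finset.insert_subset_insert _ hR, .cons h' hp (fun h => hx (hR h))⟩)
      refine ⟨insert u S₁, S₂, Finset.insert_subset_insert _ h1,
        h2.trans (Finset.subset_insert _ _), ?_⟩
      rcases h3 with ⟨h3, h4⟩ | ⟨h3, h4⟩
      · exact .inl ⟨.cons h' h3 (fun h => hx (h1 h)), h4⟩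
      · exact .inr ⟨.cons h' h3 (fun h => hx (h1 h)), h4⟩

/-- in a linkage onto T, initial part up to v avoids X -/
theorem initial_avoid {F : V → Finset V} {a : V → V}
    (h1 : ∀ t ∈ T, PathOn G (a t) t (F t))
    (h2 : ∀ i ∈ T, ∀ j ∈ T, i ≠ j → Disjoint (F i) (F j)) (hX : X ⊆ T) {t v : V} (ht : t ∈ T)
    (hv : v ∈ F t) (hvX : v ∉ X) : ∃ R, PathOn G (a t) v R ∧ ∀ u ∈ R, u ∉ X := by
  obtain ⟨S₁, S₂, h3, h4, h5, h6⟩ := (h1 t ht).split hv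
  refine ⟨S₁, h3, fun u hu huX => ?_⟩
  have huF : u ∈ F t := by rw [← h5]; simp [hu]
  have hut : u = t := by
    by_contra hne
    exact Finset.disjoint_left.1 (h2 u (hX huX) t ht hne) (h1 u (hX huX)).right_mem huF
  subst hut
  have : u ∈ S₁ ∩ S₂ := by simp [hu, h4.right_mem]
  rw [h6] at this
  have : u = v := by simpa using this
  exact hvX (this ▸ huX)

theorem combine (hadj : G.Adj x y) (hle : G' ≤ G) (hX : VSep G' A B X)
    (hxX : x ∉ X) (hyX : y ∉ X) (hxk : (insert x X).card = k) (hyk : (insert y X).card = k)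
    (l1 : Linkage G' A (insert x X) k) (l2 : Linkage G' B (insert y X) k) : Linkage G A B k := by
  obtain ⟨a, F, hF, hFd⟩ := l1.onto hxk
  obtain ⟨b, H, hH, hHd⟩ := l2.onto hyk
  have key : ∀ t ∈ insert x X, ∀ s ∈ insert y X, ∀ v ∈ F t, v ∈ H s → v ∈ X := by
    intro t ht s hs v hvF hvH
    by_contra hvX
    obtain ⟨R, hR, hRX⟩ := initial_avoid (fun t ht => (hF t ht).2) hFd
      (Finset.subset_insert x X) ht hvF hvX
    obtain ⟨R', hR', hRX'⟩ := initial_avoid (fun t ht => (hH t ht).2) hHd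
      (Finset.subset_insert y X) hs hvH hvX
    obtain ⟨Q, hQ, hQp⟩ := hR.join hR'.symm
    obtain ⟨u, hu, huX⟩ := hX _ (hF t ht).1 _ (hH s hs).1 Q hQp
    rcases Finset.mem_union.1 (hQ hu) with h | h
    · exact hRX u h huX
    · exact hRX' u h huX
  have key2 : ∀ t ∈ insert x X, ∀ s ∈ insert y X, ∀ v ∈ F t, v ∈ H s → v = t ∧ v = s := by
    intro t ht s hs v hvF hvH
    have hv := key t ht s hs v hvF hvH
    constructor
    · by_contra hne
      have hv' : v ∈ insert x X := by simp [hv]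
      exact Finset.disjoint_left.1 (hFd v hv' t ht hne) (hF v hv').2.right_mem hvF
    · by_contra hne
      have hv' : v ∈ insert y X := by simp [hv]
      exact Finset.disjoint_left.1 (hHd v hv' s hs hne) (hH v hv').2.right_mem hvH
  let σ : V → V := fun t => if t = x then y else t
  have hσ : ∀ t ∈ insert x X, σ t ∈ insert y X := by
    intro t ht
    by_cases h : t = x
    · simp [σ, h]
    · simp only [σ, h, if_false]
      simp only [Finset.mem_insert, h, false_or] at ht
      simp [ht]
  have hσi : ∀ t ∈ insert x X, ∀ s ∈ insert x X, σ t = σ s → t = s := by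
    intro t ht s hs h
    simp only [Finset.mem_insert] at ht hs
    simp only [σ] at h
    split_ifs at h with h1 h2 h2
    · rw [h1, h2]
    · subst h; rcases hs with hs | hs
      · exact absurd hs h2
      · exact absurd hs hyX
    · subst h; rcases ht with hs | hs
      · exact absurd hs h1
      · exact absurd hs hyX
    · exact h
  have hσx : ∀ t ∈ insert x X, ∀ s ∈ insert x X, t ≠ s → t ∈ X → σ s = t → False := by
    intro t ht s hs hts htX h
    simp only [σ] at h
    split_ifs at h with h1
    · subst h; exact hyX htX
    · exact hts h.symm
  refine ⟨insert x X, a, fun t => b (σ t), fun t => F t ∪ H (σ t), hxk, fun t ht => 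
    ⟨(hF t ht).1, (hH _ (hσ t ht)).1, ?_⟩, fun t ht s hs hts => ?_⟩
  · have p1 := (hF t ht).2.mono hle
    have p2 := (hH _ (hσ t ht)).2.symm.mono hle
    by_cases htx : t = x
    · have hs : σ t = y := by simp [σ, htx]
      rw [hs] at p2
      simp only [hs]
      subst htx
      refine p1.append hadj p2 ?_
      rw [Finset.disjoint_left]
      intro v hv hv'
      have := key2 t (by simp) y (by simp) v hv hv'
      exact hadj.ne (this.1.symm.trans this.2)
    · have hs : σ t = t := by simp [σ, htx]
      have hty : t ∈ insert y X := by
        have := hσ t ht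
        rwa [hs] at this
      rw [hs] at p2
      simp only [hs]
      refine p1.glue p2 ?_
      apply Finset.Subset.antisymm
      · intro v hv
        rw [Finset.mem_inter] at hv
        simpa using (key2 t ht t hty v hv.1 hv.2).1
      · simp [p1.right_mem, p2.left_mem]
  · rw [Finset.disjoint_union_left, Finset.disjoint_union_right, Finset.disjoint_union_right]
    refine ⟨⟨hFd t ht s hs hts, ?_⟩, ?_, hHd _ (hσ t ht) _ (hσ s hs) (fun h => hts (hσi t ht s hs h))⟩
    · rw [Finset.disjoint_left]
      intro v hv hv'
      have h1 := key2 t ht _ (hσ s hs) v hv hv'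
      have h2 := key t ht _ (hσ s hs) v hv hv'
      exact hσx t ht s hs hts (h1.1 ▸ h2) (h1.2.symm.trans h1.1)
    · rw [Finset.disjoint_left]
      intro v hv' hv
      have h1 := key2 s hs _ (hσ t ht) v hv hv'
      have h2 := key s hs _ (hσ t ht) v hv hv'
      exact hσx s hs t ht hts.symm (h1.1 ▸ h2) (h1.2.symm.trans h1.1)

theorem menger [Fintype V] (G : SimpleGraph V) (A B : Finset V) (k : ℕ)
    (h : ∀ X, VSep G A B X → k ≤ X.card) : Linkage G A B k := by
  classical
  generalize hN : G.edgeFinset.card = N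
  induction N using Nat.strong_induction_on generalizing G A B with
  | _ N ih =>
  by_cases hE : ∃ x y, G.Adj x y
  · obtain ⟨x, y, hadj⟩ := hE
    set G' := G.deleteEdges {s(x, y)} with hG'
    have hle : G' ≤ G := SimpleGraph.deleteEdges_le _
    have hGG : ∀ u v, G.Adj u v → s(u, v) ≠ s(x, y) → G'.Adj u v := by
      intro u v h1 h2
      rw [hG', SimpleGraph.deleteEdges_adj]
      exact ⟨h1, by simpa using h2⟩
    have hcard : G'.edgeFinset.card < N := by
      rw [← hN]
      apply Finset.card_lt_card
      rw [SimpleGraph.edgeFinset_ssubset_edgeFinset]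
      refine lt_of_le_of_ne hle (fun h => ?_)
      rw [← h, hG', SimpleGraph.deleteEdges_adj] at hadj
      simp at hadj
    by_cases hs : ∀ X, VSep G' A B X → k ≤ X.card
    · obtain ⟨I, a, b, S, h1, h2, h3⟩ := ih _ hcard G' A B hs (by congr!)
      exact ⟨I, a, b, S, h1, fun i hi => ⟨(h2 i hi).1, (h2 i hi).2.1, (h2 i hi).2.2.mono hle⟩, h3⟩
    · push Not at hs
      obtain ⟨X, hX, hXk⟩ := hs
      have hnX : ¬ VSep G A B X := fun hh => by have := h X hh; omega
      have main : ∀ x y, G.Adj x y → (∀ u v, G.Adj u v → s(u, v) ≠ s(x, y) → G'.Adj u v) →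
          ∀ a ∈ A, ∀ b ∈ B, ∀ S₁ S₂, (∀ v ∈ S₁, v ∉ X) → (∀ v ∈ S₂, v ∉ X) → 
          PathOn G' a x S₁ → PathOn G' y b S₂ → Linkage G A B k := by
        intro x y hadj hGG a ha b hb S₁ S₂ h1 h2 p1 p2
        have sx : ∀ z, (z = x ∨ z = y) → VSep G A B (insert z X) := by
          intro z hz a ha b hb S hS
          by_contra hcon
          push Not at hcon
          have : z ∉ S := fun h => hcon z h (by simp)
          obtain ⟨v, hv, hvX⟩ := hX a ha b hb S (hS.of_adj fun u hu v hv h => hGG u v h (by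
            intro he
            rw [Sym2.eq_iff] at he
            rcases hz with rfl | rfl <;> rcases he with ⟨rfl, rfl⟩ | ⟨rfl, rfl⟩ <;> exact this ‹_›))
          exact hcon v hv (by simp [hvX])
        have sxx := sx x (.inl rfl)
        have syy := sx y (.inr rfl)
        have hxX : x ∉ X := h1 x p1.right_mem
        have hyX : y ∉ X := h2 y p2.left_mem
        have c1 := h _ sxx
        have c2 := h _ syy
        have d1 := Finset.card_insert_of_notMem hxX
        have d2 := Finset.card_insert_of_notMem hyX
        refine combine hadj hle hX hxX hyX (by omega) (by omega) ?_ ?_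
        · refine ih _ hcard G' _ _ (fun Z hZ => h Z (sep_side hGG sxx ?_ hxX hZ)) (by congr!)
          intro a' ha' S hS
          obtain ⟨Q, hQ, hQp⟩ := hS.join p2
          obtain ⟨v, hv, hvX⟩ := hX a' ha' b hb Q hQp
          rcases Finset.mem_union.1 (hQ hv) with h | h
          · exact ⟨v, h, hvX⟩
          · exact absurd hvX (h2 v h)
        · refine ih _ hcard G' _ _ (fun Z hZ => h Z 
            (sep_side (A := B) (B := A) (x := y) (y := x) ?_ syy.symm ?_ hyX hZ).symm) (by congr!)
          · intro u v h1 h2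
            exact hGG u v h1 (by rwa [Sym2.eq_swap (a := x)])
          intro b' hb' S hS
          obtain ⟨Q, hQ, hQp⟩ := hS.join p1.symm
          obtain ⟨v, hv, hvX⟩ := hX a ha b' hb' Q hQp.symm
          rcases Finset.mem_union.1 (hQ hv) with h | h
          · exact ⟨v, h, hvX⟩
          · exact absurd hvX (h1 v h)
      unfold VSep at hnX
      push Not at hnX
      obtain ⟨a, ha, b, hb, S, hS, hSX⟩ := hnX
      obtain ⟨S₁, S₂, h1, h2, h3⟩ := exists_orient hGG hS (by
        rintro ⟨R, hR, hp⟩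
        obtain ⟨v, hv, hvX⟩ := hX a ha b hb R hp
        exact hSX v (hR hv) hvX)
      rcases h3 with ⟨h3, h4⟩ | ⟨h3, h4⟩
      · exact main x y hadj hGG a ha b hb S₁ S₂ (fun v hv => hSX v (h1 hv))
          (fun v hv => hSX v (h2 hv)) h3 h4
      · exact main y x hadj.symm (fun u v h1 h2 => hGG u v h1 (by rwa [Sym2.eq_swap (a := x)]))
          a ha b hb S₁ S₂ (fun v hv => hSX v (h1 hv))
          (fun v hv => hSX v (h2 hv)) h3 h4
  · push Not at hE
    have hsep : VSep G A B (A ∩ B) := by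
      intro a ha b hb S hS
      cases hS with
      | single => exact ⟨a, by simp, by simp [ha, hb]⟩
      | cons h => exact absurd h (hE _ _)
    obtain ⟨I, hI, hIk⟩ := Finset.exists_subset_card_eq (h _ hsep)
    refine ⟨I, id, id, fun i => {i}, hIk, fun i hi => ?_, fun i _ j _ hij => by simpa using hij⟩
    have := hI hi
    rw [Finset.mem_inter] at this
    exact ⟨this.1, this.2, .single i⟩

end Menger

end

section

section Surgery
variable {V : Type} [DecidableEq V] {G : SimpleGraph V} {x y z w a b : V}
  {X Z S T P P' Q Q' P₁ P₂ P₃ P₄ : Finset V}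

def Link (G : SimpleGraph V) (x y : V) (Q : Finset V) : Prop :=
  ∀ a b S T, PathOn G a x S → PathOn G y b T → Disjoint S Q → Disjoint Q T → Disjoint S T →
    PathOn G a b (S ∪ Q ∪ T)

theorem Link.of_path {R : Finset V} (h : PathOn G x y R) (hxy : x ≠ y) :
    Link G x y ((R.erase x).erase y) := by
  intro a b S T hS hT h1 h2 h3
  cases h with
  | single => exact absurd rfl hxy
  | @cons _ u _ R' e p hx =>
    rw [Finset.erase_insert hx] at *
    have p' := p.symm
    cases p' with
    | single =>
      have : ({y} : Finset V).erase y = ∅ := by simp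
      rw [this, Finset.union_empty]
      exact hS.append e hT h3
    | @cons _ v _ R'' e' q hy =>
      rw [Finset.erase_insert hy] at *
      refine (hS.append e q.symm h1).append e'.symm hT ?_
      rw [Finset.disjoint_union_left]
      exact ⟨h3, h2⟩

theorem Link.symm (h : Link G x y Q) : Link G y x Q := by
  intro a b S T hS hT h1 h2 h3
  have := h b a T S hT.symm hS.symm h2.symm h1.symm h3.symm
  rw [show S ∪ Q ∪ T = T ∪ Q ∪ S by
    rw [Finset.union_comm _ T, Finset.union_comm S Q, Finset.union_assoc]]
  exact this.symm

theorem Link.trans (h : Link G x z Q) (p : PathOn G z w P) (h' : Link G w y Q')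
    (h1 : Disjoint Q P) (h2 : Disjoint P Q') (h3 : Disjoint Q Q') : Link G x y (Q ∪ P ∪ Q') := by
  intro a b S T hS hT h4 h5 h6
  simp only [Finset.disjoint_union_left, Finset.disjoint_union_right] at h4 h5
  have := h' _ _ _ _ (h _ _ _ _ hS p h4.1.1 h1 h4.1.2) hT (by
    simp only [Finset.disjoint_union_left]; exact ⟨⟨h4.2, h3⟩, h2⟩) h5.2 (by
    simp only [Finset.disjoint_union_left]; exact ⟨⟨h6, h5.1.1⟩, h5.1.2⟩)
  simpa only [Finset.union_assoc] using this

structure CP (G : SimpleGraph V) (ℓ : ℕ) (c : ℕ → V) : Prop where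
  inj : Set.InjOn c (Set.Iio ℓ)
  adj : ∀ i, i + 1 < ℓ → G.Adj (c i) (c (i+1))
  max : ∀ S, PathOn G (c 0) (c (ℓ-1)) S → S.card ≤ ℓ

namespace CP
variable {ℓ : ℕ} {c : ℕ → V} (h : CP G ℓ c)
include h

theorem seg {i j : ℕ} (hij : i ≤ j) (hj : j < ℓ) :
    PathOn G (c i) (c j) ((Finset.Icc i j).image c) := PathOn.seg h.inj h.adj hij hj

theorem dis {i j i' j' : ℕ} (hj : j < ℓ) (hj' : j' < ℓ) (hd : j < i' ∨ j' < i) :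
    Disjoint ((Finset.Icc i j).image c) ((Finset.Icc i' j').image c) := by
  rw [Finset.disjoint_left]
  intro v hv hv'
  simp only [Finset.mem_image, Finset.mem_Icc] at hv hv'
  obtain ⟨k, hk, rfl⟩ := hv
  obtain ⟨k', hk', he⟩ := hv'
  have := h.inj (by simp; omega) (by simp; omega) he
  omega

theorem sub {i j : ℕ} (hj : j < ℓ) : (Finset.Icc i j).image c ⊆ (Finset.range ℓ).image c := by
  apply Finset.image_subset_image
  intro k hk
  simp at hk ⊢
  omega

theorem disP {i j : ℕ} (hj : j < ℓ) (hP : Disjoint P ((Finset.range ℓ).image c)) :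
    Disjoint P ((Finset.Icc i j).image c) := Finset.disjoint_of_subset_right (h.sub hj) hP

theorem card {i j : ℕ} (hj : j < ℓ) : ((Finset.Icc i j).image c).card = j + 1 - i := by
  rw [Finset.card_image_of_injOn, Nat.card_Icc]
  intro a ha b hb hab
  simp at ha hb
  exact h.inj (by simp; omega) (by simp; omega) hab

theorem single {i₁ i₂ : ℕ} (h12 : i₁ < i₂) (h2 : i₂ < ℓ) (L : Link G (c i₁) (c i₂) P)
    (hP : Disjoint P ((Finset.range ℓ).image c)) : P.card + i₁ + 1 ≤ i₂ := by
  have p := L _ _ _ _ (h.seg (Nat.zero_le i₁) (by omega)) (h.seg (show i₂ ≤ ℓ - 1 by omega) (by omega))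
    (h.disP (by omega) hP).symm (h.disP (by omega) hP) (h.dis (by omega) (by omega) (by omega))
  have := h.max _ p
  rw [Finset.card_union_of_disjoint, Finset.card_union_of_disjoint, h.card, h.card] at this
  · omega
  · omega
  · omega
  · exact (h.disP (by omega) hP).symm
  · rw [Finset.disjoint_union_left]
    exact ⟨h.dis (by omega) (by omega) (by omega), h.disP (by omega) hP⟩

theorem twSeg {lo hi p₁ p₂ p₃ p₄ : ℕ} (h0 : lo ≤ p₁) (h1 : p₁ < p₂) (h2 : p₂ < p₃) (h3 : p₃ < p₄)
    (h4 : p₄ ≤ hi) (h5 : hi < ℓ) (L : Link G (c p₁) (c p₃) P) (L' : Link G (c p₂) (c p₄) P')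
    (hP : Disjoint P ((Finset.range ℓ).image c)) (hP' : Disjoint P' ((Finset.range ℓ).image c))
    (hPP : Disjoint P P') :
    ∃ S, S ⊆ (Finset.Icc lo hi).image c ∪ P ∪ P' ∧ PathOn G (c lo) (c hi) S ∧
      S.card + p₂ + p₄ + lo = hi + p₁ + p₃ + 3 + P.card + P'.card := by
  have d1 : Disjoint ((Finset.Icc lo p₁).image c) ((Finset.Icc p₂ p₃).image c) :=
    h.dis (by omega) (by omega) (by omega)
  have d2 : Disjoint ((Finset.Icc lo p₁).image c) ((Finset.Icc p₄ hi).image c) :=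
    h.dis (by omega) (by omega) (by omega)
  have d3 : Disjoint ((Finset.Icc p₂ p₃).image c) ((Finset.Icc p₄ hi).image c) :=
    h.dis (by omega) (by omega) (by omega)
  have e1 := h.disP (i := lo) (j := p₁) (by omega) hP
  have e2 := h.disP (i := p₂) (j := p₃) (by omega) hP
  have e3 := h.disP (i := p₄) (j := hi) (by omega) hP
  have f1 := h.disP (i := lo) (j := p₁) (by omega) hP'
  have f2 := h.disP (i := p₂) (j := p₃) (by omega) hP'
  have f3 := h.disP (i := p₄) (j := hi) (by omega) hP'
  have s1 := h.seg (i := lo) (j := p₁) (by omega) (by omega)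
  have s2 := h.seg (i := p₂) (j := p₃) (by omega) (by omega)
  have s3 := h.seg (i := p₄) (j := hi) (by omega) (by omega)
  have g1 : Disjoint ((Finset.Icc lo p₁).image c ∪ P ∪ (Finset.Icc p₂ p₃).image c) P' := by
    simp only [Finset.disjoint_union_left]; exact ⟨⟨f1.symm, hPP⟩, f2.symm⟩
  have g2 : Disjoint ((Finset.Icc lo p₁).image c ∪ P ∪ (Finset.Icc p₂ p₃).image c)
      ((Finset.Icc p₄ hi).image c) := by
    simp only [Finset.disjoint_union_left]; exact ⟨⟨d2, e3⟩, d3⟩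
  refine ⟨_, ?_, L' _ _ _ _ (L _ _ _ _ s1 s2.symm e1.symm e2 d1) s3 g1 f3 g2, ?_⟩
  · have t : ∀ {a b : ℕ}, lo ≤ a → b ≤ hi →
        (Finset.Icc a b).image c ⊆ (Finset.Icc lo hi).image c ∪ P ∪ P' := fun ha hb =>
      (Finset.image_subset_image (Finset.Icc_subset_Icc ha hb)).trans
        (Finset.subset_union_left.trans Finset.subset_union_left)
    refine Finset.union_subset (Finset.union_subset (Finset.union_subset (Finset.union_subset
      (t ?_ ?_) ?_) (t ?_ ?_)) ?_) (t ?_ ?_) <;> first | omega | skip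
    · exact Finset.subset_union_right.trans Finset.subset_union_left
    · exact Finset.subset_union_right
  · rw [Finset.card_union_of_disjoint, Finset.card_union_of_disjoint g1,
      Finset.card_union_of_disjoint, Finset.card_union_of_disjoint e1.symm,
      h.card, h.card, h.card]
    · omega
    · omega
    · omega
    · omega
    · rw [Finset.disjoint_union_left]; exact ⟨d1, e2⟩
    · rw [Finset.disjoint_union_left]; exact ⟨g2, f3⟩

theorem twist {p₁ p₂ p₃ p₄ : ℕ} (h1 : p₁ < p₂) (h2 : p₂ < p₃) (h3 : p₃ < p₄)
    (h4 : p₄ < ℓ) (L : Link G (c p₁) (c p₃) P) (L' : Link G (c p₂) (c p₄) P')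
    (hP : Disjoint P ((Finset.range ℓ).image c)) (hP' : Disjoint P' ((Finset.range ℓ).image c))
    (hPP : Disjoint P P') : P.card + P'.card + p₁ + p₃ + 2 ≤ p₂ + p₄ := by
  obtain ⟨S, -, hS, hc⟩ := h.twSeg (lo := 0) (hi := ℓ - 1) (by omega) h1 h2 h3 (by omega) (by omega)
    L L' hP hP' hPP
  have := h.max S hS
  omega

theorem twoTwist {p₁ p₂ p₃ p₄ p₅ p₆ p₇ p₈ : ℕ} (h1 : p₁ < p₂) (h2 : p₂ < p₃) (h3 : p₃ < p₄)
    (h4 : p₄ < p₅) (h5 : p₅ < p₆) (h6 : p₆ < p₇) (h7 : p₇ < p₈) (h8 : p₈ < ℓ)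
    (L1 : Link G (c p₁) (c p₃) P₁) (L2 : Link G (c p₂) (c p₄) P₂)
    (L3 : Link G (c p₅) (c p₇) P₃) (L4 : Link G (c p₆) (c p₈) P₄)
    (hP1 : Disjoint P₁ ((Finset.range ℓ).image c)) (hP2 : Disjoint P₂ ((Finset.range ℓ).image c))
    (hP3 : Disjoint P₃ ((Finset.range ℓ).image c)) (hP4 : Disjoint P₄ ((Finset.range ℓ).image c))
    (h12 : Disjoint P₁ P₂) (h13 : Disjoint P₁ P₃) (h14 : Disjoint P₁ P₄) (h23 : Disjoint P₂ P₃)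
    (h24 : Disjoint P₂ P₄) (h34 : Disjoint P₃ P₄) :
    P₁.card + P₂.card + P₃.card + P₄.card + p₁ + p₃ + p₅ + p₇ + 4 ≤ p₂ + p₄ + p₆ + p₈ := by
  obtain ⟨S, hs, hS, hc⟩ := h.twSeg (lo := 0) (hi := p₄) (by omega) h1 h2 h3 (by omega) (by omega)
    L1 L2 hP1 hP2 h12
  obtain ⟨S', hs', hS', hc'⟩ := h.twSeg (lo := p₄ + 1) (hi := ℓ - 1) (by omega) h5 h6 h7 (by omega)
    (by omega) L3 L4 hP3 hP4 h34
  have hd : Disjoint S S' := by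
    refine Finset.disjoint_of_subset_left hs (Finset.disjoint_of_subset_right hs' ?_)
    simp only [Finset.disjoint_union_left, Finset.disjoint_union_right]
    refine ⟨⟨⟨⟨h.dis ?_ ?_ ?_, h.disP ?_ hP1⟩, h.disP ?_ hP2⟩, ⟨(h.disP ?_ hP3).symm, h13⟩, h23⟩,
      ⟨(h.disP ?_ hP4).symm, h14⟩, h24⟩ <;> omega
  have := h.max _ (hS.append (h.adj p₄ (by omega)) hS' hd)
  rw [Finset.card_union_of_disjoint hd] at this
  omega

theorem cross {i₁ i₂ i₃ i₄ i₅ i₆ i₇ i₈ : ℕ} (h1 : i₁ < i₂) (h2 : i₂ < i₃) (h3 : i₃ < i₄)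
    (h4 : i₄ < i₅) (h5 : i₅ < i₆) (h6 : i₆ < i₇) (h7 : i₇ < i₈) (h8 : i₈ < ℓ)
    (L1 : Link G (c i₁) (c i₆) P₁) (L2 : Link G (c i₇) (c i₄) P₂)
    (L3 : Link G (c i₅) (c i₂) P₃) (L4 : Link G (c i₃) (c i₈) P₄)
    (hP1 : Disjoint P₁ ((Finset.range ℓ).image c)) (hP2 : Disjoint P₂ ((Finset.range ℓ).image c))
    (hP3 : Disjoint P₃ ((Finset.range ℓ).image c)) (hP4 : Disjoint P₄ ((Finset.range ℓ).image c))
    (h12 : Disjoint P₁ P₂) (h13 : Disjoint P₁ P₃) (h14 : Disjoint P₁ P₄) (h23 : Disjoint P₂ P₃)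
    (h24 : Disjoint P₂ P₄) (h34 : Disjoint P₃ P₄) :
    P₁.card + P₂.card + P₃.card + P₄.card + i₁ + i₃ + i₅ + i₇ + 4 ≤ i₂ + i₄ + i₆ + i₈ := by
  have a1 := h.disP (i := 0) (j := i₁) (by omega) hP1
  have a2 := h.disP (i := i₆) (j := i₇) (by omega) hP1
  have a3 := h.disP (i := i₄) (j := i₅) (by omega) hP1
  have a4 := h.disP (i := i₂) (j := i₃) (by omega) hP1
  have a5 := h.disP (i := i₈) (j := ℓ-1) (by omega) hP1
  have b1 := h.disP (i := 0) (j := i₁) (by omega) hP2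
  have b2 := h.disP (i := i₆) (j := i₇) (by omega) hP2
  have b3 := h.disP (i := i₄) (j := i₅) (by omega) hP2
  have b4 := h.disP (i := i₂) (j := i₃) (by omega) hP2
  have b5 := h.disP (i := i₈) (j := ℓ-1) (by omega) hP2
  have c1 := h.disP (i := 0) (j := i₁) (by omega) hP3
  have c2 := h.disP (i := i₆) (j := i₇) (by omega) hP3
  have c3 := h.disP (i := i₄) (j := i₅) (by omega) hP3
  have c4 := h.disP (i := i₂) (j := i₃) (by omega) hP3
  have c5 := h.disP (i := i₈) (j := ℓ-1) (by omega) hP3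
  have d1 := h.disP (i := 0) (j := i₁) (by omega) hP4
  have d2 := h.disP (i := i₆) (j := i₇) (by omega) hP4
  have d3 := h.disP (i := i₄) (j := i₅) (by omega) hP4
  have d4 := h.disP (i := i₂) (j := i₃) (by omega) hP4
  have d5 := h.disP (i := i₈) (j := ℓ-1) (by omega) hP4
  have e12 := h.dis (i := 0) (j := i₁) (i' := i₆) (j' := i₇) (by omega) (by omega) (by omega)
  have e13 := h.dis (i := 0) (j := i₁) (i' := i₄) (j' := i₅) (by omega) (by omega) (by omega)
  have e14 := h.dis (i := 0) (j := i₁) (i' := i₂) (j' := i₃) (by omega) (by omega) (by omega)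
  have e15 := h.dis (i := 0) (j := i₁) (i' := i₈) (j' := ℓ-1) (by omega) (by omega) (by omega)
  have e23 := h.dis (i := i₆) (j := i₇) (i' := i₄) (j' := i₅) (by omega) (by omega) (by omega)
  have e24 := h.dis (i := i₆) (j := i₇) (i' := i₂) (j' := i₃) (by omega) (by omega) (by omega)
  have e25 := h.dis (i := i₆) (j := i₇) (i' := i₈) (j' := ℓ-1) (by omega) (by omega) (by omega)
  have e34 := h.dis (i := i₄) (j := i₅) (i' := i₂) (j' := i₃) (by omega) (by omega) (by omega)
  have e35 := h.dis (i := i₄) (j := i₅) (i' := i₈) (j' := ℓ-1) (by omega) (by omega) (by omega)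
  have e45 := h.dis (i := i₂) (j := i₃) (i' := i₈) (j' := ℓ-1) (by omega) (by omega) (by omega)
  have s1 := h.seg (i := 0) (j := i₁) (by omega) (by omega)
  have s2 := h.seg (i := i₆) (j := i₇) (by omega) (by omega)
  have s3 := h.seg (i := i₄) (j := i₅) (by omega) (by omega)
  have s4 := h.seg (i := i₂) (j := i₃) (by omega) (by omega)
  have s5 := h.seg (i := i₈) (j := ℓ-1) (by omega) (by omega)
  have k1 := h.card (i := 0) (j := i₁) (by omega)
  have k2 := h.card (i := i₆) (j := i₇) (by omega)
  have k3 := h.card (i := i₄) (j := i₅) (by omega)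
  have k4 := h.card (i := i₂) (j := i₃) (by omega)
  have k5 := h.card (i := i₈) (j := ℓ-1) (by omega)
  have hmax := h.max
  generalize (Finset.Icc 0 i₁).image c = A1 at *
  generalize (Finset.Icc i₆ i₇).image c = A2 at *
  generalize (Finset.Icc i₄ i₅).image c = A3 at *
  generalize (Finset.Icc i₂ i₃).image c = A4 at *
  generalize (Finset.Icc i₈ (ℓ-1)).image c = A5 at *
  have q1 := L1 _ _ _ _ s1 s2 a1.symm a2 e12
  have t1 : Disjoint (A1 ∪ P₁ ∪ A2) P₂ := by
    simp only [Finset.disjoint_union_left]; exact ⟨⟨b1.symm, h12⟩, b2.symm⟩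
  have t2 : Disjoint (A1 ∪ P₁ ∪ A2) A3 := by
    simp only [Finset.disjoint_union_left]; exact ⟨⟨e13, a3⟩, e23⟩
  have q2 := L2 _ _ _ _ q1 s3 t1 b3 t2
  have t3 : Disjoint (A1 ∪ P₁ ∪ A2 ∪ P₂ ∪ A3) P₃ := by
    simp only [Finset.disjoint_union_left]; exact ⟨⟨⟨⟨c1.symm, h13⟩, c2.symm⟩, h23⟩, c3.symm⟩
  have t4 : Disjoint (A1 ∪ P₁ ∪ A2 ∪ P₂ ∪ A3) A4 := by
    simp only [Finset.disjoint_union_left]; exact ⟨⟨⟨⟨e14, a4⟩, e24⟩, b4⟩, e34⟩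
  have q3 := L3 _ _ _ _ q2 s4 t3 c4 t4
  have t5 : Disjoint (A1 ∪ P₁ ∪ A2 ∪ P₂ ∪ A3 ∪ P₃ ∪ A4) P₄ := by
    simp only [Finset.disjoint_union_left]
    exact ⟨⟨⟨⟨⟨⟨d1.symm, h14⟩, d2.symm⟩, h24⟩, d3.symm⟩, h34⟩, d4.symm⟩
  have t6 : Disjoint (A1 ∪ P₁ ∪ A2 ∪ P₂ ∪ A3 ∪ P₃ ∪ A4) A5 := by
    simp only [Finset.disjoint_union_left]
    exact ⟨⟨⟨⟨⟨⟨e15, a5⟩, e25⟩, b5⟩, e35⟩, c5⟩, e45⟩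
  have q4 := L4 _ _ _ _ q3 s5 t5 d5 t6
  have := hmax _ q4
  rw [Finset.card_union_of_disjoint (Finset.disjoint_union_left.2 ⟨t6, d5⟩),
    Finset.card_union_of_disjoint t5,
    Finset.card_union_of_disjoint (Finset.disjoint_union_left.2 ⟨t4, c4⟩),
    Finset.card_union_of_disjoint t3,
    Finset.card_union_of_disjoint (Finset.disjoint_union_left.2 ⟨t2, b3⟩),
    Finset.card_union_of_disjoint t1,
    Finset.card_union_of_disjoint (Finset.disjoint_union_left.2 ⟨e12, a2⟩),
    Finset.card_union_of_disjoint a1.symm] at this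
  omega

end CP
end Surgery

end

section

section ConfSec
variable {V : Type} [DecidableEq V] {G : SimpleGraph V} 

def Rg {ι : Type} (Q : ι → Finset V) (d : ℕ → V) (j : ι → ℕ) (e f : ι) : Finset V :=
  Q e ∪ (Finset.uIcc (j e) (j f)).image d ∪ Q f

structure Conf (G : SimpleGraph V) (ℓ : ℕ) (c d : ℕ → V) {ι : Type} (i j : ι → ℕ)
    (Q : ι → Finset V) (α β : ι → ℕ) : Prop where
  hc : CP G ℓ c
  hd : CP G ℓ d
  ilt : ∀ e, i e < ℓ
  jlt : ∀ e, j e < ℓ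
  link : ∀ e, Link G (c (i e)) (d (j e)) (Q e)
  Qdis : ∀ e f, e ≠ f → Disjoint (Q e) (Q f)
  QC : ∀ e, Disjoint (Q e) ((Finset.range ℓ).image c)
  QD : ∀ e, Disjoint (Q e) ((Finset.range ℓ).image d)
  iinj : ∀ e f, i e = i f → e = f
  jinj : ∀ e f, j e = j f → e = f
  αlt : ∀ e f, α e < α f → i e < i f
  βlt : ∀ e f, β e < β f → j e < j f
  αseg : ∀ e f, α e = α f → Disjoint ((Finset.uIcc (i e) (i f)).image c) ((Finset.range ℓ).image d)
  βseg : ∀ e f, β e = β f → Disjoint ((Finset.uIcc (j e) (j f)).image d) ((Finset.range ℓ).image c)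

namespace Conf
variable {ℓ : ℕ} {c d : ℕ → V} {ι : Type} {i j : ι → ℕ} {Q : ι → Finset V} {α β : ι → ℕ}

theorem symm (h : Conf G ℓ c d i j Q α β) : Conf G ℓ d c j i Q β α :=
  ⟨h.hd, h.hc, h.jlt, h.ilt, fun e => (h.link e).symm, h.Qdis, h.QD, h.QC, h.jinj, h.iinj, h.βlt,
    h.αlt, h.βseg, h.αseg⟩

variable (h : Conf G ℓ c d i j Q α β) {e f e' f' : ι}
include h

theorem uIcc_sub : (Finset.uIcc (j e) (j f)).image d ⊆ (Finset.range ℓ).image d := by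
  apply Finset.image_subset_image
  intro k hk
  have := h.jlt e
  have := h.jlt f
  simp [Finset.mem_uIcc] at hk ⊢
  omega

theorem rung (hef : e ≠ f) : Link G (c (i e)) (c (i f)) (Rg Q d j e f) := by
  refine Link.trans (h.link e) ?_ (h.link f).symm ?_ ?_ (h.Qdis e f hef)
  · rcases le_total (j e) (j f) with hle | hle
    · rw [Finset.uIcc_of_le hle]; exact h.hd.seg hle (h.jlt f)
    · rw [Finset.uIcc_of_ge hle]; exact (h.hd.seg hle (h.jlt e)).symm
  · exact Finset.disjoint_of_subset_right h.uIcc_sub (h.QD e)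
  · exact (Finset.disjoint_of_subset_right h.uIcc_sub (h.QD f)).symm

theorem rungC (hβ : β e = β f) : Disjoint (Rg Q d j e f) ((Finset.range ℓ).image c) := by
  unfold Rg
  simp only [Finset.disjoint_union_left]
  exact ⟨⟨h.QC e, h.βseg e f hβ⟩, h.QC f⟩

theorem rungcard : (j e - j f) + (j f - j e) + 1 ≤ (Rg Q d j e f).card := by
  have h1 : ((Finset.uIcc (j e) (j f)).image d).card ≤ (Rg Q d j e f).card :=
    Finset.card_le_card (Finset.subset_union_right.trans Finset.subset_union_left)
  rcases le_total (j e) (j f) with hle | hle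
  · rw [Finset.uIcc_of_le hle, h.hd.card (h.jlt f)] at h1; omega
  · rw [Finset.uIcc_of_ge hle, h.hd.card (h.jlt e)] at h1; omega

theorem rungdis (h1 : β e = β f) (h2 : β e' = β f') (h3 : β e ≠ β e') :
    Disjoint (Rg Q d j e f) (Rg Q d j e' f') := by
  unfold Rg
  have n1 : e ≠ e' := fun h => h3 (by rw [h])
  have n2 : e ≠ f' := fun h => h3 (by rw [h2, h])
  have n3 : f ≠ e' := fun h => h3 (by rw [h1, h])
  have n4 : f ≠ f' := fun h => h3 (by rw [h1, h2, h])
  simp only [Finset.disjoint_union_left, Finset.disjoint_union_right]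
  refine ⟨⟨⟨⟨h.Qdis _ _ n1, ?_⟩, h.Qdis _ _ n3⟩, ⟨?_, ?_⟩, ?_⟩, ⟨h.Qdis _ _ n2, ?_⟩, h.Qdis _ _ n4⟩
  · exact (Finset.disjoint_of_subset_right h.uIcc_sub (h.QD e')).symm
  · exact Finset.disjoint_of_subset_right h.uIcc_sub (h.QD e)
  · rw [Finset.disjoint_left]
    intro v hv hv'
    simp only [Finset.mem_image, Finset.mem_uIcc] at hv hv'
    obtain ⟨k, hk, rfl⟩ := hv
    obtain ⟨k', hk', he⟩ := hv'
    have := h.jlt e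
    have := h.jlt e'
    have := h.jlt f
    have := h.jlt f'
    have := h.hd.inj (by simp; omega) (by simp; omega) he
    rcases lt_or_gt_of_ne h3 with h3 | h3
    · have := h.βlt e e' h3
      have := h.βlt e f' (by omega)
      have := h.βlt f e' (by omega)
      have := h.βlt f f' (by omega)
      omega
    · have := h.βlt e' e h3
      have := h.βlt f' e (by omega)
      have := h.βlt e' f (by omega)
      have := h.βlt f' f (by omega)
      omega
  · exact Finset.disjoint_of_subset_right h.uIcc_sub (h.QD f)
  · exact (Finset.disjoint_of_subset_right h.uIcc_sub (h.QD f')).symm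

theorem no_double (hef : e ≠ f) (hα : α e = α f) (hβ : β e = β f) : False := by
  have key : ∀ e f, e ≠ f → α e = α f → β e = β f → i e < i f → False := by
    intro e f hef hα hβ hlt
    have h1 := h.hc.single hlt (h.ilt f) (h.rung hef) (h.rungC hβ)
    have h2 := h.rungcard (e := e) (f := f)
    have h4 := h.symm.rungcard (e := e) (f := f)
    have h5 := h.symm.rungcard (e := f) (f := e)
    rcases lt_trichotomy (j e) (j f) with h6 | h6 | h6
    · have h3 := h.hd.single h6 (h.jlt f) (h.symm.rung hef) (h.symm.rungC hα)
      omega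
    · exact hef (h.jinj _ _ h6)
    · have h3 := h.hd.single h6 (h.jlt e) (h.symm.rung hef.symm) (h.symm.rungC hα.symm)
      omega
  rcases lt_trichotomy (i e) (i f) with h6 | h6 | h6
  · exact key e f hef hα hβ h6
  · exact hef (h.iinj _ _ h6)
  · exact key f e hef.symm hα.symm hβ.symm h6

/-- Normalised twisted band on the `d` side. -/
theorem band {e₁ e₂ e₃ e₄ : ι} (a13 : α e₁ = α e₃) (a24 : α e₂ = α e₄) (a12 : α e₁ ≠ α e₂)
    (b12 : β e₁ = β e₂) (b34 : β e₃ = β e₄) (b13 : β e₁ ≠ β e₃)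
    (ho : (j e₁ < j e₂ ∧ j e₃ < j e₄) ∨ (j e₂ < j e₁ ∧ j e₄ < j e₃)) :
    ∃ p₁ p₂ p₃ p₄ : ℕ, ∃ P P' : Finset V, p₁ < p₂ ∧ p₂ < p₃ ∧ p₃ < p₄ ∧ p₄ < ℓ ∧
      Link G (d p₁) (d p₃) P ∧ Link G (d p₂) (d p₄) P' ∧
      Disjoint P ((Finset.range ℓ).image d) ∧ Disjoint P' ((Finset.range ℓ).image d) ∧
      Disjoint P P' ∧ P ∪ P' ⊆ Rg Q c i e₁ e₃ ∪ Rg Q c i e₂ e₄ ∧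
      (p₁ = j e₁ ∨ p₁ = j e₂ ∨ p₁ = j e₃ ∨ p₁ = j e₄) ∧
      (p₄ = j e₁ ∨ p₄ = j e₂ ∨ p₄ = j e₃ ∨ p₄ = j e₄) ∧
      p₂ + p₄ ≤ p₁ + p₃ + ((j e₁ - j e₂) + (j e₂ - j e₁) + (j e₃ - j e₄) + (j e₄ - j e₃)) ∧
      (i e₁ - i e₃) + (i e₃ - i e₁) + (i e₂ - i e₄) + (i e₄ - i e₂) + 2 ≤ P.card + P'.card := by
  have n13 : e₁ ≠ e₃ := fun h => b13 (by rw [h])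
  have n24 : e₂ ≠ e₄ := fun h => b13 (by rw [b12, b34, h])
  have hs : ∀ e f, Rg Q c i e f = Rg Q c i f e := by
    intro e f
    unfold Rg
    rw [Finset.uIcc_comm, Finset.union_comm, Finset.union_comm (Q e), Finset.union_assoc]
  have r13 := h.symm.rung n13
  have r24 := h.symm.rung n24
  have r31 := h.symm.rung n13.symm
  have r42 := h.symm.rung n24.symm
  rw [hs] at r31 r42
  have d13 := h.symm.rungC a13
  have d24 := h.symm.rungC a24
  have dd := h.symm.rungdis a13 a24 a12
  have c13 := h.symm.rungcard (e := e₁) (f := e₃)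
  have c24 := h.symm.rungcard (e := e₂) (f := e₄)
  have l1 := h.jlt e₁
  have l2 := h.jlt e₂
  have l3 := h.jlt e₃
  have l4 := h.jlt e₄
  rcases lt_or_gt_of_ne b13 with hb | hb
  · have := h.βlt e₁ e₃ hb
    have := h.βlt e₁ e₄ (by omega)
    have := h.βlt e₂ e₃ (by omega)
    have := h.βlt e₂ e₄ (by omega)
    rcases ho with ho | ho
    · exact ⟨j e₁, j e₂, j e₃, j e₄, _, _, by omega, by omega, by omega, by omega, r13, r24,
        d13, d24, dd, subset_rfl, by omega, by omega, by omega, by omega⟩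
    · exact ⟨j e₂, j e₁, j e₄, j e₃, _, _, by omega, by omega, by omega, by omega, r24, r13,
        d24, d13, dd.symm, (Finset.union_comm _ _).subset, by omega, by omega, by omega, by omega⟩
  · have := h.βlt e₃ e₁ hb
    have := h.βlt e₄ e₁ (by omega)
    have := h.βlt e₃ e₂ (by omega)
    have := h.βlt e₄ e₂ (by omega)
    rcases ho with ho | ho
    · exact ⟨j e₃, j e₄, j e₁, j e₂, _, _, by omega, by omega, by omega, by omega, r31, r42,
        d13, d24, dd, subset_rfl, by omega, by omega, by omega, by omega⟩
    · exact ⟨j e₄, j e₃, j e₂, j e₁, _, _, by omega, by omega, by omega, by omega, r42, r31,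
        d24, d13, dd.symm, (Finset.union_comm _ _).subset, by omega, by omega, by omega, by omega⟩

theorem no_twist {e₁ e₂ e₃ e₄ : ι} (a13 : α e₁ = α e₃) (a24 : α e₂ = α e₄) (a12 : α e₁ < α e₂)
    (b12 : β e₁ = β e₂) (b34 : β e₃ = β e₄) (b13 : β e₁ ≠ β e₃)
    (ho : (j e₁ < j e₂ ∧ j e₃ < j e₄) ∨ (j e₂ < j e₁ ∧ j e₄ < j e₃))
    (hi : i e₁ < i e₃) (hi' : i e₂ < i e₄) : False := by
  obtain ⟨p₁, p₂, p₃, p₄, P, P', h1, h2, h3, h4, L, L', hP, hP', hPP, -, -, -, hs1, hs2⟩ :=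
    h.band a13 a24 a12.ne b12 b34 b13 ho
  have t1 := h.hd.twist h1 h2 h3 h4 L L' hP hP' hPP
  have n12 : e₁ ≠ e₂ := fun h => a12.ne (by rw [h])
  have n34 : e₃ ≠ e₄ := fun h => a12.ne (by rw [a13, a24, h])
  have t2 := h.hc.twist hi (h.αlt e₃ e₂ (by omega)) hi' (h.ilt _) (h.rung n12) (h.rung n34)
    (h.rungC b12) (h.rungC b34) (h.rungdis b12 b34 b13)
  have c12 := h.rungcard (e := e₁) (f := e₂)
  have c34 := h.rungcard (e := e₃) (f := e₄)
  omega

theorem no_cross {e₁ e₂ e₃ e₄ f₁ f₂ f₃ f₄ : ι} 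
    (ea13 : α e₁ = α e₃) (ea24 : α e₂ = α e₄)
    (eb12 : β e₁ = β e₂) (eb34 : β e₃ = β e₄) (eb13 : β e₁ ≠ β e₃)
    (eo : (j e₁ < j e₂ ∧ j e₃ < j e₄) ∨ (j e₂ < j e₁ ∧ j e₄ < j e₃))
    (ei : i e₁ < i e₃) (ei' : i e₄ < i e₂)
    (fa13 : α f₁ = α f₃) (fa24 : α f₂ = α f₄)
    (fb12 : β f₁ = β f₂) (fb34 : β f₃ = β f₄) (fb13 : β f₁ ≠ β f₃)
    (fo : (j f₁ < j f₂ ∧ j f₃ < j f₄) ∨ (j f₂ < j f₁ ∧ j f₄ < j f₃))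
    (fi : i f₁ < i f₃) (fi' : i f₄ < i f₂)
    (o1 : α e₁ < α f₁) (o2 : α f₁ < α e₂) (o3 : α e₂ < α f₂)
    (hb : (β e₁ < β f₁ ∧ β e₁ < β f₃ ∧ β e₃ < β f₁ ∧ β e₃ < β f₃) ∨
      (β f₁ < β e₁ ∧ β f₁ < β e₃ ∧ β f₃ < β e₁ ∧ β f₃ < β e₃)) : False := by
  have ne12 : e₁ ≠ e₂ := fun h => (show α e₁ ≠ α e₂ by omega) (by rw [h])
  have ne34 : e₄ ≠ e₃ := fun h => (show α e₄ ≠ α e₃ by omega) (by rw [h])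
  have nf12 : f₁ ≠ f₂ := fun h => (show α f₁ ≠ α f₂ by omega) (by rw [h])
  have nf34 : f₄ ≠ f₃ := fun h => (show α f₄ ≠ α f₃ by omega) (by rw [h])
  have T := h.hc.cross ei (h.αlt e₃ f₁ (by omega)) fi (h.αlt f₃ e₄ (by omega)) ei'
    (h.αlt e₂ f₄ (by omega)) fi' (h.ilt _) (h.rung ne12) (h.rung nf34) (h.rung ne34) (h.rung nf12)
    (h.rungC eb12) (h.rungC fb34.symm) (h.rungC eb34.symm) (h.rungC fb12)
    (h.rungdis eb12 fb34.symm (by omega)) (h.rungdis eb12 eb34.symm (by omega))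
    (h.rungdis eb12 fb12 (by omega)) (h.rungdis fb34.symm eb34.symm (by omega))
    (h.rungdis fb34.symm fb12 (by omega)) (h.rungdis eb34.symm fb12 (by omega))
  have c1 := h.rungcard (e := e₁) (f := e₂)
  have c2 := h.rungcard (e := e₄) (f := e₃)
  have c3 := h.rungcard (e := f₁) (f := f₂)
  have c4 := h.rungcard (e := f₄) (f := f₃)
  obtain ⟨p₁, p₂, p₃, p₄, P, P', h1, h2, h3, h4, L, L', hP, hP', hPP, hu, w1, w4, hs1, hs2⟩ :=
    h.band ea13 ea24 (by omega) eb12 eb34 eb13 eo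
  obtain ⟨q₁, q₂, q₃, q₄, R, R', g1, g2, g3, g4, M, M', hR, hR', hRR, hv, v1, v4, gs1, gs2⟩ :=
    h.band fa13 fa24 (by omega) fb12 fb34 fb13 fo
  have hdis : Disjoint (P ∪ P') (R ∪ R') := by
    refine Finset.disjoint_of_subset_left hu (Finset.disjoint_of_subset_right hv ?_)
    simp only [Finset.disjoint_union_left, Finset.disjoint_union_right]
    exact ⟨⟨h.symm.rungdis ea13 fa13 (by omega), h.symm.rungdis ea24 fa13 (by omega)⟩,
      h.symm.rungdis ea13 fa24 (by omega), h.symm.rungdis ea24 fa24 (by omega)⟩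
  simp only [Finset.disjoint_union_left, Finset.disjoint_union_right] at hdis
  obtain ⟨⟨x1, x2⟩, x3, x4⟩ := hdis
  have lt1 : ∀ e f, β e < β f → j e < j f := h.βlt
  rcases hb with hb | hb
  · have hpq : p₄ < q₁ := by
      rcases w4 with rfl | rfl | rfl | rfl <;> rcases v1 with rfl | rfl | rfl | rfl <;>
        exact lt1 _ _ (by omega)
    have := h.hd.twoTwist h1 h2 h3 hpq g1 g2 g3 g4 L L' M M' hP hP' hR hR' hPP x1 x3 x2 x4 hRR
    omega
  · have hpq : q₄ < p₁ := by
      rcases v4 with rfl | rfl | rfl | rfl <;> rcases w1 with rfl | rfl | rfl | rfl <;>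
        exact lt1 _ _ (by omega)
    have := h.hd.twoTwist g1 g2 g3 hpq h1 h2 h3 h4 M M' L L' hR hR' hP hP' hRR x1.symm x2.symm
      x3.symm x4.symm hPP
    omega

end Conf
end ConfSec

end

section

theorem sel_four (N N' : Finset ℕ) (h : 4 ≤ N.card) (h' : 4 ≤ N'.card) :
    ∃ n₁ ∈ N, ∃ n₂ ∈ N, ∃ m₁ ∈ N', ∃ m₂ ∈ N', n₁ ≠ n₂ ∧ m₁ ≠ m₂ ∧
      ((n₁ < m₁ ∧ n₁ < m₂ ∧ n₂ < m₁ ∧ n₂ < m₂) ∨ (m₁ < n₁ ∧ m₁ < n₂ ∧ m₂ < n₁ ∧ m₂ < n₂)) := by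
  have key : ∀ N : Finset ℕ, 4 ≤ N.card → ∃ a ∈ N, ∃ b ∈ N, ∃ c ∈ N, ∃ d ∈ N, a < b ∧ b < c ∧ c < d := by
    intro N h
    obtain ⟨S, hS, hc⟩ := Finset.exists_subset_card_eq h
    let o := S.orderEmbOfFin hc
    have hm : ∀ k, o k ∈ N := fun k => hS (Finset.orderEmbOfFin_mem S hc k)
    have hl : ∀ a b : Fin 4, a < b → o a < o b := fun a b hab => o.lt_iff_lt.2 hab
    exact ⟨o 0, hm _, o 1, hm _, o 2, hm _, o 3, hm _, hl _ _ (by decide), hl _ _ (by decide),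
      hl _ _ (by decide)⟩
  obtain ⟨n0, hn0, n1, hn1, n2, hn2, n3, hn3, _, _, _⟩ := key N h
  obtain ⟨m0, hm0, m1, hm1, m2, hm2, m3, hm3, _, _, _⟩ := key N' h'
  rcases lt_or_ge n1 m2 with hlt | hge
  · exact ⟨n0, hn0, n1, hn1, m2, hm2, m3, hm3, by omega, by omega, by omega⟩
  · exact ⟨n2, hn2, n3, hn3, m0, hm0, m1, hm1, by omega, by omega, by omega⟩

theorem noncross_card (M : ℕ) (H : Finset (ℕ × ℕ)) (h1 : ∀ p ∈ H, p.1 < M ∧ p.2 < M)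
    (h2 : ∀ p ∈ H, ∀ q ∈ H, ¬ (p.1 < q.1 ∧ q.1 < p.2 ∧ p.2 < q.2)) (h3 : ∀ p ∈ H, p.1 < p.2) :
    H.card ≤ 2 * M := by
  classical
  let H1 := H.filter (fun p => ∀ q ∈ H, q.1 = p.1 → q.2 ≤ p.2)
  let H2 := H.filter (fun p => ∀ q ∈ H, q.2 = p.2 → p.1 ≤ q.1)
  have hsub : H ⊆ H1 ∪ H2 := by
    intro p hp
    by_contra hcon
    simp only [H1, H2, Finset.mem_union, Finset.mem_filter, hp, true_and, not_or, not_forall] at hcon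
    obtain ⟨⟨q, hq, hq1, hq2⟩, r, hr, hr1, hr2⟩ := hcon
    have := h3 p hp
    exact h2 r hr q hq ⟨by omega, by omega, by omega⟩
  have c1 : H1.card ≤ M := by
    rw [← Finset.card_range M]
    apply Finset.card_le_card_of_injOn Prod.fst
    · intro p hp
      have := h1 p (Finset.mem_filter.1 hp).1
      simpa using this.1
    · intro p hp q hq hpq
      have hp := Finset.mem_filter.1 hp
      have hq := Finset.mem_filter.1 hq
      exact Prod.ext hpq (le_antisymm (hq.2 p hp.1 hpq) (hp.2 q hq.1 hpq.symm))
  have c2 : H2.card ≤ M := by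
    rw [← Finset.card_range M]
    apply Finset.card_le_card_of_injOn Prod.snd
    · intro p hp
      have := h1 p (Finset.mem_filter.1 hp).1
      simpa using this.2
    · intro p hp q hq hpq
      have hp := Finset.mem_filter.1 hp
      have hq := Finset.mem_filter.1 hq
      exact Prod.ext (le_antisymm (hp.2 q hq.1 hpq.symm) (hq.2 p hp.1 hpq)) hpq
  have := Finset.card_le_card hsub
  have := Finset.card_union_le H1 H2
  omega

namespace Conf
variable {V : Type} [DecidableEq V] {G : SimpleGraph V} 
variable {ℓ : ℕ} {c d : ℕ → V} {ι : Type} {i j : ι → ℕ} {Q : ι → Finset V} {α β : ι → ℕ}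
variable (h : Conf G ℓ c d i j Q α β)
include h

theorem high (N : Finset ℕ) {a a' : ℕ} (haa : a < a') (hN : 7 ≤ N.card)
    (hN' : ∀ b ∈ N, ∃ e f, α e = a ∧ α f = a' ∧ β e = b ∧ β f = b) :
    ∃ (N' : Finset ℕ) (e f : ℕ → ι), 4 ≤ N'.card ∧
      (∀ b ∈ N', α (e b) = a ∧ α (f b) = a' ∧ β (e b) = b ∧ β (f b) = b) ∧
      ((∀ b ∈ N', j (e b) < j (f b)) ∨ (∀ b ∈ N', j (f b) < j (e b))) ∧
      ∀ b ∈ N', ∀ b' ∈ N', i (e b) < i (e b') → i (f b') < i (f b) := by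
  classical
  have hne : Nonempty ι := by
    obtain ⟨b, hb⟩ : N.Nonempty := Finset.card_pos.1 (by omega)
    obtain ⟨e, _⟩ := hN' b hb
    exact ⟨e⟩
  choose! e f h1 h2 h3 h4 using hN'
  have key : ∀ N' ⊆ N, ((∀ b ∈ N', j (e b) < j (f b)) ∨ (∀ b ∈ N', j (f b) < j (e b))) → 
      ∀ b ∈ N', ∀ b' ∈ N', i (e b) < i (e b') → i (f b') < i (f b) := by
    intro N' hs ho b hb b' hb' hlt
    have q1 := h1 b (hs hb)
    have q2 := h2 b (hs hb)
    have q3 := h3 b (hs hb)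
    have q4 := h4 b (hs hb)
    have q1' := h1 b' (hs hb')
    have q2' := h2 b' (hs hb')
    have q3' := h3 b' (hs hb')
    have q4' := h4 b' (hs hb')
    have hbb : b ≠ b' := fun h => by rw [h] at hlt; omega
    rcases lt_trichotomy (i (f b)) (i (f b')) with hh | hh | hh
    · exfalso
      refine h.no_twist (e₁ := e b) (e₂ := f b) (e₃ := e b') (e₄ := f b') (by omega) (by omega)
        (by omega) (by omega) (by omega) (by omega) ?_ hlt hh
      rcases ho with ho | ho
      · exact .inl ⟨ho b hb, ho b' hb'⟩
      · exact .inr ⟨ho b hb, ho b' hb'⟩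
    · exfalso
      have := h.iinj _ _ hh
      rw [this] at q4
      omega
    · exact hh
  have hcard := Finset.card_filter_add_card_filter_not (s := N) (fun b => j (e b) < j (f b))
  by_cases hh : 4 ≤ (N.filter (fun b => j (e b) < j (f b))).card
  · have ho : (∀ b ∈ N.filter (fun b => j (e b) < j (f b)), j (e b) < j (f b)) :=
      fun b hb => (Finset.mem_filter.1 hb).2
    exact ⟨_, e, f, hh, fun b hb => ⟨h1 b (Finset.filter_subset _ _ hb),
      h2 b (Finset.filter_subset _ _ hb), h3 b (Finset.filter_subset _ _ hb),
      h4 b (Finset.filter_subset _ _ hb)⟩, .inl ho, key _ (Finset.filter_subset _ _) (.inl ho)⟩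
  · have hh' : 4 ≤ (N.filter (fun b => ¬ j (e b) < j (f b))).card := by omega
    have ho : (∀ b ∈ N.filter (fun b => ¬ j (e b) < j (f b)), j (f b) < j (e b)) := by
      intro b hb
      have hb' := Finset.mem_filter.1 hb
      refine lt_of_le_of_ne (by omega) (fun hh => ?_)
      have e1 := h1 b hb'.1
      have e2 := h2 b hb'.1
      have := h.jinj _ _ hh
      rw [this] at e2
      omega
    exact ⟨_, e, f, hh', fun b hb => ⟨h1 b (Finset.filter_subset _ _ hb),
      h2 b (Finset.filter_subset _ _ hb), h3 b (Finset.filter_subset _ _ hb),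
      h4 b (Finset.filter_subset _ _ hb)⟩, .inr ho, key _ (Finset.filter_subset _ _) (.inr ho)⟩

theorem no_cross_high (N N' : Finset ℕ) {a₁ a₂ a₃ a₄ : ℕ} (h12 : a₁ < a₂) (h23 : a₂ < a₃)
    (h34 : a₃ < a₄) (hN : 7 ≤ N.card) (hN' : 7 ≤ N'.card)
    (hh : ∀ b ∈ N, ∃ e f, α e = a₁ ∧ α f = a₃ ∧ β e = b ∧ β f = b)
    (hh' : ∀ b ∈ N', ∃ e f, α e = a₂ ∧ α f = a₄ ∧ β e = b ∧ β f = b) : False := by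
  obtain ⟨K, e, f, k1, k2, k3, k4⟩ := h.high N (by omega) hN hh
  obtain ⟨K', e', f', l1, l2, l3, l4⟩ := h.high N' (by omega) hN' hh'
  obtain ⟨n₁, hn1, n₂, hn2, m₁, hm1, m₂, hm2, hnn, hmm, hor⟩ := sel_four K K' k1 l1
  have main : ∀ n₁ ∈ K, ∀ n₂ ∈ K, ∀ m₁ ∈ K', ∀ m₂ ∈ K', n₁ ≠ n₂ → m₁ ≠ m₂ →
      ((n₁ < m₁ ∧ n₁ < m₂ ∧ n₂ < m₁ ∧ n₂ < m₂) ∨ (m₁ < n₁ ∧ m₁ < n₂ ∧ m₂ < n₁ ∧ m₂ < n₂)) → 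
      i (e n₁) < i (e n₂) → i (e' m₁) < i (e' m₂) → False := by
    intro n₁ hn1 n₂ hn2 m₁ hm1 m₂ hm2 hnn hmm hor hi hi'
    obtain ⟨x1, x2, x3, x4⟩ := k2 n₁ hn1
    obtain ⟨y1, y2, y3, y4⟩ := k2 n₂ hn2
    obtain ⟨z1, z2, z3, z4⟩ := l2 m₁ hm1
    obtain ⟨w1, w2, w3, w4⟩ := l2 m₂ hm2
    refine h.no_cross (e₁ := e n₁) (e₂ := f n₁) (e₃ := e n₂) (e₄ := f n₂) (f₁ := e' m₁)
      (f₂ := f' m₁) (f₃ := e' m₂) (f₄ := f' m₂) (by omega) (by omega) (by omega) (by omega)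
      (by omega) ?_ hi (k4 _ hn1 _ hn2 hi) (by omega) (by omega) (by omega) (by omega)
      (by omega) ?_ hi' (l4 _ hm1 _ hm2 hi') (by omega) (by omega) (by omega) (by omega)
    · rcases k3 with ho | ho
      · exact .inl ⟨ho _ hn1, ho _ hn2⟩
      · exact .inr ⟨ho _ hn1, ho _ hn2⟩
    · rcases l3 with ho | ho
      · exact .inl ⟨ho _ hm1, ho _ hm2⟩
      · exact .inr ⟨ho _ hm1, ho _ hm2⟩
  have ne1 : i (e n₁) ≠ i (e n₂) := fun hh => by
    have := h.iinj _ _ hh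
    have e1 := (k2 _ hn1).2.2.1
    have e2 := (k2 _ hn2).2.2.1
    rw [this] at e1
    omega
  have ne2 : i (e' m₁) ≠ i (e' m₂) := fun hh => by
    have := h.iinj _ _ hh
    have e1 := (l2 _ hm1).2.2.1
    have e2 := (l2 _ hm2).2.2.1
    rw [this] at e1
    omega
  rcases lt_or_gt_of_ne ne1 with h5 | h5 <;> rcases lt_or_gt_of_ne ne2 with h6 | h6
  · exact main n₁ hn1 n₂ hn2 m₁ hm1 m₂ hm2 hnn hmm hor h5 h6
  · exact main n₁ hn1 n₂ hn2 m₂ hm2 m₁ hm1 hnn hmm.symm (by omega) h5 h6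
  · exact main n₂ hn2 n₁ hn1 m₁ hm1 m₂ hm2 hnn.symm hmm (by omega) h5 h6
  · exact main n₂ hn2 n₁ hn1 m₂ hm2 m₁ hm1 hnn.symm hmm.symm (by omega) h5 h6

theorem count [Fintype ι] (M : ℕ) (hα : ∀ e, α e < M) (hβ : ∀ e, β e < M) :
    Fintype.card ι ≤ M ^ 2 ∧ Fintype.card ι ^ 2 ≤ 17 * M ^ 3 := by
  classical
  have hinj : ∀ e f, α e = α f → β e = β f → e = f := fun e f h1 h2 => by
    by_contra hne
    exact h.no_double hne h1 h2
  have hcard : Fintype.card ι ≤ M ^ 2 := by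
    rw [sq, ← Finset.card_univ]
    have : (Finset.range M ×ˢ Finset.range M).card = M * M := by simp
    rw [← this]
    apply Finset.card_le_card_of_injOn (fun e => (α e, β e))
    · intro e _; simp [hα, hβ]
    · intro e _ f _ hef
      simp only [Prod.mk.injEq] at hef
      exact hinj e f hef.1 hef.2
  refine ⟨hcard, ?_⟩
  let N : ℕ × ℕ → Finset ℕ := fun p => (Finset.range M).filter
    (fun b => ∃ e f, α e = p.1 ∧ α f = p.2 ∧ β e = b ∧ β f = b)
  let PP : Finset (ℕ × ℕ) := (Finset.range M ×ˢ Finset.range M).filter (fun p => p.1 < p.2)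
  let H : Finset (ℕ × ℕ) := PP.filter (fun p => 7 ≤ (N p).card)
  have hNb : ∀ p, ∀ b ∈ N p, ∃ e f, α e = p.1 ∧ α f = p.2 ∧ β e = b ∧ β f = b :=
    fun p b hb => (Finset.mem_filter.1 hb).2
  have hPP : ∀ p ∈ PP, p.1 < M ∧ p.2 < M ∧ p.1 < p.2 := by
    intro p hp
    simp only [PP, Finset.mem_filter, Finset.mem_product, Finset.mem_range] at hp
    exact ⟨hp.1.1, hp.1.2, hp.2⟩
  have hH : H.card ≤ 2 * M := by
    apply noncross_card
    · intro p hp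
      have := hPP p (Finset.mem_filter.1 hp).1
      exact ⟨this.1, this.2.1⟩
    · rintro p hp q hq ⟨h1, h2, h3⟩
      exact h.no_cross_high (N p) (N q) h1 h2 h3 (Finset.mem_filter.1 hp).2
        (Finset.mem_filter.1 hq).2 (hNb p) (hNb q)
    · intro p hp
      exact (hPP p (Finset.mem_filter.1 hp).1).2.2
  have hNM : ∀ p, (N p).card ≤ M := fun p => by
    simpa using Finset.card_filter_le (Finset.range M) _
  have hPPc : PP.card ≤ M * M := by
    have := Finset.card_filter_le (Finset.range M ×ˢ Finset.range M) (fun p => p.1 < p.2)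
    simpa [PP] using this
  have hsum : ∑ p ∈ PP, (N p).card ≤ 8 * M ^ 2 := by
    have : ∀ p ∈ PP, (N p).card ≤ 6 + if 7 ≤ (N p).card then M else 0 := by
      intro p hp
      split_ifs with h7
      · have := hNM p; omega
      · omega
    calc _ ≤ ∑ p ∈ PP, (6 + if 7 ≤ (N p).card then M else 0) := Finset.sum_le_sum this
      _ = PP.card * 6 + H.card * M := by
        rw [Finset.sum_add_distrib, ← Finset.sum_filter]; simp [H]
      _ ≤ _ := by nlinarith
  let L : Finset (ι × ι) := Finset.univ.filter (fun p => β p.1 = β p.2 ∧ α p.1 < α p.2)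
  let U : Finset (ι × ι) := Finset.univ.filter (fun p => β p.1 = β p.2)
  have hL : L.card ≤ 8 * M ^ 2 := by
    refine le_trans ?_ hsum
    rw [Finset.card_eq_sum_card_fiberwise (f := fun p : ι × ι => (α p.1, α p.2)) (t := PP)]
    · apply Finset.sum_le_sum
      intro p hp
      apply Finset.card_le_card_of_injOn (fun q : ι × ι => β q.1)
      · intro q hq
        simp only [L, Finset.coe_filter, Finset.mem_filter, Finset.mem_univ, true_and,
          Set.mem_setOf_eq] at hq
        obtain ⟨⟨h1, h2⟩, h3⟩ := hq
        subst h3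
        simp only [N, Finset.coe_filter, Set.mem_setOf_eq, Finset.mem_range]
        exact ⟨hβ _, q.1, q.2, rfl, rfl, rfl, h1.symm⟩
      · intro q hq r hr hqr
        simp only [L, Finset.coe_filter, Finset.mem_filter, Finset.mem_univ, true_and,
          Set.mem_setOf_eq] at hq hr
        have h5 := hq.2.trans hr.2.symm
        simp only [Prod.mk.injEq] at h5
        simp only at hqr
        exact Prod.ext (hinj _ _ h5.1 hqr) (hinj _ _ h5.2 (by omega))
    · intro q hq
      simp only [L, Finset.coe_filter, Finset.mem_univ, true_and, Set.mem_setOf_eq] at hq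
      simp [PP, hα, hq.2]
  have hU : U.card ≤ 2 * L.card + Fintype.card ι := by
    have hsub : U ⊆ (L ∪ L.image Prod.swap) ∪ Finset.univ.image (fun e : ι => (e, e)) := by
      intro p hp
      have hp := (Finset.mem_filter.1 hp).2
      rcases lt_trichotomy (α p.1) (α p.2) with h1 | h1 | h1
      · simp [L, hp, h1]
      · have := hinj _ _ h1 hp
        apply Finset.mem_union_right
        simp only [Finset.mem_image, Finset.mem_univ, true_and]
        exact ⟨p.1, Prod.ext rfl this⟩
      · apply Finset.mem_union_left
        apply Finset.mem_union_right
        simp only [Finset.mem_image]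
        exact ⟨p.swap, by simp [L, hp, h1], by simp⟩
    have h1 := Finset.card_le_card hsub
    have h2 := Finset.card_union_le (L ∪ L.image Prod.swap) (Finset.univ.image (fun e : ι => (e, e)))
    have h3 := Finset.card_union_le L (L.image Prod.swap)
    have h4 : (L.image Prod.swap).card ≤ L.card := Finset.card_image_le
    have h5 : (Finset.univ.image (fun e : ι => (e, e))).card ≤ Fintype.card ι := Finset.card_image_le
    omega
  have hU2 : U.card = ∑ b ∈ Finset.range M, (Finset.univ.filter (fun e => β e = b)).card ^ 2 := by
    rw [Finset.card_eq_sum_card_fiberwise (f := fun p : ι × ι => β p.1) (t := Finset.range M)]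
    · apply Finset.sum_congr rfl
      intro b hb
      rw [sq, ← Finset.card_product]
      congr 1
      ext p
      simp only [U, Finset.mem_filter, Finset.mem_univ, true_and, Finset.mem_product]
      constructor
      · rintro ⟨h1, h2⟩; exact ⟨h2, by omega⟩
      · rintro ⟨h1, h2⟩; exact ⟨by omega, h1⟩
    · intro q hq
      simp [hβ]
  have hC : Fintype.card ι = ∑ b ∈ Finset.range M, (Finset.univ.filter (fun e => β e = b)).card := by
    rw [← Finset.card_univ, Finset.card_eq_sum_card_fiberwise (f := β) (t := Finset.range M)]
    intro q hq
    simp [hβ]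
  have hCS := sq_sum_le_card_mul_sum_sq (s := Finset.range M)
    (f := fun b => (Finset.univ.filter (fun e => β e = b)).card)
  rw [← hC, ← hU2, Finset.card_range] at hCS
  calc _ ≤ M * U.card := hCS
    _ ≤ M * (17 * M ^ 2) := Nat.mul_le_mul_left _ (by omega)
    _ = _ := by ring

end Conf

end

section
variable {V : Type} [DecidableEq V] {G : SimpleGraph V}

theorem PathOn.trim {a b : V} {S C D : Finset V} (h : PathOn G a b S) (ha : a ∈ C) (hb : b ∈ D)
    (hS : Disjoint S (C ∩ D)) :
    ∃ x y R, R ⊆ S ∧ PathOn G x y R ∧ R ∩ C = {x} ∧ R ∩ D = {y} ∧ x ≠ y := by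
  obtain ⟨v, S₁, hv, h1, p1, e1⟩ := h.first (T := D) ⟨b, h.right_mem, hb⟩
  obtain ⟨w, S₂, hw, h2, p2, e2⟩ := p1.symm.first (T := C) ⟨a, p1.left_mem, ha⟩
  refine ⟨w, v, S₂, h2.trans h1, p2.symm, e2, ?_, ?_⟩
  · apply Finset.Subset.antisymm
    · rw [← e1]; exact Finset.inter_subset_inter_right h2
    · simp [p2.left_mem, hv]
  · rintro rfl
    exact Finset.disjoint_left.1 hS (h1 (h2 p2.left_mem)) (by simp [hv, hw])

def cnt (c : ℕ → V) (D : Finset V) (p : ℕ) : ℕ := ((Finset.range p).filter (fun t => c t ∈ D)).card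

theorem cnt_mono (c : ℕ → V) (D : Finset V) {p q : ℕ} (h : p ≤ q) : cnt c D p ≤ cnt c D q := by
  unfold cnt
  apply Finset.card_le_card
  apply Finset.filter_subset_filter
  intro t; simp; omega

theorem cnt_seg (c : ℕ → V) (D : Finset V) {p q : ℕ} (h : p ≤ q) (he : cnt c D p = cnt c D q)
    (hq : c q ∉ D) : Disjoint ((Finset.Icc p q).image c) D := by
  rw [Finset.disjoint_left]
  intro v hv hD
  obtain ⟨t, ht, rfl⟩ := Finset.mem_image.1 hv
  rw [Finset.mem_Icc] at ht
  rcases eq_or_lt_of_le ht.2 with rfl | hlt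
  · exact hq hD
  have : cnt c D p < cnt c D q := by
    unfold cnt
    apply Finset.card_lt_card
    rw [Finset.ssubset_iff_of_subset]
    · exact ⟨t, by simp [hlt, hD], by simp; omega⟩
    · apply Finset.filter_subset_filter
      intro t; simp; omega
  omega

theorem cnt_useg (c : ℕ → V) (D : Finset V) {p q : ℕ} (he : cnt c D p = cnt c D q)
    (hp : c p ∉ D) (hq : c q ∉ D) : Disjoint ((Finset.uIcc p q).image c) D := by
  rcases le_total p q with h | h
  · rw [Finset.uIcc_of_le h]; exact cnt_seg c D h he hq
  · rw [Finset.uIcc_of_ge h]; exact cnt_seg c D h he.symm hp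

theorem cnt_le {c : ℕ → V} {D : Finset V} {ℓ p : ℕ} (hc : Set.InjOn c (Set.Iio ℓ)) (hp : p < ℓ) :
    cnt c D p ≤ ((Finset.range ℓ).image c ∩ D).card := by
  unfold cnt
  apply Finset.card_le_card_of_injOn c
  · intro t ht
    simp at ht
    simp only [Finset.coe_inter, Set.mem_inter_iff, Finset.mem_coe, Finset.mem_image, Finset.mem_range]
    exact ⟨⟨t, by omega, rfl⟩, ht.2⟩
  · apply hc.mono
    intro t ht
    simp at ht
    simp; omega

theorem main_lemma {ℓ k : ℕ} {c d : ℕ → V} (hc : CP G ℓ c) (hd : CP G ℓ d) (C D : Finset V)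
    (hC : C = (Finset.range ℓ).image c) (hD : D = (Finset.range ℓ).image d)
    (hL : Linkage G C D k) :
    ∃ E : ℕ, k ≤ (C ∩ D).card + E ∧ E ≤ ((C ∩ D).card + 1)^2 ∧ E^2 ≤ 17 * ((C ∩ D).card + 1)^3 := by
  obtain ⟨I, a, b, S, hI, hp, hdis⟩ := hL
  classical
  set J := I.filter (fun i => Disjoint (S i) (C ∩ D)) with hJ
  set B := I.filter (fun i => ¬ Disjoint (S i) (C ∩ D)) with hB
  have hsum : J.card + B.card = k := by
    rw [← hI]; exact Finset.card_filter_add_card_filter_not _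
  have hBc : B.card ≤ (C ∩ D).card := by
    have : ∀ i ∈ B, ∃ v, v ∈ S i ∧ v ∈ C ∩ D := by
      intro i hi
      exact Finset.not_disjoint_iff.1 (Finset.mem_filter.1 hi).2
    choose! f hf using this
    apply Finset.card_le_card_of_injOn f
    · intro i hi; exact (hf i hi).2
    · intro i hi j hj hij
      by_contra hne
      have h1 := hdis i (Finset.mem_filter.1 hi).1 j (Finset.mem_filter.1 hj).1 hne
      exact Finset.disjoint_left.1 h1 (hf i hi).1 (hij ▸ (hf j hj).1)
  have key : ∀ e : {i // i ∈ J}, ∃ x y R, R ⊆ S e ∧ PathOn G x y R ∧ R ∩ C = {x} ∧ R ∩ D = {y} ∧ x ≠ y := by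
    rintro ⟨i, hi⟩
    rw [hJ, Finset.mem_filter] at hi
    obtain ⟨h1, h2, h3⟩ := hp i hi.1
    exact h3.trim h1 h2 hi.2
  choose x y R hRS hR hRC hRD hxy using key
  have hxR : ∀ e, x e ∈ R e := fun e => (hR e).left_mem
  have hyR : ∀ e, y e ∈ R e := fun e => (hR e).right_mem
  have hxC : ∀ e, x e ∈ C := fun e => by
    have : x e ∈ R e ∩ C := by rw [hRC]; simp
    exact (Finset.mem_inter.1 this).2
  have hyD : ∀ e, y e ∈ D := fun e => by
    have : y e ∈ R e ∩ D := by rw [hRD]; simp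
    exact (Finset.mem_inter.1 this).2
  have hxD : ∀ e, x e ∉ D := fun e h => by
    have : x e ∈ R e ∩ D := by simp [hxR, h]
    rw [hRD] at this
    exact hxy e (by simpa using this)
  have hyC : ∀ e, y e ∉ C := fun e h => by
    have : y e ∈ R e ∩ C := by simp [hyR, h]
    rw [hRC] at this
    exact hxy e (by simpa using Eq.symm (by simpa using this))
  have hRdis : ∀ e f, e ≠ f → Disjoint (R e) (R f) := by
    intro e f hef
    have := hdis e (Finset.mem_filter.1 e.2).1 f (Finset.mem_filter.1 f.2).1
      (fun h => hef (Subtype.ext h))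
    exact Finset.disjoint_of_subset_left (hRS e) (Finset.disjoint_of_subset_right (hRS f) this)
  have hi : ∀ e, ∃ i, i < ℓ ∧ c i = x e := fun e => by
    have := hxC e
    rw [hC] at this
    simpa using this
  have hj : ∀ e, ∃ i, i < ℓ ∧ d i = y e := fun e => by
    have := hyD e
    rw [hD] at this
    simpa using this
  choose i hil hi using hi
  choose j hjl hj using hj
  have conf : Conf G ℓ c d i j (fun e => ((R e).erase (x e)).erase (y e))
      (fun e => cnt c D (i e)) (fun e => cnt d C (j e)) := by
    refine ⟨hc, hd, hil, hjl, ?_, ?_, ?_, ?_, ?_, ?_, ?_, ?_, ?_, ?_⟩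
    · intro e; rw [hi, hj]; exact Link.of_path (hR e) (hxy e)
    · intro e f hef
      exact Finset.disjoint_of_subset_left ((Finset.erase_subset _ _).trans (Finset.erase_subset _ _))
        (Finset.disjoint_of_subset_right ((Finset.erase_subset _ _).trans (Finset.erase_subset _ _))
          (hRdis e f hef))
    · intro e
      rw [← hC, Finset.disjoint_left]
      intro v hv hvC
      simp only [Finset.mem_erase] at hv
      have : v ∈ R e ∩ C := by simp [hv, hvC]
      rw [hRC] at this
      exact hv.2.1 (by simpa using this)
    · intro e
      rw [← hD, Finset.disjoint_left]
      intro v hv hvC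
      simp only [Finset.mem_erase] at hv
      have : v ∈ R e ∩ D := by simp [hv, hvC]
      rw [hRD] at this
      exact hv.1 (by simpa using this)
    · intro e f hef
      by_contra hne
      have h1 : x e = x f := by rw [← hi, ← hi, hef]
      exact Finset.disjoint_left.1 (hRdis e f hne) (hxR e) (h1 ▸ hxR f)
    · intro e f hef
      by_contra hne
      have h1 : y e = y f := by rw [← hj, ← hj, hef]
      exact Finset.disjoint_left.1 (hRdis e f hne) (hyR e) (h1 ▸ hyR f)
    · intro e f h
      by_contra hh
      exact absurd (cnt_mono c D (not_lt.1 hh)) (not_le.2 h)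
    · intro e f h
      by_contra hh
      exact absurd (cnt_mono d C (not_lt.1 hh)) (not_le.2 h)
    · intro e f h
      rw [← hD]
      exact cnt_useg c D h (hi e ▸ hxD e) (hi f ▸ hxD f)
    · intro e f h
      rw [← hC]
      exact cnt_useg d C h (hj e ▸ hyC e) (hj f ▸ hyC f)
  obtain ⟨h1, h2⟩ := conf.count ((C ∩ D).card + 1)
    (fun e => by
      have := cnt_le (D := D) hc.inj (hil e)
      rw [← hC] at this
      exact Nat.lt_succ_of_le this)
    (fun e => by
      have := cnt_le (D := C) hd.inj (hjl e)
      rw [← hD, Finset.inter_comm] at this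
      exact Nat.lt_succ_of_le this)
  rw [Fintype.card_coe] at h1 h2
  exact ⟨J.card, by omega, h1, h2⟩

end



section
variable {V : Type} [DecidableEq V] {G : SimpleGraph V}

def CycSet (G : SimpleGraph V) (S : Finset V) : Prop :=
  ∃ x y, PathOn G x y S ∧ G.Adj y x ∧ 3 ≤ S.card

theorem CycSet.cp {S : Finset V} (h : CycSet G S) (hm : ∀ T, CycSet G T → T.card ≤ S.card) :
    ∃ c, CP G S.card c ∧ S = (Finset.range S.card).image c := by
  obtain ⟨x, y, hp, hadj, h3⟩ := h
  obtain ⟨c, hinj, him, hc, hx, hy⟩ := hp.exists_param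
  refine ⟨c, ⟨hinj, hc, ?_⟩, him.symm⟩
  intro T hT
  by_cases hT3 : 3 ≤ T.card
  · exact hm T ⟨_, _, hT, by rw [hx, hy]; exact hadj, hT3⟩
  · omega

theorem CycSet.image {S : Finset V} (h : CycSet G S) (g : G ≃g G) : CycSet G (S.image g) := by
  obtain ⟨x, y, hp, hadj, h3⟩ := h
  refine ⟨g x, g y, hp.map g g.injective (fun u v huv => g.map_adj_iff.2 huv), g.map_adj_iff.2 hadj, ?_⟩
  rwa [Finset.card_image_of_injective _ g.injective]

theorem CycSet.conn {S : Finset V} (h : CycSet G S) {a b : V} (ha : a ∈ S) (hb : b ∈ S) :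
    ∃ R, R ⊆ S ∧ PathOn G a b R := by
  obtain ⟨x, y, hp, -, -⟩ := h
  obtain ⟨S₁, S₂, p1, -, h1, -⟩ := hp.split ha
  obtain ⟨T₁, T₂, q1, -, h2, -⟩ := hp.split hb
  obtain ⟨R, hR, r⟩ := p1.symm.join q1
  refine ⟨R, hR.trans (Finset.union_subset ?_ ?_), r⟩
  · rw [← h1]; exact Finset.subset_union_left
  · rw [← h2]; exact Finset.subset_union_left

theorem exists_cycSet [Fintype V] (h3 : 3 ≤ Fintype.card V) (hc : G.Connected)
    (hv : IsVertexTransitive G) : ∃ S, CycSet G S := by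
  classical
  have hna : ¬ G.IsAcyclic := by
    intro ha
    have ht : G.IsTree := ⟨hc, ha⟩
    have : Nontrivial V := Fintype.one_lt_card_iff_nontrivial.1 (by omega)
    obtain ⟨v, hv1⟩ := ht.exists_vert_degree_one_of_nontrivial
    have hd : ∀ u, G.degree u = 1 := by
      intro u
      obtain ⟨g, rfl⟩ := hv v u
      rw [g.degree_eq, hv1]
    have := G.sum_degrees_eq_twice_card_edges
    simp only [hd] at this
    have h2 := ht.card_edgeFinset
    simp at this
    omega
  unfold SimpleGraph.IsAcyclic at hna
  push Not at hna
  obtain ⟨v, W, hW⟩ := hna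
  cases W with
  | nil => simp at hW
  | cons e p =>
    have h3 := hW.three_le_length
    rw [Walk.cons_isCycle_iff] at hW
    refine ⟨_, _, _, PathOn.of_walk p hW.1, e, ?_⟩
    rw [List.toFinset_card_of_nodup hW.1.support_nodup]
    simp at h3 ⊢
    omega

theorem noncut [Fintype V] (h3 : 3 ≤ Fintype.card V) (hc : G.Connected)
    (hv : IsVertexTransitive G) (v a b : V) (ha : a ≠ v) (hb : b ≠ v) :
    ∃ S, PathOn G a b S ∧ v ∉ S := by
  have : Nontrivial V := Fintype.one_lt_card_iff_nontrivial.1 (by omega)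
  obtain ⟨w, hw⟩ := hc.exists_connected_induce_compl_singleton_of_finite_nontrivial
  obtain ⟨g, rfl⟩ := hv v w
  obtain ⟨p, hp⟩ := (hw.preconnected ⟨g a, by simpa using ha⟩ ⟨g b, by simpa using hb⟩).exists_isPath
  have h1 := (PathOn.of_walk p hp).map (H := G) (fun u => g.symm u.1)
    (fun u v h => Subtype.ext (g.symm.injective h)) (fun u v huv => g.symm.map_adj_iff.2 huv)
  simp only [RelIso.symm_apply_apply] at h1
  refine ⟨_, h1, ?_⟩
  intro hh
  obtain ⟨u, -, hu⟩ := Finset.mem_image.1 hh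
  have : u.1 = g v := by
    have h5 := congrArg g hu
    simpa using h5
  exact u.2 this

theorem longest_meet [Fintype V] (h3 : 3 ≤ Fintype.card V) (hc : G.Connected)
    (hv : IsVertexTransitive G) {C D : Finset V} (hC : CycSet G C) (hD : CycSet G D)
    (hm : ∀ T, CycSet G T → T.card ≤ C.card) (hcard : D.card = C.card) : 1 ≤ (C ∩ D).card := by
  by_contra hlt
  obtain ⟨c, hcp, hc'⟩ := hC.cp hm
  obtain ⟨d, hdp, hd'⟩ := hD.cp (by rwa [hcard])
  rw [hcard] at hdp hd'
  have hL : Linkage G C D 2 := by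
    apply menger
    intro X hX
    by_contra hX2
    have hne : ∃ v, X ⊆ {v} := by
      have : Nonempty V := hc.nonempty
      exact Finset.card_le_one_iff_subset_singleton.1 (by omega)
    obtain ⟨v, hXv⟩ := hne
    have hex : ∀ T, CycSet G T → ∃ a ∈ T, a ≠ v := by
      rintro T ⟨_, _, _, _, h⟩
      exact Finset.exists_mem_ne (by omega) v
    obtain ⟨a, haC, hav⟩ := hex C hC
    obtain ⟨b, hbD, hbv⟩ := hex D hD
    obtain ⟨S, hS, hvS⟩ := noncut h3 hc hv v a b hav hbv
    obtain ⟨u, hu, huX⟩ := hX a haC b hbD S hS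
    have := hXv huX
    simp at this
    exact hvS (this ▸ hu)
  obtain ⟨E, h1, h2, -⟩ := main_lemma hcp hdp C D hc' hd' hL
  have : (C ∩ D).card = 0 := by omega
  rw [this] at h1 h2
  omega

theorem averaging [Fintype V] [Fintype (G ≃g G)] (hv : IsVertexTransitive G) (C X : Finset V) :
    Fintype.card V * ∑ g : G ≃g G, (C.image g ∩ X).card
      = C.card * X.card * Fintype.card (G ≃g G) := by
  classical
  let N : V → V → ℕ := fun u v => (Finset.univ.filter (fun g : G ≃g G => g u = v)).card
  have hN : ∀ u v v', N u v ≤ N u v' := by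
    intro u v v'
    obtain ⟨h, hh⟩ := hv v v'
    apply Finset.card_le_card_of_injOn (fun g => g.trans h)
    · intro g hg
      simp at hg ⊢
      rw [hg, hh]
    · intro g _ g' _ hgg
      ext u
      have := DFunLike.congr_fun hgg u
      simpa using this
  have hN2 : ∀ u v, Fintype.card V * N u v = Fintype.card (G ≃g G) := by
    intro u v
    have h1 : ∑ v', N u v' = Fintype.card (G ≃g G) := by
      rw [← Finset.card_univ]
      exact (Finset.card_eq_sum_card_fiberwise (f := fun g : G ≃g G => g u)
        (fun _ _ => Finset.mem_coe.2 (Finset.mem_univ _))).symm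
    rw [← h1, Finset.sum_congr rfl (fun v' _ => le_antisymm (hN u v' v) (hN u v v'))]
    simp
  have h2 : ∀ g : G ≃g G, (C.image g ∩ X).card = ∑ u ∈ C, ∑ v ∈ X, if g u = v then 1 else 0 := by
    intro g
    simp only [Finset.sum_ite_eq]
    rw [← Finset.card_filter]
    rw [← Finset.filter_mem_eq_inter, Finset.filter_image, Finset.card_image_of_injective _ g.injective]
  simp only [h2]
  rw [Finset.sum_comm]
  simp only [Finset.sum_comm (s := Finset.univ) (t := X)]
  have h3 : ∀ u v, (∑ g : G ≃g G, if g u = v then 1 else 0) = N u v := by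
    intro u v
    rw [← Finset.card_filter]
  simp only [h3, Finset.mul_sum, hN2]
  simp [mul_assoc]

theorem nat_bound [Fintype V] (h3 : 3 ≤ Fintype.card V) (hc : G.Connected)
    (hv : IsVertexTransitive G) : ∃ C, CycSet G C ∧ Fintype.card V ^ 5 ≤ 274 * C.card ^ 8 := by
  classical
  have : Fintype (G ≃g G) := @Fintype.ofFinite _ (DFunLike.finite _)
  obtain ⟨C, hC, hm⟩ : ∃ C, CycSet G C ∧ ∀ T, CycSet G T → T.card ≤ C.card := by
    obtain ⟨S, hS⟩ := exists_cycSet h3 hc hv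
    obtain ⟨C, hC, h⟩ := Finset.exists_max_image (Finset.univ.filter (CycSet G)) Finset.card
      ⟨S, by simpa using hS⟩
    exact ⟨C, by simpa using hC, fun T hT => h T (by simpa using hT)⟩
  refine ⟨C, hC, ?_⟩
  have hcard : ∀ g : G ≃g G, (C.image g).card = C.card := fun g =>
    Finset.card_image_of_injective _ g.injective
  have hm' : ∀ g : G ≃g G, ∀ T, CycSet G T → T.card ≤ (C.image g).card := fun g => by
    rw [hcard]; exact hm
  have hCne : 3 ≤ C.card := by obtain ⟨_, _, _, _, h⟩ := hC; exact h
  let Hit : Finset V → Prop := fun X => ∀ h : G ≃g G, ∃ v ∈ C.image h, v ∈ X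
  obtain ⟨X, hX, hXm⟩ : ∃ X, Hit X ∧ ∀ Y, Hit Y → X.card ≤ Y.card := by
    obtain ⟨X, hX, h⟩ := Finset.exists_min_image (Finset.univ.filter Hit) Finset.card
      ⟨Finset.univ, by
        simp only [Finset.mem_filter, Finset.mem_univ, true_and]
        intro h
        obtain ⟨v, hv⟩ := Finset.card_pos.1 (show 0 < (C.image h).card by rw [hcard]; omega)
        exact ⟨v, hv, Finset.mem_univ _⟩⟩
    exact ⟨X, by simpa using hX, fun T hT => h T (by simpa using hT)⟩
  have hΓ : 0 < Fintype.card (G ≃g G) := Fintype.card_pos_iff.2 ⟨RelIso.refl _⟩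
  have hn1 : Fintype.card V ≤ C.card * X.card := by
    have h1 := averaging hv C X
    have h2 : Fintype.card (G ≃g G) ≤ ∑ g : G ≃g G, (C.image g ∩ X).card := by
      have : ∑ g : G ≃g G, 1 ≤ ∑ g : G ≃g G, (C.image g ∩ X).card := by
        apply Finset.sum_le_sum
        intro g _
        obtain ⟨v, h, h'⟩ := hX g
        exact Finset.card_pos.2 ⟨v, by simp only [Finset.mem_inter]; exact ⟨h, h'⟩⟩
      simpa using this
    have h3 := Nat.mul_le_mul_left (Fintype.card V) h2
    rw [h1] at h3
    exact Nat.le_of_mul_le_mul_right h3 hΓ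
  obtain ⟨g, hg⟩ : ∃ g : G ≃g G, Fintype.card V * (C ∩ C.image g).card ≤ C.card ^ 2 := by
    by_contra! hcon
    have h1 := averaging hv C C
    rw [Finset.mul_sum] at h1
    have : ∑ g : G ≃g G, C.card ^ 2 < ∑ g : G ≃g G, Fintype.card V * (C.image g ∩ C).card := by
      apply Finset.sum_lt_sum_of_nonempty
      · exact ⟨RelIso.refl _, Finset.mem_univ _⟩
      · intro g _
        rw [Finset.inter_comm]
        exact hcon g
    rw [h1] at this
    simp at this
    nlinarith
  have hmeet : ∀ g h : G ≃g G, ∃ v, v ∈ C.image g ∧ v ∈ C.image h := by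
    intro g h
    have := longest_meet h3 hc hv (hC.image g) (hC.image h) (hm' g) (by rw [hcard, hcard])
    obtain ⟨v, hv⟩ := Finset.card_pos.1 this
    exact ⟨v, by simpa only [Finset.mem_inter] using hv⟩
  have hm1 : 1 ≤ (C ∩ C.image g).card :=
    longest_meet h3 hc hv hC (hC.image g) hm (hcard g)
  have hid : C.image (RelIso.refl _ : G ≃g G) = C := by
    ext v; simp
  have hL : Linkage G C (C.image g) X.card := by
    apply menger
    intro Y hY
    apply hXm
    intro h
    obtain ⟨a, ha1, ha2⟩ := hmeet (RelIso.refl _) h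
    rw [hid] at ha1
    obtain ⟨b, hb1, hb2⟩ := hmeet g h
    obtain ⟨R, hR, r⟩ := (hC.image h).conn ha2 hb2
    obtain ⟨v, hv1, hv2⟩ := hY a ha1 b hb1 R r
    exact ⟨v, hR hv1, hv2⟩
  obtain ⟨c, hcp, hc'⟩ := hC.cp hm
  obtain ⟨d, hdp, hd'⟩ := (hC.image g).cp (hm' g)
  rw [hcard] at hdp hd'
  obtain ⟨E, h1, -, h2⟩ := main_lemma hcp hdp C (C.image g) hc' hd' hL
  generalize (C ∩ C.image g).card = m at *
  generalize X.card = k at *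
  generalize C.card = l at *
  generalize Fintype.card V = n at *
  have hm3 : (m+1)^3 ≤ 8 * m^3 := by
    calc (m+1)^3 ≤ (2*m)^3 := Nat.pow_le_pow_left (by omega) 3
      _ = 8 * m^3 := by ring
  have hm2 : m^2 ≤ m^3 := Nat.pow_le_pow_right hm1 (by norm_num)
  have hk : k^2 ≤ 274 * m^3 := by
    have h5 : k^2 ≤ (m+E)^2 := Nat.pow_le_pow_left h1 2
    have h6 : (m+E)^2 ≤ 2*m^2+2*E^2 := by
      zify; nlinarith [sq_nonneg ((m:ℤ)-E)]
    omega
  calc n^5 = n^2 * n^3 := by ring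
    _ ≤ (l*k)^2 * n^3 := Nat.mul_le_mul_right _ (Nat.pow_le_pow_left hn1 2)
    _ = k^2 * (l^2 * n^3) := by ring
    _ ≤ (274 * m^3) * (l^2 * n^3) := Nat.mul_le_mul_right _ hk
    _ = 274 * l^2 * (n*m)^3 := by ring
    _ ≤ 274 * l^2 * (l^2)^3 := Nat.mul_le_mul_left _ (Nat.pow_le_pow_left hg 3)
    _ = 274 * l^8 := by ring

end

theorem stmt_13 :
    ∃ c : ℝ, 0 < c ∧
      ∀ (V : Type) [Fintype V] [DecidableEq V] (G : SimpleGraph V),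
        3 ≤ Fintype.card V → G.Connected → IsVertexTransitive G →
        ∃ (x : V) (W : G.Walk x x), W.IsCycle ∧
          c * (Fintype.card V : ℝ) ^ ((5 : ℝ) / 8) ≤ (W.length : ℝ) := by
  refine ⟨1/3, by norm_num, ?_⟩
  intro V _ _ G h3 hc hv
  obtain ⟨C, ⟨x, y, hp, hadj, hC3⟩, hn⟩ := nat_bound h3 hc hv
  obtain ⟨W, hW, hl⟩ := hp.exists_cycle hadj hC3
  refine ⟨y, W, hW, ?_⟩
  rw [hl]
  generalize C.card = l at *
  generalize Fintype.card V = n at *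
  have h1 : (n:ℝ)^5 ≤ (3*l)^8 := by
    have : n^5 ≤ (3*l)^8 := by
      rw [mul_pow]; norm_num; nlinarith [Nat.zero_le (l^8)]
    exact_mod_cast this
  have h2 : ((n:ℝ) ^ ((5 : ℝ) / 8))^8 = (n:ℝ)^5 := by
    rw [← Real.rpow_natCast, ← Real.rpow_mul (by positivity), ← Real.rpow_natCast]
    norm_num
  have h4 : (n:ℝ) ^ ((5 : ℝ) / 8) ≤ 3 * l := by
    apply le_of_pow_le_pow_left₀ (n := 8) (by norm_num) (by positivity)
    rw [h2]; exact h1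
  linarith
end

section
/- There exists a constant C > 0 such that the following holds: for every finite simple graph G and every two longest paths X and Y of G with |V(X) ∩ V(Y)| = m, there exists a set S ⊆ V(G) with |S| ≤ C·m^(3/2) that separates V(X) and V(Y), i.e., every (V(X), V(Y))-path in G contains a vertex of S. -/
open SimpleGraph

/-- `P` is a longest path in `G`: it is a path and its length (number of edges) is at
least the length of any path in `G`. -/
def IsLongestPath {V : Type*} (G : SimpleGraph V) {a b : V} (P : G.Walk a b) : Prop :=
  P.IsPath ∧ ∀ (c d : V) (Q : G.Walk c d), Q.IsPath → Q.length ≤ P.length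

/-- `p` is an `(A,B)`-path: a path meeting `A` exactly in its first vertex and `B` exactly
in its last vertex. -/
def IsABPath {V : Type*} (G : SimpleGraph V) (A B : Set V) {a b : V} (p : G.Walk a b) : Prop :=
  p.IsPath ∧ a ∈ A ∧ b ∈ B ∧ (∀ v ∈ p.support, v ∈ A → v = a) ∧
    (∀ v ∈ p.support, v ∈ B → v = b)

/-- `S` separates `A` and `B` in `G`: every `(A,B)`-path contains a vertex of `S`. -/
def Separates {V : Type*} (G : SimpleGraph V) (A B S : Set V) : Prop :=
  ∀ ⦃a b : V⦄ (p : G.Walk a b), IsABPath G A B p → ∃ v ∈ p.support, v ∈ S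




def WSep {V : Type} (G : SimpleGraph V) (A B S : Set V) : Prop :=
  ∀ a ∈ A, ∀ b ∈ B, ∀ p : G.Walk a b, ∃ s ∈ p.support, s ∈ S

def Rch {V : Type} (G : SimpleGraph V) (A S : Set V) (v : V) : Prop :=
  ∃ a ∈ A, ∃ p : G.Walk a v, ∀ w ∈ p.support, w ∉ S

lemma WSep.symm {V : Type} {G : SimpleGraph V} {A B S : Set V} (h : WSep G A B S) :
    WSep G B A S := by
  intro b hb a ha p
  obtain ⟨s, hs, hS⟩ := h a ha b hb p.reverse
  exact ⟨s, by simpa using hs, hS⟩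

lemma closure_walk {V : Type} {G : SimpleGraph V} {T Q : Set V}
    (hcl : ∀ u v, u ∈ Q → G.Adj u v → v ∉ T → v ∈ Q) :
    ∀ {a b : V} (p : G.Walk a b), a ∈ Q → (∀ w ∈ p.support, w ∉ T) → b ∈ Q := by
  intro a b p
  induction p with
  | nil => intro h _; exact h
  | cons h p ih =>
    intro ha hw
    refine ih (hcl _ _ ha h (hw _ ?_)) (fun w hw' => hw w ?_)
    · simp
    · simp [hw']

lemma Rch.step {V : Type} {G : SimpleGraph V} {A S : Set V} {u v : V} (h : Rch G A S u)
    (e : G.Adj u v) (hv : v ∉ S) : Rch G A S v := by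
  obtain ⟨a, ha, p, hp⟩ := h
  refine ⟨a, ha, p.concat e, ?_⟩
  intro w hw
  rw [Walk.support_concat] at hw
  simp at hw
  rcases hw with hw | rfl
  · exact hp _ hw
  · exact hv

lemma Rch.self {V : Type} {G : SimpleGraph V} {A S : Set V} {u : V} (h : u ∈ A) (hu : u ∉ S) :
    Rch G A S u := ⟨u, h, Walk.nil, by simpa using hu⟩

lemma Rch.mono {V : Type} {G : SimpleGraph V} {A S S' : Set V} {u : V} (h : Rch G A S u)
    (hS : S' ⊆ S) : Rch G A S' u := by
  obtain ⟨a, ha, p, hp⟩ := h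
  exact ⟨a, ha, p, fun w hw h' => hp w hw (hS h')⟩

lemma Rch.notMem {V : Type} {G : SimpleGraph V} {A S : Set V} {u : V} (h : Rch G A S u) :
    u ∉ S := by
  obtain ⟨a, ha, p, hp⟩ := h
  exact hp _ (by simp)

lemma menger_claim {V : Type} {G G' : SimpleGraph V} {A B S T : Set V} {x y : V}
    (hG' : ∀ u v, G.Adj u v → G'.Adj u v ∨ (u = x ∧ v = y) ∨ (u = y ∧ v = x))
    (hS : WSep G' A B S) (hy : ¬ Rch G' A S y)
    (hT : WSep G' A (insert x S) T) : WSep G A B T := by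
  intro a ha b hb p
  by_contra hcon
  push Not at hcon
  have hT' : ∀ v, v ∈ insert x S → ¬ Rch G' A T v := by
    rintro v hv ⟨a, ha, p, hp⟩
    obtain ⟨s, hs, hs'⟩ := hT a ha v hv p
    exact hp s hs hs'
  have key : b ∈ {v | Rch G' A (T ∪ insert x S) v} := by
    refine closure_walk (G := G) (T := T) ?_ p ?_ hcon
    · intro u v hu huv hv
      have hu' : Rch G' A (T ∪ insert x S) u := hu
      have hadj : G'.Adj u v := by
        rcases hG' u v huv with h | ⟨rfl, rfl⟩ | ⟨rfl, rfl⟩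
        · exact h
        · exact absurd (Or.inr (Or.inl rfl)) hu'.notMem
        · exact absurd (hu'.mono (by intro z hz; exact Or.inr (Or.inr hz))) hy
      refine hu'.step hadj ?_
      rintro (h | h)
      · exact hv h
      · exact hT' v h ((hu'.mono (fun z hz => Or.inl hz)).step hadj hv)
    · have haT := hcon a (by simp)
      refine Rch.self ha ?_
      rintro (h | h)
      · exact haT h
      · exact hT' a h (Rch.self ha haT)
  have key' : Rch G' A (T ∪ insert x S) b := key
  obtain ⟨a', ha', q, hq⟩ := key'
  obtain ⟨s, hs, hs'⟩ := hS a' ha' b hb q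
  exact hq s hs (Or.inr (Or.inr hs'))

def MPaths {V : Type} (G : SimpleGraph V) (A B : Set V) (k : ℕ) : Prop :=
  ∃ P : Fin k → Set V, (∀ i j, i ≠ j → Disjoint (P i) (P j)) ∧
    ∀ i, ∃ a ∈ A, ∃ b ∈ B, ∃ p : G.Walk a b, ∀ v ∈ p.support, v ∈ P i

lemma MPaths.tight {V : Type} [DecidableEq V] {G : SimpleGraph V} {A : Set V} {B : Finset V} {k : ℕ}
    (h : MPaths G A B k) (hk : B.card = k) :
    ∃ P : V → Set V, (∀ s ∈ B, ∀ t ∈ B, s ≠ t → Disjoint (P s) (P t)) ∧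
      ∀ s ∈ B, ∃ a ∈ A, ∃ p : G.Walk a s, p.IsPath ∧ ∀ v, v ∈ p.support ↔ v ∈ P s := by
  obtain ⟨P, hd, hP⟩ := h
  choose a ha b hb p hp using hP
  have hbP : ∀ i, b i ∈ P i := fun i => hp i _ (by simp)
  have hinj : Function.Injective (fun i => (⟨b i, hb i⟩ : B)) := by
    intro i j hij
    by_contra hne
    have : b i = b j := by simpa using hij
    exact Set.disjoint_left.1 (hd i j hne) (hbP i) (this ▸ hbP j)
  have hbij : Function.Bijective (fun i => (⟨b i, hb i⟩ : B)) := by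
    rw [Fintype.bijective_iff_injective_and_card]
    exact ⟨hinj, by simp [hk]⟩
  have hsurj : ∀ s ∈ B, ∃ i, b i = s := by
    intro s hs
    obtain ⟨i, hi⟩ := hbij.2 ⟨s, hs⟩
    exact ⟨i, by simpa using hi⟩
  refine ⟨fun s => {v | ∃ i, b i = s ∧ v ∈ (p i).bypass.support}, ?_, ?_⟩
  · intro s hs t ht hst
    rw [Set.disjoint_left]
    rintro v ⟨i, hi, hvi⟩ ⟨j, hj, hvj⟩
    have hij : i ≠ j := by rintro rfl; exact hst (hi.symm.trans hj)
    exact Set.disjoint_left.1 (hd i j hij) (hp i _ (Walk.support_bypass_subset_support _ hvi))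
      (hp j _ (Walk.support_bypass_subset_support _ hvj))
  · intro s hs
    obtain ⟨i, rfl⟩ := hsurj s hs
    refine ⟨a i, ha i, (p i).bypass, Walk.bypass_isPath _, ?_⟩
    intro v
    constructor
    · intro hv; exact ⟨i, rfl, hv⟩
    · rintro ⟨j, hj, hv⟩
      have : j = i := hinj (by simpa using hj)
      subst this; exact hv

theorem menger_s15 {V : Type} [Fintype V] [DecidableEq V] (G : SimpleGraph V) :
    ∀ (A B : Set V) (k : ℕ), (∀ S : Finset V, WSep G A B S → k ≤ S.card) → MPaths G A B k := by
  classical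
  induction G using WellFoundedLT.induction with
  | ind G ih =>
  intro A B k hk
  by_cases hE : ∃ x y, G.Adj x y
  swap
  · push Not at hE
    have h1 := hk (Finset.univ.filter (fun v => v ∈ A ∧ v ∈ B)) (by
      intro a ha b hb p
      cases p with
      | nil => exact ⟨a, by simp, by simp [ha, hb]⟩
      | cons h p => exact absurd h (hE _ _))
    obtain ⟨T, hT, hTk⟩ := Finset.exists_subset_card_eq h1
    let f := T.equivFinOfCardEq hTk
    refine ⟨fun i => {((f.symm i : T) : V)}, ?_, ?_⟩
    · intro i j hij
      simp only [Set.disjoint_singleton, ne_eq]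
      intro h
      exact hij (f.symm.injective (Subtype.ext h))
    · intro i
      have := hT (f.symm i).2
      simp at this
      exact ⟨_, this.1, _, this.2, Walk.nil, by simp⟩
  obtain ⟨x0, y0, hxy0⟩ := hE
  set G' := G.deleteEdges {s(x0, y0)} with hG'
  have hle : G' ≤ G := deleteEdges_le _
  have hlt : G' < G := by
    refine lt_of_le_of_ne hle ?_
    intro h
    have : G'.Adj x0 y0 := h ▸ hxy0
    simp [hG'] at this
  by_cases hall : ∀ S : Finset V, WSep G' A B S → k ≤ S.card
  · obtain ⟨P, hd, hP⟩ := ih G' hlt A B k hall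
    refine ⟨P, hd, fun i => ?_⟩
    obtain ⟨a, ha, b, hb, p, hp⟩ := hP i
    exact ⟨a, ha, b, hb, p.mapLe hle, by simpa using hp⟩
  push Not at hall
  obtain ⟨S, hS, hSk⟩ := hall
  have hnS : ¬ WSep G A B S := fun h => absurd (hk S h) (by omega)
  -- find crossing edge
  have hcross : ∃ x y, (s(x, y) = s(x0, y0)) ∧ Rch G' A S x ∧ ¬ Rch G' A S y ∧ y ∉ S := by
    by_contra hcon
    apply hnS
    intro a ha b hb p
    by_contra hp
    push Not at hp
    have : b ∈ {v | Rch G' A S v} := by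
      refine closure_walk (G := G) (T := S) ?_ p (Rch.self ha (hp a (by simp))) hp
      intro u v hu huv hv
      by_contra hnv
      apply hcon
      refine ⟨u, v, ?_, hu, hnv, hv⟩
      by_contra hne
      apply hnv
      have hu' : Rch G' A S u := hu
      refine hu'.step ?_ hv
      rw [hG', deleteEdges_adj]
      exact ⟨huv, by simpa using hne⟩
    have this' : Rch G' A S b := this
    obtain ⟨a', ha', q, hq⟩ := this'
    obtain ⟨s, hs, hs'⟩ := hS a' ha' b hb q
    exact hq s hs hs'
  obtain ⟨x, y, hxy, hx, hy, hyS⟩ := hcross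
  have hxS : x ∉ S := by simpa using hx.notMem
  have hadj : G.Adj x y := by
    rw [← mem_edgeSet, hxy]; exact hxy0
  have hG1 : ∀ u v, G.Adj u v → G'.Adj u v ∨ (u = x ∧ v = y) ∨ (u = y ∧ v = x) := by
    intro u v huv
    by_cases h : s(u, v) = s(x, y)
    · right; simpa using h
    · left
      rw [hG', deleteEdges_adj]
      exact ⟨huv, by rw [← hxy]; simpa using h⟩
  have hxB : ¬ Rch G' B S x := by
    rintro ⟨b, hb, q, hq⟩
    obtain ⟨a, ha, p, hp⟩ := hx
    obtain ⟨s, hs, hs'⟩ := hS a ha b hb (p.append q.reverse)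
    rw [Walk.mem_support_append_iff] at hs
    rcases hs with hs | hs
    · exact hp s hs hs'
    · exact hq s (by simpa using hs) hs'
  have hSA : ∀ T, WSep G' A (insert x (S : Set V)) T → WSep G A B T := fun T hT =>
    menger_claim hG1 hS hy hT
  have hSB : ∀ T, WSep G' B (insert y (S : Set V)) T → WSep G A B T := fun T hT =>
    (menger_claim (x := y) (y := x) (fun u v h => by
      rcases hG1 u v h with h | h | h
      · exact Or.inl h
      · exact Or.inr (Or.inr h)
      · exact Or.inr (Or.inl h)) hS.symm hxB hT).symm
  have hcA : (insert x S).card = k := by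
    have h1 : k ≤ (insert x S).card := hk _ (hSA _ (by
      intro a ha b hb p
      exact ⟨b, by simp, by simpa using hb⟩))
    have h2 := Finset.card_insert_le x S
    omega
  have hcB : (insert y S).card = k := by
    have h1 : k ≤ (insert y S).card := hk _ (hSB _ (by
      intro a ha b hb p
      exact ⟨b, by simp, by simpa using hb⟩))
    have h2 := Finset.card_insert_le y S
    omega
  obtain ⟨P, hPd, hP⟩ := (ih G' hlt A ((insert x S : Finset V) : Set V) k
    (fun T hT => hk T (hSA T (by simpa using hT)))).tight hcA
  obtain ⟨Q, hQd, hQ⟩ := (ih G' hlt B ((insert y S : Finset V) : Set V) k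
    (fun T hT => hk T (hSB T (by simpa using hT)))).tight hcB
  have hPm : ∀ s ∈ insert x S, s ∈ P s := by
    intro s hs
    obtain ⟨a, ha, p, _, hp⟩ := hP s hs
    exact (hp s).1 (by simp)
  have hQm : ∀ s ∈ insert y S, s ∈ Q s := by
    intro s hs
    obtain ⟨a, ha, p, _, hp⟩ := hQ s hs
    exact (hp s).1 (by simp)
  have hPu : ∀ s ∈ insert x S, ∀ z ∈ insert x S, z ∈ P s → z = s := by
    intro s hs z hz h
    by_contra hne
    exact Set.disjoint_left.1 (hPd z hz s hs hne) (hPm z hz) h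
  have hQu : ∀ s ∈ insert y S, ∀ z ∈ insert y S, z ∈ Q s → z = s := by
    intro s hs z hz h
    by_contra hne
    exact Set.disjoint_left.1 (hQd z hz s hs hne) (hQm z hz) h
  have hcr : ∀ s ∈ insert x S, ∀ t ∈ insert y S, ∀ v, v ∈ P s → v ∈ Q t → v = s ∧ v = t ∧ v ∈ S := by
    intro s hs t ht v hvP hvQ
    have hvS : v ∈ S := by
      obtain ⟨a, ha, p, hpp, hp⟩ := hP s hs
      obtain ⟨b, hb, q, hqq, hq⟩ := hQ t ht
      have hvp := (hp v).2 hvP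
      have hvq := (hq v).2 hvQ
      obtain ⟨z, hz, hz'⟩ := hS a ha b hb ((p.takeUntil v hvp).append (q.takeUntil v hvq).reverse)
      have hz' : z ∈ S := hz'
      rw [Walk.mem_support_append_iff] at hz
      rcases hz with hz | hz
      · have h1 := hPu s hs z (by simp [hz']) ((hp z).1 (p.support_takeUntil_subset_support hvp hz))
        subst h1
        by_contra hne
        exact Walk.endpoint_notMem_support_takeUntil hpp hvp (by rintro rfl; exact hne hz') hz
      · rw [Walk.support_reverse, List.mem_reverse] at hz
        have h1 := hQu t ht z (by simp [hz']) ((hq z).1 (q.support_takeUntil_subset_support hvq hz))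
        subst h1
        by_contra hne
        exact Walk.endpoint_notMem_support_takeUntil hqq hvq (by rintro rfl; exact hne hz') hz
    exact ⟨hPu s hs v (by simp [hvS]) hvP, hQu t ht v (by simp [hvS]) hvQ, hvS⟩
  let σ : V → V := fun s => if s = x then y else s
  have hσ : ∀ s ∈ insert x S, σ s ∈ insert y S := by
    intro s hs
    by_cases h : s = x
    · simp [σ, h]
    · simp only [σ, h, if_false]
      simp [h] at hs
      simp [hs]
  have hσi : ∀ s ∈ insert x S, ∀ t ∈ insert x S, s ≠ t → σ s ≠ σ t := by
    intro s hs t ht hst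
    simp only [Finset.mem_insert] at hs ht
    by_cases h : s = x <;> by_cases h' : t = x
    · exact absurd (h.trans h'.symm) hst
    · simp only [σ, h, h', if_true, if_false]
      rintro rfl
      exact hyS (by simpa using ht.resolve_left h')
    · simp only [σ, h, h', if_true, if_false]
      rintro rfl
      exact hyS (by simpa using hs.resolve_left h)
    · simpa [σ, h, h'] using hst
  have hσS : ∀ s, s ∈ S → σ s = s := by
    intro s hs
    have : s ≠ x := by rintro rfl; exact hxS hs
    simp [σ, this]
  let f := (insert x S).equivFinOfCardEq hcA
  have hσst : ∀ s ∈ insert x S, ∀ t ∈ insert x S, s ≠ t → ∀ v, v ∈ P s → v ∈ Q (σ t) → False := by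
    intro s hs t ht hst v h1 h2
    obtain ⟨h3, h4, h5⟩ := hcr s hs _ (hσ t ht) v h1 h2
    subst h3
    have := hσS v h5
    exact hσi v hs t ht hst (this.trans h4)
  refine ⟨fun i => P (f.symm i) ∪ Q (σ (f.symm i)), ?_, ?_⟩
  · intro i j hij
    have hne : ((f.symm i : _) : V) ≠ f.symm j := fun h => hij (f.symm.injective (Subtype.ext h))
    have hi := (f.symm i).2
    have hj := (f.symm j).2
    rw [Set.disjoint_left]
    rintro v (h1 | h1) (h2 | h2)
    · exact Set.disjoint_left.1 (hPd _ hi _ hj hne) h1 h2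
    · exact hσst _ hi _ hj hne v h1 h2
    · exact hσst _ hj _ hi hne.symm v h2 h1
    · exact Set.disjoint_left.1 (hQd _ (hσ _ hi) _ (hσ _ hj) (hσi _ hi _ hj hne)) h1 h2
  · intro i
    have hi := (f.symm i).2
    obtain ⟨a, ha, p, _, hp⟩ := hP _ hi
    obtain ⟨b, hb, q, _, hq⟩ := hQ _ (hσ _ hi)
    beta_reduce
    generalize ((f.symm i : _) : V) = s at *
    have hw : ∃ w : G.Walk s (σ s), ∀ v ∈ w.support, v = s ∨ v = σ s := by
      by_cases h : s = x
      · subst h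
        have : σ s = y := by simp [σ]
        rw [this]
        exact ⟨hadj.toWalk, by simp⟩
      · have : σ s = s := by simp [σ, h]
        rw [this]
        exact ⟨Walk.nil, by simp⟩
    obtain ⟨w, hw⟩ := hw
    refine ⟨a, ha, b, hb, (p.mapLe hle).append (w.append (q.mapLe hle).reverse), ?_⟩
    intro v hv
    simp only [Walk.mem_support_append_iff, Walk.support_reverse, List.mem_reverse,
      Walk.support_mapLe_eq_support] at hv
    rcases hv with hv | hv | hv
    · exact Or.inl ((hp v).1 hv)
    · rcases hw v hv with rfl | rfl
      · exact Or.inl (hPm _ hi)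
      · exact Or.inr (hQm _ (hσ _ hi))
    · exact Or.inr ((hq v).1 hv)


def HP {V : Type} [DecidableEq V] (G : SimpleGraph V) (u v : V) (S : Finset V) (n : ℕ) : Prop :=
  S.card = n ∧ ∃ p : G.Walk u v, p.IsPath ∧ p.support.toFinset = S

def Lk {V : Type} [DecidableEq V] (G : SimpleGraph V) (v w : V) (T : Finset V) : Prop :=
  (T = ∅ ∧ G.Adj v w) ∨ ∃ a b n, G.Adj v a ∧ HP G a b T n ∧ G.Adj b w

section moves
variable {V : Type} [DecidableEq V] {G : SimpleGraph V}

lemma HP.symm {u v : V} {S : Finset V} {n : ℕ} (h : HP G u v S n) : HP G v u S n := by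
  obtain ⟨h, p, hp, hS⟩ := h
  exact ⟨h, p.reverse, hp.reverse, by simpa using hS⟩

lemma HP.join {u v w z : V} {S T : Finset V} {n k : ℕ} (h : HP G u v S n) (e : G.Adj v w)
    (h' : HP G w z T k) (hd : Disjoint S T) : HP G u z (S ∪ T) (n + k) := by
  obtain ⟨h, p, hp, rfl⟩ := h
  obtain ⟨h', q, hq, rfl⟩ := h'
  refine ⟨by rw [Finset.card_union_of_disjoint hd, h, h'], p.append (Walk.cons e q), ?_, ?_⟩
  · rw [Walk.isPath_def, Walk.support_append, Walk.support_cons, List.tail_cons,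
      List.nodup_append]
    refine ⟨hp.support_nodup, hq.support_nodup, ?_⟩
    intro a ha b hb hab
    subst hab
    exact Finset.disjoint_left.1 hd (by simpa using ha) (by simpa using hb)
  · ext v
    simp [Walk.mem_support_append_iff]
    constructor
    · rintro (h | rfl | h)
      · exact Or.inl h
      · exact Or.inl (by simp)
      · exact Or.inr h
    · rintro (h | h)
      · exact Or.inl h
      · exact Or.inr (Or.inr h)

lemma Lk.symm {u v : V} {S : Finset V} (h : Lk G u v S) : Lk G v u S := by
  rcases h with ⟨h, h'⟩ | ⟨a, b, n, h1, h2, h3⟩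
  · exact Or.inl ⟨h, h'.symm⟩
  · exact Or.inr ⟨b, a, n, h3.symm, h2.symm, h1.symm⟩

lemma HP.splice {u v w z : V} {S T U : Finset V} {n k : ℕ} (h : HP G u v S n) (e : Lk G v w T)
    (h' : HP G w z U k) (h1 : Disjoint S T) (h2 : Disjoint S U) (h3 : Disjoint T U) :
    HP G u z (S ∪ T ∪ U) (n + T.card + k) := by
  rcases e with ⟨rfl, e⟩ | ⟨a, b, l, e1, e2, e3⟩
  · simpa using h.join e h' h2
  · have := (h.join e1 e2 h1).join e3 h' (by simp [Finset.disjoint_union_left, h2, h3])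
    rw [← e2.1] at this
    exact this

lemma Lk.lk {x y y' x' : V} {T J T' : Finset V} {n : ℕ} (h : Lk G x y T) (hJ : HP G y y' J n)
    (h' : Lk G y' x' T') (h1 : Disjoint T J) (h2 : Disjoint T T') (h3 : Disjoint J T') :
    Lk G x x' (T ∪ J ∪ T') := by
  rcases h with ⟨rfl, e⟩ | ⟨a, b, l, e1, e2, e3⟩ <;> rcases h' with ⟨rfl, e'⟩ | ⟨a', b', l', e1', e2', e3'⟩
  · exact Or.inr ⟨y, y', n, e, by simpa using hJ, e'⟩
  · exact Or.inr ⟨y, b', _, e, by simpa using hJ.join e1' e2' h3, e3'⟩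
  · exact Or.inr ⟨a, y', _, e1, by simpa using e2.join e3 hJ h1, e'⟩
  · exact Or.inr ⟨a, b', _, e1, (e2.join e3 hJ h1).join e1' e2'
      (by simp [Finset.disjoint_union_left, h2, h3]), e3'⟩

def PthF (G : SimpleGraph V) (N : ℕ) (x : ℕ → V) : Prop :=
  (∀ i j, i < N → j < N → x i = x j → i = j) ∧ ∀ i, i + 1 < N → G.Adj (x i) (x (i + 1))

def img (x : ℕ → V) (i j : ℕ) : Finset V := (Finset.Icc i j).image x

lemma PthF.hp {N : ℕ} {x : ℕ → V} (h : PthF G N x) {i j : ℕ} (hij : i ≤ j) (hj : j < N) :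
    HP G (x i) (x j) (img x i j) (j + 1 - i) := by
  induction j, hij using Nat.le_induction with
  | base => exact ⟨by simp [img], Walk.nil, by simp, by simp [img]⟩
  | succ j hij ih =>
    have h1 : HP G (x (j + 1)) (x (j + 1)) {x (j+1)} 1 := ⟨by simp, Walk.nil, by simp, by simp⟩
    have h2 := (ih (by omega)).join (h.2 j hj) h1 (by
      simp only [Finset.disjoint_singleton_right, img, Finset.mem_image, Finset.mem_Icc, not_exists,
        not_and]
      rintro k ⟨_, hk⟩ hx
      have := h.1 _ _ (by omega) hj hx
      omega)
    have h3 : img x i (j + 1) = img x i j ∪ {x (j + 1)} := by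
      ext v
      simp only [img, Finset.mem_image, Finset.mem_Icc, Finset.mem_union, Finset.mem_singleton]
      constructor
      · rintro ⟨k, hk, rfl⟩
        by_cases hk' : k = j + 1
        · right; rw [hk']
        · left; exact ⟨k, by omega, rfl⟩
      · rintro (⟨k, hk, rfl⟩ | rfl)
        · exact ⟨k, by omega, rfl⟩
        · exact ⟨j + 1, by omega, rfl⟩
    rw [h3]
    convert h2 using 1
    omega

lemma PthF.disj {N : ℕ} {x : ℕ → V} (h : PthF G N x) {i j k l : ℕ} (hjk : j < k) (hl : l < N) :
    Disjoint (img x i j) (img x k l) := by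
  rw [Finset.disjoint_left]
  simp only [img, Finset.mem_image, Finset.mem_Icc]
  rintro _ ⟨a, ha, rfl⟩ ⟨b, hb, hab⟩
  have := h.1 _ _ (by omega) (by omega) hab
  omega

lemma img_disj {N : ℕ} {x : ℕ → V} {D : Finset V} (hD : ∀ i < N, x i ∉ D) {i j : ℕ} (hj : j < N) :
    Disjoint (img x i j) D := by
  rw [Finset.disjoint_left]
  simp only [img, Finset.mem_image, Finset.mem_Icc]
  rintro _ ⟨a, ha, rfl⟩
  exact hD a (by omega)

variable {N : ℕ} {x : ℕ → V}

lemma mv1 (h : PthF G N x) (hmax : ∀ u v S n, HP G u v S n → n ≤ N) {p q : ℕ} (hpq : p < q)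
    (hq : q < N) {D : Finset V} (hD : ∀ i < N, x i ∉ D) (l : Lk G (x p) (x q) D) :
    D.card + 1 + p ≤ q := by
  have h1 := (h.hp (Nat.zero_le p) (by omega)).splice l (h.hp (show q ≤ N - 1 by omega) (by omega))
    (img_disj hD (by omega)) (h.disj hpq (by omega)) (img_disj hD (by omega)).symm
  have := hmax _ _ _ _ h1
  omega

lemma mv2 (h : PthF G N x) (hmax : ∀ u v S n, HP G u v S n → n ≤ N) {p1 q1 p2 q2 : ℕ}
    (h1 : p1 < q1) (h2 : q1 < p2) (h3 : p2 < q2)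
    (h4 : q2 < N) {D1 D2 : Finset V} (hD1 : ∀ i < N, x i ∉ D1) (hD2 : ∀ i < N, x i ∉ D2)
    (hd : Disjoint D1 D2)
    (l1 : Lk G (x p1) (x p2) D1) (l2 : Lk G (x q1) (x q2) D2) :
    D1.card + D2.card + 2 + p1 + p2 ≤ q1 + q2 := by
  have a0 := h.hp (Nat.zero_le p1) (by omega)
  have a1 := (h.hp h2.le (by omega)).symm
  have a2 := h.hp (show q2 ≤ N - 1 by omega) (by omega)
  have b1 := (a0.splice l1 a1 (by exact img_disj hD1 (by omega)) (by exact h.disj (by omega) (by omega))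
    (by exact (img_disj hD1 (by omega)).symm)).splice l2 a2 (by
      simp only [Finset.disjoint_union_left]
      exact ⟨⟨img_disj hD2 (by omega), hd⟩, img_disj hD2 (by omega)⟩) (by
      simp only [Finset.disjoint_union_left]
      exact ⟨⟨h.disj (by omega) (by omega), (img_disj hD1 (by omega)).symm⟩,
        h.disj (by omega) (by omega)⟩) (by exact (img_disj hD2 (by omega)).symm)
  have := hmax _ _ _ _ b1
  omega

/-- double bridge -/
lemma mvX (h : PthF G N x) (hmax : ∀ u v S n, HP G u v S n → n ≤ N)
    {p1 q1 p2 q2 p3 q3 p4 q4 : ℕ}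
    (h1 : p1 < q1) (h2 : q1 < p2) (h3 : p2 < q2) (h4 : q2 < p3) (h5 : p3 < q3)
    (h6 : q3 < p4) (h7 : p4 < q4)
    (h8 : q4 < N) {D1 D2 D3 D4 : Finset V} (hD1 : ∀ i < N, x i ∉ D1) (hD2 : ∀ i < N, x i ∉ D2)
    (hD3 : ∀ i < N, x i ∉ D3) (hD4 : ∀ i < N, x i ∉ D4)
    (d12 : Disjoint D1 D2) (d13 : Disjoint D1 D3) (d14 : Disjoint D1 D4)
    (d23 : Disjoint D2 D3) (d24 : Disjoint D2 D4) (d34 : Disjoint D3 D4)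
    (l1 : Lk G (x p1) (x q3) D1) (l2 : Lk G (x q1) (x p3) D2)
    (l3 : Lk G (x p2) (x q4) D3) (l4 : Lk G (x q2) (x p4) D4) :
    D1.card + D2.card + D3.card + D4.card + 4 + p1 + p2 + p3 + p4 ≤ q1 + q2 + q3 + q4 := by
  have a0 := h.hp (Nat.zero_le p1) (by omega)
  have a1 := h.hp h2.le (by omega)
  have a2 := h.hp h4.le (by omega)
  have a3 := h.hp h6.le (by omega)
  have a4 := h.hp (show q4 ≤ N - 1 by omega) (by omega)
  have e1 := fun i j (hj : j < N) => img_disj (i := i) hD1 hj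
  have e2 := fun i j (hj : j < N) => img_disj (i := i) hD2 hj
  have e3 := fun i j (hj : j < N) => img_disj (i := i) hD3 hj
  have e4 := fun i j (hj : j < N) => img_disj (i := i) hD4 hj
  have b1 := a0.splice l1 a3 (by exact e1 _ _ (by omega)) (by exact h.disj (by omega) (by omega))
    (by exact (e1 _ _ (by omega)).symm)
  have b2 := b1.splice l4.symm a2
    (by
      simp only [Finset.disjoint_union_left]
      exact ⟨⟨e4 _ _ (by omega), d14⟩, e4 _ _ (by omega)⟩)
    (by
      simp only [Finset.disjoint_union_left]
      exact ⟨⟨h.disj (by omega) (by omega), (e1 _ _ (by omega)).symm⟩,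
        (h.disj (by omega) (by omega)).symm⟩)
    (by exact (e4 _ _ (by omega)).symm)
  have b3 := b2.splice l2.symm a1
    (by
      simp only [Finset.disjoint_union_left]
      exact ⟨⟨⟨⟨e2 _ _ (by omega), d12⟩, e2 _ _ (by omega)⟩, d24.symm⟩, e2 _ _ (by omega)⟩)
    (by
      simp only [Finset.disjoint_union_left]
      exact ⟨⟨⟨⟨h.disj (by omega) (by omega), (e1 _ _ (by omega)).symm⟩,
        (h.disj (by omega) (by omega)).symm⟩, (e4 _ _ (by omega)).symm⟩,
        (h.disj (by omega) (by omega)).symm⟩)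
    (by exact (e2 _ _ (by omega)).symm)
  have b4 := b3.splice l3 a4
    (by
      simp only [Finset.disjoint_union_left]
      exact ⟨⟨⟨⟨⟨⟨e3 _ _ (by omega), d13⟩, e3 _ _ (by omega)⟩, d34.symm⟩, e3 _ _ (by omega)⟩,
        d23⟩, e3 _ _ (by omega)⟩)
    (by
      simp only [Finset.disjoint_union_left]
      exact ⟨⟨⟨⟨⟨⟨h.disj (by omega) (by omega), (e1 _ _ (by omega)).symm⟩,
        h.disj (by omega) (by omega)⟩, (e4 _ _ (by omega)).symm⟩,
        h.disj (by omega) (by omega)⟩, (e2 _ _ (by omega)).symm⟩, h.disj (by omega) (by omega)⟩)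
    (by exact (e3 _ _ (by omega)).symm)
  have := hmax _ _ _ _ b4
  omega

/-- two consecutive good moves -/
lemma mvS (h : PthF G N x) (hmax : ∀ u v S n, HP G u v S n → n ≤ N)
    {p1 q1 p2 q2 p3 q3 p4 q4 : ℕ}
    (h1 : p1 < q1) (h2 : q1 < p2) (h3 : p2 < q2) (h4 : q2 < p3) (h5 : p3 < q3)
    (h6 : q3 < p4) (h7 : p4 < q4)
    (h8 : q4 < N) {D1 D2 D3 D4 : Finset V} (hD1 : ∀ i < N, x i ∉ D1) (hD2 : ∀ i < N, x i ∉ D2)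
    (hD3 : ∀ i < N, x i ∉ D3) (hD4 : ∀ i < N, x i ∉ D4)
    (d12 : Disjoint D1 D2) (d13 : Disjoint D1 D3) (d14 : Disjoint D1 D4)
    (d23 : Disjoint D2 D3) (d24 : Disjoint D2 D4) (d34 : Disjoint D3 D4)
    (l1 : Lk G (x p1) (x p2) D1) (l2 : Lk G (x q1) (x q2) D2)
    (l3 : Lk G (x p3) (x p4) D3) (l4 : Lk G (x q3) (x q4) D4) :
    D1.card + D2.card + D3.card + D4.card + 4 + p1 + p2 + p3 + p4 ≤ q1 + q2 + q3 + q4 := by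
  have a0 := h.hp (Nat.zero_le p1) (by omega)
  have a1 := (h.hp h2.le (by omega)).symm
  have a2 := h.hp h4.le (by omega)
  have a3 := (h.hp h6.le (by omega)).symm
  have a4 := h.hp (show q4 ≤ N - 1 by omega) (by omega)
  have e1 := fun i j (hj : j < N) => img_disj (i := i) hD1 hj
  have e2 := fun i j (hj : j < N) => img_disj (i := i) hD2 hj
  have e3 := fun i j (hj : j < N) => img_disj (i := i) hD3 hj
  have e4 := fun i j (hj : j < N) => img_disj (i := i) hD4 hj
  have b1 := a0.splice l1 a1 (by exact e1 _ _ (by omega)) (by exact h.disj (by omega) (by omega))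
    (by exact (e1 _ _ (by omega)).symm)
  have b2 := b1.splice l2 a2
    (by
      simp only [Finset.disjoint_union_left]
      exact ⟨⟨e2 _ _ (by omega), d12⟩, e2 _ _ (by omega)⟩)
    (by
      simp only [Finset.disjoint_union_left]
      exact ⟨⟨h.disj (by omega) (by omega), (e1 _ _ (by omega)).symm⟩,
        h.disj (by omega) (by omega)⟩)
    (by exact (e2 _ _ (by omega)).symm)
  have b3 := b2.splice l3 a3
    (by
      simp only [Finset.disjoint_union_left]
      exact ⟨⟨⟨⟨e3 _ _ (by omega), d13⟩, e3 _ _ (by omega)⟩, d23⟩, e3 _ _ (by omega)⟩)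
    (by
      simp only [Finset.disjoint_union_left]
      exact ⟨⟨⟨⟨h.disj (by omega) (by omega), (e1 _ _ (by omega)).symm⟩,
        h.disj (by omega) (by omega)⟩, (e2 _ _ (by omega)).symm⟩,
        h.disj (by omega) (by omega)⟩)
    (by exact (e3 _ _ (by omega)).symm)
  have b4 := b3.splice l4 a4
    (by
      simp only [Finset.disjoint_union_left]
      exact ⟨⟨⟨⟨⟨⟨e4 _ _ (by omega), d14⟩, e4 _ _ (by omega)⟩, d24⟩, e4 _ _ (by omega)⟩,
        d34⟩, e4 _ _ (by omega)⟩)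
    (by
      simp only [Finset.disjoint_union_left]
      exact ⟨⟨⟨⟨⟨⟨h.disj (by omega) (by omega), (e1 _ _ (by omega)).symm⟩,
        h.disj (by omega) (by omega)⟩, (e2 _ _ (by omega)).symm⟩,
        h.disj (by omega) (by omega)⟩, (e3 _ _ (by omega)).symm⟩, h.disj (by omega) (by omega)⟩)
    (by exact (e4 _ _ (by omega)).symm)
  have := hmax _ _ _ _ b4
  omega

/-- two nested good moves: outer `(p1,q1),(p4,q4)`, inner `(p2,q2),(p3,q3)` -/
lemma mvN (h : PthF G N x) (hmax : ∀ u v S n, HP G u v S n → n ≤ N)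
    {p1 q1 p2 q2 p3 q3 p4 q4 : ℕ}
    (h1 : p1 < q1) (h2 : q1 < p2) (h3 : p2 < q2) (h4 : q2 < p3) (h5 : p3 < q3)
    (h6 : q3 < p4) (h7 : p4 < q4)
    (h8 : q4 < N) {D1 D2 D3 D4 : Finset V} (hD1 : ∀ i < N, x i ∉ D1) (hD2 : ∀ i < N, x i ∉ D2)
    (hD3 : ∀ i < N, x i ∉ D3) (hD4 : ∀ i < N, x i ∉ D4)
    (d12 : Disjoint D1 D2) (d13 : Disjoint D1 D3) (d14 : Disjoint D1 D4)
    (d23 : Disjoint D2 D3) (d24 : Disjoint D2 D4) (d34 : Disjoint D3 D4)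
    (l1 : Lk G (x p1) (x p4) D1) (l2 : Lk G (x q1) (x q4) D2)
    (l3 : Lk G (x p2) (x p3) D3) (l4 : Lk G (x q2) (x q3) D4) :
    D1.card + D2.card + D3.card + D4.card + 4 + p1 + p2 + p3 + p4 ≤ q1 + q2 + q3 + q4 := by
  have a0 := h.hp (Nat.zero_le p1) (by omega)
  have a1 := (h.hp h2.le (by omega)).symm
  have a2 := h.hp h4.le (by omega)
  have a3 := (h.hp h6.le (by omega)).symm
  have a4 := h.hp (show q4 ≤ N - 1 by omega) (by omega)
  have e1 := fun i j (hj : j < N) => img_disj (i := i) hD1 hj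
  have e2 := fun i j (hj : j < N) => img_disj (i := i) hD2 hj
  have e3 := fun i j (hj : j < N) => img_disj (i := i) hD3 hj
  have e4 := fun i j (hj : j < N) => img_disj (i := i) hD4 hj
  have b1 := a0.splice l1 a3 (by exact e1 _ _ (by omega)) (by exact h.disj (by omega) (by omega))
    (by exact (e1 _ _ (by omega)).symm)
  have b2 := b1.splice l4.symm a2
    (by
      simp only [Finset.disjoint_union_left]
      exact ⟨⟨e4 _ _ (by omega), d14⟩, e4 _ _ (by omega)⟩)
    (by
      simp only [Finset.disjoint_union_left]
      exact ⟨⟨h.disj (by omega) (by omega), (e1 _ _ (by omega)).symm⟩,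
        (h.disj (by omega) (by omega)).symm⟩)
    (by exact (e4 _ _ (by omega)).symm)
  have b3 := b2.splice l3.symm a1
    (by
      simp only [Finset.disjoint_union_left]
      exact ⟨⟨⟨⟨e3 _ _ (by omega), d13⟩, e3 _ _ (by omega)⟩, d34.symm⟩, e3 _ _ (by omega)⟩)
    (by
      simp only [Finset.disjoint_union_left]
      exact ⟨⟨⟨⟨h.disj (by omega) (by omega), (e1 _ _ (by omega)).symm⟩,
        (h.disj (by omega) (by omega)).symm⟩, (e4 _ _ (by omega)).symm⟩,
        (h.disj (by omega) (by omega)).symm⟩)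
    (by exact (e3 _ _ (by omega)).symm)
  have b4 := b3.splice l2 a4
    (by
      simp only [Finset.disjoint_union_left]
      exact ⟨⟨⟨⟨⟨⟨e2 _ _ (by omega), d12⟩, e2 _ _ (by omega)⟩, d24.symm⟩, e2 _ _ (by omega)⟩,
        d23.symm⟩, e2 _ _ (by omega)⟩)
    (by
      simp only [Finset.disjoint_union_left]
      exact ⟨⟨⟨⟨⟨⟨h.disj (by omega) (by omega), (e1 _ _ (by omega)).symm⟩,
        h.disj (by omega) (by omega)⟩, (e4 _ _ (by omega)).symm⟩,
        h.disj (by omega) (by omega)⟩, (e3 _ _ (by omega)).symm⟩, h.disj (by omega) (by omega)⟩)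
    (by exact (e2 _ _ (by omega)).symm)
  have := hmax _ _ _ _ b4
  omega

end moves


section cfg
variable {V : Type} [DecidableEq V] {G : SimpleGraph V} {ι : Type}

structure Cfg (G : SimpleGraph V) (N : ℕ) (x y : ℕ → V) (px py : ι → ℕ) (T : ι → Finset V) :
    Prop where
  hx : PthF G N x
  hy : PthF G N y
  hmax : ∀ u v S n, HP G u v S n → n ≤ N
  pxN : ∀ e, px e < N
  pyN : ∀ e, py e < N
  pxi : ∀ e f, px e = px f → e = f
  pyi : ∀ e f, py e = py f → e = f
  lk : ∀ e, Lk G (x (px e)) (y (py e)) (T e)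
  Tx : ∀ e, ∀ i < N, x i ∉ T e
  Ty : ∀ e, ∀ i < N, y i ∉ T e
  Td : ∀ e f, e ≠ f → Disjoint (T e) (T f)
  nx : ∀ e, ∀ i < N, x (px e) ≠ y i
  ny : ∀ e, ∀ i < N, y (py e) ≠ x i

lemma Cfg.symm {N : ℕ} {x y : ℕ → V} {px py : ι → ℕ} {T : ι → Finset V}
    (c : Cfg G N x y px py T) : Cfg G N y x py px T where
  hx := c.hy
  hy := c.hx
  hmax := c.hmax
  pxN := c.pyN
  pyN := c.pxN
  pxi := c.pyi
  pyi := c.pxi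
  lk := fun e => (c.lk e).symm
  Tx := c.Ty
  Ty := c.Tx
  Td := c.Td
  nx := c.ny
  ny := c.nx

open Classical in
/-- number of vertices of `x` before position `p` that lie on `y` -/
noncomputable def seg (N : ℕ) (x y : ℕ → V) (p : ℕ) : ℕ :=
  ((Finset.range p).filter (fun q => ∃ j < N, x q = y j)).card

lemma seg_mono (N : ℕ) (x y : ℕ → V) : Monotone (seg N x y) := by
  intro p q h
  apply Finset.card_le_card
  apply Finset.filter_subset_filter
  simpa using h

lemma seg_lt {N : ℕ} {x y : ℕ → V} {p q : ℕ} (h : seg N x y p < seg N x y q) : p < q := by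
  by_contra hh
  have := seg_mono N x y (not_lt.1 hh)
  omega

lemma seg_inner {N : ℕ} {x y : ℕ → V} {p r q : ℕ} (h : seg N x y p = seg N x y q) (h1 : p ≤ r)
    (h2 : r < q) : ∀ j < N, x r ≠ y j := by
  classical
  intro j hj hxy
  have : seg N x y p < seg N x y q := by
    unfold seg
    apply Finset.card_lt_card
    rw [Finset.ssubset_iff_of_subset]
    · refine ⟨r, ?_, ?_⟩
      · simp only [Finset.mem_filter, Finset.mem_range]
        exact ⟨h2, j, hj, hxy⟩
      · simp only [Finset.mem_filter, Finset.mem_range]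
        intro h; omega
    · intro z
      simp only [Finset.mem_filter, Finset.mem_range]
      rintro ⟨a, b⟩
      exact ⟨by omega, b⟩
  omega

def dd (a b : ℕ) : ℕ := max a b - min a b

def Dt (y : ℕ → V) (py : ι → ℕ) (T : ι → Finset V) (e f : ι) : Finset V :=
  T e ∪ img y (min (py e) (py f)) (max (py e) (py f)) ∪ T f

variable {N : ℕ} {x y : ℕ → V} {px py : ι → ℕ} {T : ι → Finset V}

lemma Dt_mem (c : Cfg G N x y px py T) {e f : ι}
    (hs : seg N y x (py e) = seg N y x (py f)) {v : V} (hv : v ∈ Dt y py T e f) :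
    v ∈ T e ∨ v ∈ T f ∨ ∃ j < N, v = y j ∧ seg N y x j = seg N y x (py e) ∧ ∀ i < N, y j ≠ x i := by
  simp only [Dt, Finset.mem_union, img, Finset.mem_image, Finset.mem_Icc] at hv
  rcases hv with (h | ⟨j, ⟨h1, h2⟩, rfl⟩) | h
  · exact Or.inl h
  · refine Or.inr (Or.inr ⟨j, ?_, rfl, ?_, ?_⟩)
    · have := c.pyN e
      have := c.pyN f
      omega
    · have a1 := seg_mono N y x h1
      have a2 := seg_mono N y x h2
      rcases le_total (py e) (py f) with h | h
      · rw [min_eq_left h] at a1; rw [max_eq_right h] at a2; omega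
      · rw [min_eq_right h] at a1; rw [max_eq_left h] at a2; omega
    · by_cases hj : j = max (py e) (py f)
      · rcases max_choice (py e) (py f) with h | h
        · rw [hj, h]; exact c.ny e
        · rw [hj, h]; exact c.ny f
      · refine seg_inner (p := min (py e) (py f)) (q := max (py e) (py f)) ?_ h1 (by omega)
        rcases le_total (py e) (py f) with h | h
        · rw [min_eq_left h, max_eq_right h]; exact hs
        · rw [min_eq_right h, max_eq_left h]; exact hs.symm
  · exact Or.inr (Or.inl h)

lemma Dt_x (c : Cfg G N x y px py T) {e f : ι}
    (hs : seg N y x (py e) = seg N y x (py f)) : ∀ i < N, x i ∉ Dt y py T e f := by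
  intro i hi hv
  rcases Dt_mem c hs hv with h | h | ⟨j, hj, h, _, h'⟩
  · exact c.Tx _ i hi h
  · exact c.Tx _ i hi h
  · exact h' i hi h.symm

lemma Dt_disj (c : Cfg G N x y px py T) {e f e' f' : ι}
    (hs : seg N y x (py e) = seg N y x (py f)) (hs' : seg N y x (py e') = seg N y x (py f'))
    (hne : seg N y x (py e) ≠ seg N y x (py e')) : Disjoint (Dt y py T e f) (Dt y py T e' f') := by
  have n1 : e ≠ e' := by rintro rfl; exact hne rfl
  have n2 : e ≠ f' := by rintro rfl; exact hne hs'.symm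
  have n3 : f ≠ e' := by rintro rfl; exact hne hs
  have n4 : f ≠ f' := by rintro rfl; exact hne (hs.trans hs'.symm)
  rw [Finset.disjoint_left]
  intro v hv hv'
  rcases Dt_mem c hs hv with h | h | ⟨j, hj, h, h1, _⟩ <;>
  rcases Dt_mem c hs' hv' with h' | h' | ⟨j', hj', h', h1', _⟩
  · exact Finset.disjoint_left.1 (c.Td _ _ n1) h h'
  · exact Finset.disjoint_left.1 (c.Td _ _ n2) h h'
  · exact c.Ty _ j' hj' (h' ▸ h)
  · exact Finset.disjoint_left.1 (c.Td _ _ n3) h h'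
  · exact Finset.disjoint_left.1 (c.Td _ _ n4) h h'
  · exact c.Ty _ j' hj' (h' ▸ h)
  · exact c.Ty _ j hj (h ▸ h')
  · exact c.Ty _ j hj (h ▸ h')
  · have := c.hy.1 j j' hj hj' (h.symm.trans h')
    subst this
    omega

lemma Dt_card (c : Cfg G N x y px py T) (e f : ι) : dd (py e) (py f) + 1 ≤ (Dt y py T e f).card := by
  have h1 := c.pyN e
  have h2 := c.pyN f
  have := (c.hy.hp (show min (py e) (py f) ≤ max (py e) (py f) from min_le_max) (by omega)).1
  have h3 : (img y (min (py e) (py f)) (max (py e) (py f))).card ≤ (Dt y py T e f).card := by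
    apply Finset.card_le_card
    intro v hv
    simp [Dt, hv]
  unfold dd
  omega

lemma Dt_lk (c : Cfg G N x y px py T) {e f : ι} (hef : e ≠ f) :
    Lk G (x (px e)) (x (px f)) (Dt y py T e f) := by
  have h1 := c.pyN e
  have h2 := c.pyN f
  have key : HP G (y (py e)) (y (py f)) (img y (min (py e) (py f)) (max (py e) (py f)))
      (max (py e) (py f) + 1 - min (py e) (py f)) := by
    rcases le_total (py e) (py f) with h | h
    · rw [min_eq_left h, max_eq_right h]; exact c.hy.hp h h2
    · rw [min_eq_right h, max_eq_left h]; exact (c.hy.hp h h1).symm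
  exact (c.lk e).lk key (c.lk f).symm (img_disj (c.Ty e) (by omega)).symm (c.Td _ _ hef)
    (img_disj (c.Ty f) (by omega))

lemma half_mult (c : Cfg G N x y px py T) {e f : ι} (hef : e ≠ f)
    (hs : seg N y x (py e) = seg N y x (py f)) :
    dd (py e) (py f) + 2 ≤ dd (px e) (px f) := by
  have hc := Dt_card c e f
  have hl := Dt_lk c hef
  have hD := Dt_x c hs
  have h1 := c.pxN e
  have h2 := c.pxN f
  have hne : px e ≠ px f := fun h => hef (c.pxi _ _ h)
  rcases lt_or_gt_of_ne hne with h | h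
  · have := mv1 c.hx c.hmax h h2 hD hl
    have : dd (px e) (px f) = px f - px e := by unfold dd; omega
    omega
  · have := mv1 c.hx c.hmax h h1 hD hl.symm
    have : dd (px e) (px f) = px e - px f := by unfold dd; omega
    omega

lemma mult (c : Cfg G N x y px py T) {e f : ι}
    (hs : seg N y x (py e) = seg N y x (py f)) (hs' : seg N x y (px e) = seg N x y (px f)) :
    e = f := by
  by_contra hef
  have h1 := half_mult c hef hs
  have h2 := half_mult c.symm hef hs'
  omega

structure C4 (sa sb : ι → ℕ) (A1 A2 B1 B2 : ℕ) (e11 e12 e21 e22 : ι) : Prop where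
  a11 : sa e11 = A1
  a12 : sa e12 = A1
  a21 : sa e21 = A2
  a22 : sa e22 = A2
  b11 : sb e11 = B1
  b12 : sb e12 = B2
  b21 : sb e21 = B1
  b22 : sb e22 = B2

lemma C4.rows {sa sb : ι → ℕ} {A1 A2 B1 B2 : ℕ} {e11 e12 e21 e22 : ι}
    (h : C4 sa sb A1 A2 B1 B2 e11 e12 e21 e22) : C4 sa sb A2 A1 B1 B2 e21 e22 e11 e12 :=
  ⟨h.a21, h.a22, h.a11, h.a12, h.b21, h.b22, h.b11, h.b12⟩

lemma C4.cols {sa sb : ι → ℕ} {A1 A2 B1 B2 : ℕ} {e11 e12 e21 e22 : ι}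
    (h : C4 sa sb A1 A2 B1 B2 e11 e12 e21 e22) : C4 sa sb A1 A2 B2 B1 e12 e11 e22 e21 :=
  ⟨h.a12, h.a11, h.a22, h.a21, h.b12, h.b11, h.b22, h.b21⟩

lemma C4.tr {sa sb : ι → ℕ} {A1 A2 B1 B2 : ℕ} {e11 e12 e21 e22 : ι}
    (h : C4 sa sb A1 A2 B1 B2 e11 e12 e21 e22) : C4 sb sa B1 B2 A1 A2 e11 e21 e12 e22 :=
  ⟨h.b11, h.b21, h.b12, h.b22, h.a11, h.a21, h.a12, h.a22⟩

lemma dd_comm (a b : ℕ) : dd a b = dd b a := by unfold dd; omega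

lemma dd_lt {a b : ℕ} (h : a < b) : dd a b = b - a := by unfold dd; omega

/-- sum of the two distances along a path -/
def sm (px : ι → ℕ) (e11 e12 e21 e22 : ι) : ℕ := dd (px e11) (px e12) + dd (px e21) (px e22)

lemma goodX0 (c : Cfg G N x y px py T) {A1 A2 B1 B2 : ℕ} {e11 e12 e21 e22 : ι}
    (h : C4 (fun e => seg N x y (px e)) (fun e => seg N y x (py e)) A1 A2 B1 B2 e11 e12 e21 e22)
    (hA : A1 < A2) (hB : B1 ≠ B2) (h1 : px e11 < px e12) (h2 : px e21 < px e22) :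
    sm py e11 e21 e12 e22 + 4 ≤ sm px e11 e12 e21 e22 := by
  obtain ⟨a11, a12, a21, a22, b11, b12, b21, b22⟩ := h
  have n1 : e11 ≠ e21 := by rintro rfl; omega
  have n2 : e12 ≠ e22 := by rintro rfl; omega
  have s1 := b11.trans b21.symm
  have s2 := b12.trans b22.symm
  have := mv2 c.hx c.hmax h1 (seg_lt (N := N) (x := x) (y := y) (by omega)) h2 (c.pxN _)
    (Dt_x c s1) (Dt_x c s2) (Dt_disj c s1 s2 (by omega)) (Dt_lk c n1) (Dt_lk c n2)
  have := Dt_card c e11 e21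
  have := Dt_card c e12 e22
  unfold sm
  rw [dd_lt h1, dd_lt h2]
  omega

lemma pne (c : Cfg G N x y px py T) {e f : ι} (h : seg N y x (py e) ≠ seg N y x (py f)) :
    px e ≠ px f := by
  intro h'
  exact h (by rw [c.pxi _ _ h'])

lemma sm_rows (px : ι → ℕ) (e11 e12 e21 e22 : ι) : sm px e21 e22 e11 e12 = sm px e11 e12 e21 e22 := by
  unfold sm; omega

lemma sm_cols (px : ι → ℕ) (e11 e12 e21 e22 : ι) : sm px e12 e11 e22 e21 = sm px e11 e12 e21 e22 := by
  unfold sm; rw [dd_comm, dd_comm (px e22)]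

lemma goodX (c : Cfg G N x y px py T) {A1 A2 B1 B2 : ℕ} {e11 e12 e21 e22 : ι}
    (h : C4 (fun e => seg N x y (px e)) (fun e => seg N y x (py e)) A1 A2 B1 B2 e11 e12 e21 e22)
    (hA : A1 ≠ A2) (hB : B1 ≠ B2) (hg : px e11 < px e12 ↔ px e21 < px e22) :
    sm py e11 e21 e12 e22 + 4 ≤ sm px e11 e12 e21 e22 := by
  have n1 : px e11 ≠ px e12 := pne c (by rw [h.b11, h.b12]; exact hB)
  have n2 : px e21 ≠ px e22 := pne c (by rw [h.b21, h.b22]; exact hB)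
  rcases lt_or_gt_of_ne hA with hA | hA <;> rcases lt_or_gt_of_ne n1 with h1 | h1
  · exact goodX0 c h hA hB h1 (hg.1 h1)
  · have := goodX0 c h.cols hA hB.symm h1 (by omega)
    have q1 := sm_rows py e11 e21 e12 e22
    have q2 := sm_cols px e11 e12 e21 e22
    omega
  · have := goodX0 c h.rows hA hB (hg.1 h1) h1
    have q1 := sm_cols py e11 e21 e12 e22
    have q2 := sm_rows px e11 e12 e21 e22
    omega
  · have := goodX0 c h.cols.rows hA hB.symm (by omega) h1
    have q1 := sm_cols py e11 e21 e12 e22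
    have q2 := sm_rows px e11 e12 e21 e22
    have q3 := sm_rows py e21 e11 e22 e12
    have q4 := sm_cols px e21 e22 e11 e12
    omega

lemma perm_ne {B1 B2 B1' B2' D1 D2 D1' D2' : ℕ}
    (hB : B1 ≠ B2) (hB' : B1' ≠ B2') (b1 : B1 ≠ B1') (b2 : B1 ≠ B2') (b3 : B2 ≠ B1') (b4 : B2 ≠ B2')
    (k : (D1 = B1 ∧ D2 = B2) ∨ (D1 = B2 ∧ D2 = B1))
    (k' : (D1' = B1' ∧ D2' = B2') ∨ (D1' = B2' ∧ D2' = B1')) :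
    D1 ≠ D2 ∧ D1' ≠ D2' ∧ D1 ≠ D1' ∧ D1 ≠ D2' ∧ D2 ≠ D1' ∧ D2 ≠ D2' := by
  rcases k with ⟨rfl, rfl⟩ | ⟨rfl, rfl⟩ <;> rcases k' with ⟨rfl, rfl⟩ | ⟨rfl, rfl⟩ <;>
    refine ⟨?_, ?_, ?_, ?_, ?_, ?_⟩ <;> first | assumption | (apply Ne.symm; assumption)

lemma perm_cross {A1 A2 A1' A2' C1 C2 C1' C2' : ℕ}
    (a1 : A1 ≠ A1') (a2 : A1 ≠ A2') (a3 : A2 ≠ A1') (a4 : A2 ≠ A2')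
    (hc : (A1' < A1 ∧ A1 < A2') ↔ (A1' < A2 ∧ A2 < A2')) (hA' : A1' < A2')
    (k : (C1 = A1 ∧ C2 = A2) ∨ (C1 = A2 ∧ C2 = A1))
    (k' : (C1' = A1' ∧ C2' = A2') ∨ (C1' = A2' ∧ C2' = A1')) (h : C1 < C2) (h' : C1' < C2') :
    (C1 < C1' ∧ (C2 < C1' ∨ C2' < C2)) ∨ (C1' < C1 ∧ (C2' < C1 ∨ C2 < C2')) := by
  rcases k with ⟨rfl, rfl⟩ | ⟨rfl, rfl⟩ <;> rcases k' with ⟨rfl, rfl⟩ | ⟨rfl, rfl⟩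
  · omega
  · omega
  · omega
  · omega

/-- two X-good 4-cycles, normalized -/
lemma twoGood0 (c : Cfg G N x y px py T) {A1 A2 B1 B2 : ℕ} {e11 e12 e21 e22 : ι}
    (h : C4 (fun e => seg N x y (px e)) (fun e => seg N y x (py e)) A1 A2 B1 B2 e11 e12 e21 e22)
    {A1' A2' B1' B2' : ℕ} {f11 f12 f21 f22 : ι}
    (h' : C4 (fun e => seg N x y (px e)) (fun e => seg N y x (py e)) A1' A2' B1' B2' f11 f12 f21 f22)
    (hB : B1 ≠ B2) (hB' : B1' ≠ B2') (b1 : B1 ≠ B1') (b2 : B1 ≠ B2') (b3 : B2 ≠ B1') (b4 : B2 ≠ B2')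
    (hA : A1 < A2) (hA' : A1' < A2') (hAA : A1 < A1') (hc : A2 < A1' ∨ A2' < A2)
    (h1 : px e11 < px e12) (h2 : px e21 < px e22) (h3 : px f11 < px f12) (h4 : px f21 < px f22) :
    sm py e11 e21 e12 e22 + sm py f11 f21 f12 f22 + 8 ≤
      sm px e11 e12 e21 e22 + sm px f11 f12 f21 f22 := by
  obtain ⟨a11, a12, a21, a22, b11, b12, b21, b22⟩ := h
  obtain ⟨a11', a12', a21', a22', b11', b12', b21', b22'⟩ := h'
  have n1 : e11 ≠ e21 := by rintro rfl; omega
  have n2 : e12 ≠ e22 := by rintro rfl; omega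
  have n1' : f11 ≠ f21 := by rintro rfl; omega
  have n2' : f12 ≠ f22 := by rintro rfl; omega
  have s1 := b11.trans b21.symm
  have s2 := b12.trans b22.symm
  have s1' := b11'.trans b21'.symm
  have s2' := b12'.trans b22'.symm
  have c1 := Dt_card c e11 e21
  have c2 := Dt_card c e12 e22
  have c3 := Dt_card c f11 f21
  have c4 := Dt_card c f12 f22
  unfold sm
  rw [dd_lt h1, dd_lt h2, dd_lt h3, dd_lt h4]
  rcases hc with hc | hc
  · have := mvS c.hx c.hmax h1 (seg_lt (N := N) (x := x) (y := y) (by omega)) h2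
      (seg_lt (N := N) (x := x) (y := y) (by omega)) h3
      (seg_lt (N := N) (x := x) (y := y) (by omega)) h4 (c.pxN _)
      (Dt_x c s1) (Dt_x c s2) (Dt_x c s1') (Dt_x c s2')
      (Dt_disj c s1 s2 (by omega)) (Dt_disj c s1 s1' (by omega)) (Dt_disj c s1 s2' (by omega))
      (Dt_disj c s2 s1' (by omega)) (Dt_disj c s2 s2' (by omega)) (Dt_disj c s1' s2' (by omega))
      (Dt_lk c n1) (Dt_lk c n2) (Dt_lk c n1') (Dt_lk c n2')
    omega
  · have := mvN c.hx c.hmax h1 (seg_lt (N := N) (x := x) (y := y) (by omega)) h3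
      (seg_lt (N := N) (x := x) (y := y) (by omega)) h4
      (seg_lt (N := N) (x := x) (y := y) (by omega)) h2 (c.pxN _)
      (Dt_x c s1) (Dt_x c s2) (Dt_x c s1') (Dt_x c s2')
      (Dt_disj c s1 s2 (by omega)) (Dt_disj c s1 s1' (by omega)) (Dt_disj c s1 s2' (by omega))
      (Dt_disj c s2 s1' (by omega)) (Dt_disj c s2 s2' (by omega)) (Dt_disj c s1' s2' (by omega))
      (Dt_lk c n1) (Dt_lk c n2) (Dt_lk c n1') (Dt_lk c n2')
    omega

/-- column normalization -/
lemma colnorm (c : Cfg G N x y px py T) {A1 A2 B1 B2 : ℕ} {e11 e12 e21 e22 : ι}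
    (h : C4 (fun e => seg N x y (px e)) (fun e => seg N y x (py e)) A1 A2 B1 B2 e11 e12 e21 e22)
    (hA : A1 ≠ A2) (hB : B1 ≠ B2) (hg : px e11 < px e12 ↔ px e21 < px e22) :
    ∃ C1 C2 D1 D2 g11 g12 g21 g22,
      C4 (fun e => seg N x y (px e)) (fun e => seg N y x (py e)) C1 C2 D1 D2 g11 g12 g21 g22 ∧
      C1 < C2 ∧ px g11 < px g12 ∧ px g21 < px g22 ∧
      sm px g11 g12 g21 g22 = sm px e11 e12 e21 e22 ∧
      sm py g11 g21 g12 g22 = sm py e11 e21 e12 e22 ∧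
      ((C1 = A1 ∧ C2 = A2) ∨ (C1 = A2 ∧ C2 = A1)) ∧
      ((D1 = B1 ∧ D2 = B2) ∨ (D1 = B2 ∧ D2 = B1)) := by
  have n1 : px e11 ≠ px e12 := pne c (by rw [h.b11, h.b12]; exact hB)
  have n2 : px e21 ≠ px e22 := pne c (by rw [h.b21, h.b22]; exact hB)
  rcases lt_or_gt_of_ne hA with hA | hA <;> rcases lt_or_gt_of_ne n1 with h1 | h1
  · exact ⟨_, _, _, _, _, _, _, _, h, hA, h1, hg.1 h1, rfl, rfl, by simp, by simp⟩
  · exact ⟨_, _, _, _, _, _, _, _, h.cols, hA, h1, by omega, sm_cols .., sm_rows .., by simp, by simp⟩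
  · exact ⟨_, _, _, _, _, _, _, _, h.rows, hA, hg.1 h1, h1, sm_rows .., sm_cols .., by simp, by simp⟩
  · exact ⟨_, _, _, _, _, _, _, _, h.cols.rows, hA, by omega, h1,
      by rw [sm_rows, sm_cols], by rw [sm_cols, sm_rows], by simp, by simp⟩

lemma twoGood (c : Cfg G N x y px py T) {A1 A2 B1 B2 : ℕ} {e11 e12 e21 e22 : ι}
    (h : C4 (fun e => seg N x y (px e)) (fun e => seg N y x (py e)) A1 A2 B1 B2 e11 e12 e21 e22)
    {A1' A2' B1' B2' : ℕ} {f11 f12 f21 f22 : ι}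
    (h' : C4 (fun e => seg N x y (px e)) (fun e => seg N y x (py e)) A1' A2' B1' B2' f11 f12 f21 f22)
    (hB : B1 ≠ B2) (hB' : B1' ≠ B2') (b1 : B1 ≠ B1') (b2 : B1 ≠ B2') (b3 : B2 ≠ B1') (b4 : B2 ≠ B2')
    (hA : A1 ≠ A2) (hA' : A1' < A2') (a1 : A1 ≠ A1') (a2 : A1 ≠ A2') (a3 : A2 ≠ A1') (a4 : A2 ≠ A2')
    (hc : (A1' < A1 ∧ A1 < A2') ↔ (A1' < A2 ∧ A2 < A2'))
    (hg : px e11 < px e12 ↔ px e21 < px e22) (hg' : px f11 < px f12 ↔ px f21 < px f22) :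
    sm py e11 e21 e12 e22 + sm py f11 f21 f12 f22 + 8 ≤
      sm px e11 e12 e21 e22 + sm px f11 f12 f21 f22 := by
  obtain ⟨C1, C2, D1, D2, g11, g12, g21, g22, k, kC, k1, k2, k3, k4, k5, k6⟩ := colnorm c h hA hB hg
  obtain ⟨C1', C2', D1', D2', g11', g12', g21', g22', k', kC', k1', k2', k3', k4', k5', k6'⟩ :=
    colnorm c h' hA'.ne hB' hg'
  rw [← k3, ← k4, ← k3', ← k4']
  obtain ⟨d1, d2, d3, d4, d5, d6⟩ := perm_ne hB hB' b1 b2 b3 b4 k6 k6'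
  rcases perm_cross a1 a2 a3 a4 hc hA' k5 k5' kC kC' with ⟨hh, hh'⟩ | ⟨hh, hh'⟩
  · exact twoGood0 c k k' d1 d2 d3 d4 d5 d6 kC kC' hh hh' k1 k2 k1' k2'
  · have := twoGood0 c k' k d2 d1 d3.symm d5.symm d4.symm d6.symm kC' kC hh hh' k1' k2' k1 k2
    clear * - this
    omega

lemma twoBad0 (c : Cfg G N x y px py T) {A1 A2 B1 B2 : ℕ} {e11 e12 e21 e22 : ι}
    (h : C4 (fun e => seg N x y (px e)) (fun e => seg N y x (py e)) A1 A2 B1 B2 e11 e12 e21 e22)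
    {A1' A2' B1' B2' : ℕ} {f11 f12 f21 f22 : ι}
    (h' : C4 (fun e => seg N x y (px e)) (fun e => seg N y x (py e)) A1' A2' B1' B2' f11 f12 f21 f22)
    (hB : B1 ≠ B2) (hB' : B1' ≠ B2') (b1 : B1 ≠ B1') (b2 : B1 ≠ B2') (b3 : B2 ≠ B1') (b4 : B2 ≠ B2')
    (hA1 : A1 < A1') (hA2 : A1' < A2) (hA3 : A2 < A2')
    (h1 : px e11 < px e12) (h2 : px e22 < px e21) (h3 : px f11 < px f12) (h4 : px f22 < px f21) :
    sm py e11 e21 e12 e22 + sm py f11 f21 f12 f22 + 8 ≤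
      sm px e11 e12 e21 e22 + sm px f11 f12 f21 f22 := by
  obtain ⟨a11, a12, a21, a22, b11, b12, b21, b22⟩ := h
  obtain ⟨a11', a12', a21', a22', b11', b12', b21', b22'⟩ := h'
  have n1 : e11 ≠ e21 := by rintro rfl; omega
  have n2 : e12 ≠ e22 := by rintro rfl; omega
  have n1' : f11 ≠ f21 := by rintro rfl; omega
  have n2' : f12 ≠ f22 := by rintro rfl; omega
  have s1 := b11.trans b21.symm
  have s2 := b12.trans b22.symm
  have s1' := b11'.trans b21'.symm
  have s2' := b12'.trans b22'.symm
  have c1 := Dt_card c e11 e21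
  have c2 := Dt_card c e12 e22
  have c3 := Dt_card c f11 f21
  have c4 := Dt_card c f12 f22
  unfold sm
  rw [dd_lt h1, dd_comm, dd_comm (px e21), dd_lt h2, dd_lt h3, dd_comm (px f21), dd_lt h4]
  have := mvX c.hx c.hmax h1 (seg_lt (N := N) (x := x) (y := y) (by omega)) h3
      (seg_lt (N := N) (x := x) (y := y) (by omega)) h2
      (seg_lt (N := N) (x := x) (y := y) (by omega)) h4 (c.pxN _)
      (Dt_x c s1) (Dt_x c s2) (Dt_x c s1') (Dt_x c s2')
      (Dt_disj c s1 s2 (by omega)) (Dt_disj c s1 s1' (by omega)) (Dt_disj c s1 s2' (by omega))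
      (Dt_disj c s2 s1' (by omega)) (Dt_disj c s2 s2' (by omega)) (Dt_disj c s1' s2' (by omega))
      (Dt_lk c n1) (Dt_lk c n2) (Dt_lk c n1') (Dt_lk c n2')
  have := dd_comm (py e11) (py e21)
  omega

lemma badnorm (c : Cfg G N x y px py T) {A1 A2 B1 B2 : ℕ} {e11 e12 e21 e22 : ι}
    (h : C4 (fun e => seg N x y (px e)) (fun e => seg N y x (py e)) A1 A2 B1 B2 e11 e12 e21 e22)
    (hB : B1 ≠ B2) (hg : ¬ (px e11 < px e12 ↔ px e21 < px e22)) :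
    ∃ D1 D2 g11 g12 g21 g22,
      C4 (fun e => seg N x y (px e)) (fun e => seg N y x (py e)) A1 A2 D1 D2 g11 g12 g21 g22 ∧
      px g11 < px g12 ∧ px g22 < px g21 ∧
      sm px g11 g12 g21 g22 = sm px e11 e12 e21 e22 ∧
      sm py g11 g21 g12 g22 = sm py e11 e21 e12 e22 ∧
      ((D1 = B1 ∧ D2 = B2) ∨ (D1 = B2 ∧ D2 = B1)) := by
  have n1 : px e11 ≠ px e12 := pne c (by rw [h.b11, h.b12]; exact hB)
  have n2 : px e21 ≠ px e22 := pne c (by rw [h.b21, h.b22]; exact hB)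
  rcases lt_or_gt_of_ne n1 with h1 | h1
  · exact ⟨_, _, _, _, _, _, h, h1, by omega, rfl, rfl, by simp⟩
  · exact ⟨_, _, _, _, _, _, h.cols, h1, by omega, sm_cols .., sm_rows .., by simp⟩

lemma crossing (c : Cfg G N x y px py T) {A1 A2 B1 B2 : ℕ} {e11 e12 e21 e22 : ι}
    (h : C4 (fun e => seg N x y (px e)) (fun e => seg N y x (py e)) A1 A2 B1 B2 e11 e12 e21 e22)
    {A1' A2' B1' B2' : ℕ} {f11 f12 f21 f22 : ι}
    (h' : C4 (fun e => seg N x y (px e)) (fun e => seg N y x (py e)) A1' A2' B1' B2' f11 f12 f21 f22)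
    (hB : B1 ≠ B2) (hB' : B1' < B2') (b1 : B1 ≠ B1') (b2 : B1 ≠ B2') (b3 : B2 ≠ B1') (b4 : B2 ≠ B2')
    (hA1 : A1 < A1') (hA2 : A1' < A2) (hA3 : A2 < A2')
    (hc : (B1' < B1 ∧ B1 < B2') ↔ (B1' < B2 ∧ B2 < B2'))
    (hg : py e11 < py e21 ↔ py e12 < py e22) (hg' : py f11 < py f21 ↔ py f12 < py f22) : False := by
  have Y := twoGood c.symm h.tr h'.tr (by omega) (by omega) (by omega) (by omega) (by omega)
    (by omega) hB hB' b1 b2 b3 b4 hc hg hg'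
  have Y1 := goodX c.symm h.tr hB (by omega) hg
  have Y2 := goodX c.symm h'.tr hB'.ne (by omega) hg'
  by_cases x1 : px e11 < px e12 ↔ px e21 < px e22
  · have := goodX c h (by omega) hB x1
    omega
  by_cases x2 : px f11 < px f12 ↔ px f21 < px f22
  · have := goodX c h' (by omega) hB'.ne x2
    omega
  obtain ⟨D1, D2, g11, g12, g21, g22, k, k1, k2, k3, k4, k6⟩ := badnorm c h hB x1
  obtain ⟨D1', D2', g11', g12', g21', g22', k', k1', k2', k3', k4', k6'⟩ :=
    badnorm c h' hB'.ne x2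
  obtain ⟨d1, d2, d3, d4, d5, d6⟩ := perm_ne hB hB'.ne b1 b2 b3 b4 k6 k6'
  have Z := twoBad0 c k k' d1 d2 d3 d4 d5 d6 hA1 hA2 hA3 k1 k2 k1' k2'
  clear * - Y Z k3 k4 k3' k4'
  omega

end cfg

section cnt

lemma pig (U : Finset ℕ) (p : ℕ → Prop) (k : ℕ) (h : 2 * k ≤ U.card + 1) :
    ∃ W ⊆ U, W.card = k ∧ ∀ a ∈ W, ∀ b ∈ W, (p a ↔ p b) := by
  classical
  have hs := Finset.card_filter_add_card_filter_not (s := U) p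
  by_cases hk : k ≤ (U.filter p).card
  · obtain ⟨W, hW, hc⟩ := Finset.exists_subset_card_eq hk
    refine ⟨W, hW.trans (Finset.filter_subset _ _), hc, ?_⟩
    intro a ha b hb
    have h1 := (Finset.mem_filter.1 (hW ha)).2
    have h2 := (Finset.mem_filter.1 (hW hb)).2
    tauto
  · have hk : k ≤ (U.filter (fun a => ¬ p a)).card := by omega
    obtain ⟨W, hW, hc⟩ := Finset.exists_subset_card_eq hk
    refine ⟨W, hW.trans (Finset.filter_subset _ _), hc, ?_⟩
    intro a ha b hb
    have h1 := (Finset.mem_filter.1 (hW ha)).2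
    have h2 := (Finset.mem_filter.1 (hW hb)).2
    tauto

lemma rich {V : Type} [DecidableEq V] {G : SimpleGraph V} {ι : Type}
    {N : ℕ} {x y : ℕ → V} {px py : ι → ℕ} {T : ι → Finset V} (c : Cfg G N x y px py T)
    {A1 A2 A1' A2' : ℕ} (hA1 : A1 < A1') (hA2 : A1' < A2) (hA3 : A2 < A2') (U U' : Finset ℕ)
    (hU : 6 ≤ U.card) (hU' : 6 ≤ U'.card)
    (h1 : ∀ B ∈ U, ∃ e, seg N x y (px e) = A1 ∧ seg N y x (py e) = B)
    (h2 : ∀ B ∈ U, ∃ e, seg N x y (px e) = A2 ∧ seg N y x (py e) = B)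
    (h1' : ∀ B ∈ U', ∃ e, seg N x y (px e) = A1' ∧ seg N y x (py e) = B)
    (h2' : ∀ B ∈ U', ∃ e, seg N x y (px e) = A2' ∧ seg N y x (py e) = B) : False := by
  classical
  have ne : Nonempty ι := by
    obtain ⟨B, hB⟩ : U.Nonempty := Finset.card_pos.1 (by omega)
    obtain ⟨e, _⟩ := h1 B hB
    exact ⟨e⟩
  have fn : ∀ (A : ℕ) (U : Finset ℕ), (∀ B ∈ U, ∃ e, seg N x y (px e) = A ∧ seg N y x (py e) = B) →
      ∃ f : ℕ → ι, ∀ B ∈ U, seg N x y (px (f B)) = A ∧ seg N y x (py (f B)) = B := by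
    intro A U h
    have : ∀ B, ∃ e, B ∈ U → seg N x y (px e) = A ∧ seg N y x (py e) = B := by
      intro B
      by_cases hB : B ∈ U
      · obtain ⟨e, he⟩ := h B hB
        exact ⟨e, fun _ => he⟩
      · exact ⟨ne.some, fun h => absurd h hB⟩
    choose f hf using this
    exact ⟨f, hf⟩
  obtain ⟨e1, he1⟩ := fn _ _ h1
  obtain ⟨e2, he2⟩ := fn _ _ h2
  obtain ⟨f1, hf1⟩ := fn _ _ h1'
  obtain ⟨f2, hf2⟩ := fn _ _ h2'
  obtain ⟨W, hWU, hW, hWp⟩ := pig U (fun B => py (e1 B) < py (e2 B)) 3 (by omega)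
  have hd : 3 ≤ (U' \ W).card := by
    have := Finset.le_card_sdiff W U'
    omega
  obtain ⟨W', hWU', hW', hWp'⟩ := pig (U' \ W) (fun B => py (f1 B) < py (f2 B)) 2 (by omega)
  obtain ⟨B1', B2', hlt, m1', m2'⟩ : ∃ B1 B2, B1 < B2 ∧ B1 ∈ W' ∧ B2 ∈ W' := by
    obtain ⟨a, b, hab, rfl⟩ := Finset.card_eq_two.1 hW'
    rcases lt_or_gt_of_ne hab with h | h
    · exact ⟨a, b, h, by simp, by simp⟩
    · exact ⟨b, a, h, by simp, by simp⟩
  obtain ⟨W2, hW2W, hW2, hW2p⟩ := pig W (fun B => B1' < B ∧ B < B2') 2 (by omega)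
  obtain ⟨B1, B2, hab, rfl⟩ := Finset.card_eq_two.1 hW2
  have m1 : B1 ∈ W := hW2W (by simp)
  have m2 : B2 ∈ W := hW2W (by simp)
  have q1 := Finset.mem_sdiff.1 (hWU' m1')
  have q2 := Finset.mem_sdiff.1 (hWU' m2')
  have n1 : B1 ≠ B1' := by rintro rfl; exact q1.2 m1
  have n2 : B1 ≠ B2' := by rintro rfl; exact q2.2 m1
  have n3 : B2 ≠ B1' := by rintro rfl; exact q1.2 m2
  have n4 : B2 ≠ B2' := by rintro rfl; exact q2.2 m2
  have u1 := hWU m1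
  have u2 := hWU m2
  exact crossing c (e11 := e1 B1) (e12 := e1 B2) (e21 := e2 B1) (e22 := e2 B2)
    ⟨(he1 _ u1).1, (he1 _ u2).1, (he2 _ u1).1, (he2 _ u2).1,
      (he1 _ u1).2, (he1 _ u2).2, (he2 _ u1).2, (he2 _ u2).2⟩
    (f11 := f1 B1') (f12 := f1 B2') (f21 := f2 B1') (f22 := f2 B2')
    ⟨(hf1 _ q1.1).1, (hf1 _ q2.1).1, (hf2 _ q1.1).1, (hf2 _ q2.1).1,
      (hf1 _ q1.1).2, (hf1 _ q2.1).2, (hf2 _ q1.1).2, (hf2 _ q2.1).2⟩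
    hab hlt n1 n2 n3 n4 hA1 hA2 hA3 (hW2p _ (by simp) _ (by simp)) (hWp _ m1 _ m2)
    (hWp' _ m1' _ m2')

lemma noncross_card_s15 (n : ℕ) (R : Finset (ℕ × ℕ)) (hR : ∀ p ∈ R, p.1 < p.2 ∧ p.2 < n)
    (hnc : ∀ a a' b b', a < a' → a' < b → b < b' → (a, b) ∈ R → (a', b') ∈ R → False) :
    R.card ≤ 2 * n := by
  classical
  have hs := Finset.card_filter_add_card_filter_not (s := R) (fun p => ∃ c, p.2 < c ∧ (p.1, c) ∈ R)
  have h1 : (R.filter (fun p => ∃ c, p.2 < c ∧ (p.1, c) ∈ R)).card ≤ (Finset.range n).card := by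
    apply Finset.card_le_card_of_injOn Prod.snd
    · intro p hp
      have := hR p (Finset.mem_filter.1 hp).1
      simp only [Finset.coe_range, Set.mem_Iio]
      omega
    · rintro ⟨a, b⟩ hp ⟨a', b'⟩ hp' (rfl : b = b')
      simp only [Finset.coe_filter, Set.mem_ofPred_eq] at hp hp'
      obtain ⟨hp, c, hc, hc'⟩ := hp
      obtain ⟨hp', d, hd, hd'⟩ := hp'
      have r1 := (hR _ hp).1
      have r2 := (hR _ hp').1
      rcases lt_trichotomy a a' with h | h | h
      · exact (hnc _ _ _ _ h r2 hd hp hd').elim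
      · rw [h]
      · exact (hnc _ _ _ _ h r1 hc hp' hc').elim
  have h2 : (R.filter (fun p => ¬ ∃ c, p.2 < c ∧ (p.1, c) ∈ R)).card ≤ (Finset.range n).card := by
    apply Finset.card_le_card_of_injOn Prod.fst
    · intro p hp
      have := hR p (Finset.mem_filter.1 hp).1
      simp only [Finset.coe_range, Set.mem_Iio]
      omega
    · rintro ⟨a, b⟩ hp ⟨a', b'⟩ hp' (rfl : a = a')
      simp only [Finset.coe_filter, Set.mem_ofPred_eq, not_exists, not_and] at hp hp'
      rcases lt_trichotomy b b' with h | h | h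
      · exact (hp.2 _ h hp'.1).elim
      · rw [h]
      · exact (hp'.2 _ h hp.1).elim
  simp only [Finset.card_range] at h1 h2
  omega

open Classical in
lemma count (n : ℕ) (H : Finset (ℕ × ℕ)) (hH : ∀ p ∈ H, p.1 < n ∧ p.2 < n)
    (hnc : ∀ a a' b b', a < a' → a' < b → b < b' →
      6 ≤ ((Finset.range n).filter (fun B => (a, B) ∈ H ∧ (b, B) ∈ H)).card →
      6 ≤ ((Finset.range n).filter (fun B => (a', B) ∈ H ∧ (b', B) ∈ H)).card → False) :
    H.card ^ 2 ≤ 10 * n ^ 3 := by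
  set cn : ℕ → ℕ → ℕ := fun a b => ((Finset.range n).filter (fun B => (a, B) ∈ H ∧ (b, B) ∈ H)).card
    with hcn
  set R : Finset (ℕ × ℕ) := (Finset.range n ×ˢ Finset.range n).filter (fun p => p.1 < p.2 ∧ 6 ≤ cn p.1 p.2)
    with hRdef
  have hR : R.card ≤ 2 * n := by
    apply noncross_card_s15
    · intro p hp
      simp only [hRdef, Finset.mem_filter, Finset.mem_product, Finset.mem_range] at hp
      omega
    · intro a a' b b' h1 h2 h3 h4 h5
      simp only [hRdef, Finset.mem_filter, Finset.mem_product, Finset.mem_range] at h4 h5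
      exact hnc a a' b b' h1 h2 h3 h4.2.2 h5.2.2
  set d : ℕ → ℕ := fun B => ((Finset.range n).filter (fun a => (a, B) ∈ H)).card with hd
  have e1 : H.card = ∑ B ∈ Finset.range n, d B := by
    rw [Finset.card_eq_sum_card_fiberwise (f := Prod.snd) (t := Finset.range n)]
    · apply Finset.sum_congr rfl
      intro B hB
      simp only [hd]
      apply Finset.card_bij (fun p _ => p.1)
      · rintro ⟨a, b⟩ hp
        simp only [Finset.mem_filter, Finset.mem_range] at hp ⊢
        obtain ⟨hp, rfl⟩ := hp
        exact ⟨(hH _ hp).1, hp⟩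
      · rintro ⟨a, b⟩ hp ⟨a', b'⟩ hp' h
        simp only [Finset.mem_filter] at hp hp' h
        rw [h, hp.2, hp'.2]
      · intro a ha
        simp only [Finset.mem_filter] at ha
        exact ⟨(a, B), by simp [ha.2], rfl⟩
    · intro p hp
      simpa using (hH p hp).2
  have e2 : ∑ B ∈ Finset.range n, d B ^ 2 = ∑ a ∈ Finset.range n, ∑ b ∈ Finset.range n, cn a b := by
    have : ∀ B ∈ Finset.range n, d B ^ 2 = ∑ a ∈ Finset.range n, ∑ b ∈ Finset.range n,
        if (a, B) ∈ H ∧ (b, B) ∈ H then 1 else 0 := by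
      intro B _
      simp only [hd, Finset.card_filter, sq, Finset.sum_mul_sum]
      apply Finset.sum_congr rfl
      intro a _
      apply Finset.sum_congr rfl
      intro b _
      by_cases h1 : (a, B) ∈ H <;> by_cases h2 : (b, B) ∈ H <;> simp [h1, h2]
    rw [Finset.sum_congr rfl this, Finset.sum_comm]
    apply Finset.sum_congr rfl
    intro a _
    rw [Finset.sum_comm]
    apply Finset.sum_congr rfl
    intro b _
    simp only [hcn, Finset.card_filter]
  have e3 : ∀ a ∈ Finset.range n, ∀ b ∈ Finset.range n, cn a b ≤
      5 + n * (if a = b then 1 else 0) + n * (if (a, b) ∈ R then 1 else 0) +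
        n * (if (b, a) ∈ R then 1 else 0) := by
    intro a ha b hb
    have hle : cn a b ≤ n := by
      simpa using Finset.card_filter_le (Finset.range n) (fun B => (a, B) ∈ H ∧ (b, B) ∈ H)
    have hsy : cn b a = cn a b := by
      simp only [hcn]
      congr 1
      apply Finset.filter_congr
      intro B _
      exact and_comm
    by_cases h6 : cn a b ≤ 5
    · omega
    rcases lt_trichotomy a b with h | h | h
    · have : (a, b) ∈ R := by
        simp only [hRdef, Finset.mem_filter, Finset.mem_product]
        exact ⟨⟨ha, hb⟩, h, by omega⟩
      rw [if_pos this]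
      omega
    · rw [if_pos h]
      omega
    · have : (b, a) ∈ R := by
        simp only [hRdef, Finset.mem_filter, Finset.mem_product]
        exact ⟨⟨hb, ha⟩, h, by omega⟩
      rw [if_pos this]
      omega
  have e4 : ∑ a ∈ Finset.range n, ∑ b ∈ Finset.range n, (if (a, b) ∈ R then 1 else 0) = R.card := by
    rw [← Finset.sum_product', ← Finset.card_filter]
    congr 1
    ext p
    simp only [Finset.mem_filter, Prod.mk.eta, hRdef]
    tauto
  have e5 : ∑ a ∈ Finset.range n, ∑ b ∈ Finset.range n, (if (b, a) ∈ R then 1 else 0) = R.card := by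
    rw [Finset.sum_comm]
    exact e4
  have e6 : ∑ a ∈ Finset.range n, ∑ b ∈ Finset.range n, cn a b ≤ 10 * n ^ 2 := by
    calc _ ≤ ∑ a ∈ Finset.range n, ∑ b ∈ Finset.range n,
        (5 + n * (if a = b then 1 else 0) + n * (if (a, b) ∈ R then 1 else 0) +
          n * (if (b, a) ∈ R then 1 else 0)) :=
          Finset.sum_le_sum fun a ha => Finset.sum_le_sum fun b hb => e3 a ha b hb
      _ = n * n * 5 + n * n + n * R.card + n * R.card := by
          simp only [Finset.sum_add_distrib, ← Finset.mul_sum]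
          rw [e4, e5]
          have : ∑ a ∈ Finset.range n, ∑ b ∈ Finset.range n, (if a = b then 1 else 0) = n := by
            have : ∀ a ∈ Finset.range n, ∑ b ∈ Finset.range n, (if a = b then 1 else 0) = 1 := by
              intro a ha
              simpa using ha
            rw [Finset.sum_congr rfl this]
            simp
          rw [this]
          simp
          ring
      _ ≤ _ := by nlinarith
  have e7 := sq_sum_le_card_mul_sum_sq (s := Finset.range n) (f := d)
  rw [Finset.card_range, ← e1, e2] at e7
  calc _ ≤ _ := e7
    _ ≤ n * (10 * n ^ 2) := Nat.mul_le_mul_left _ e6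
    _ = _ := by ring

lemma cfg_bound {V : Type} [DecidableEq V] {G : SimpleGraph V} {ι : Type} [Fintype ι]
    {N : ℕ} {x y : ℕ → V} {px py : ι → ℕ} {T : ι → Finset V} (c : Cfg G N x y px py T) (m : ℕ)
    (hm : seg N x y N ≤ m) (hm' : seg N y x N ≤ m) : Fintype.card ι ^ 2 ≤ 10 * (m + 1) ^ 3 := by
  classical
  set H : Finset (ℕ × ℕ) := Finset.univ.image (fun e => (seg N x y (px e), seg N y x (py e))) with hH
  have hc : H.card = Fintype.card ι := by
    rw [hH, Finset.card_image_of_injective, Finset.card_univ]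
    intro e f h
    simp only [Prod.mk.injEq] at h
    exact mult c h.2 h.1
  have hmem : ∀ A B, (A, B) ∈ H → ∃ e, seg N x y (px e) = A ∧ seg N y x (py e) = B := by
    intro A B h
    simpa [hH] using h
  rw [← hc]
  apply count
  · intro p hp
    obtain ⟨e, h1, h2⟩ := hmem p.1 p.2 hp
    have q1 := seg_mono N x y (c.pxN e).le
    have q2 := seg_mono N y x (c.pyN e).le
    omega
  · intro a a' b b' h1 h2 h3 h4 h5
    refine rich c h1 h2 h3 _ _ h4 h5 ?_ ?_ ?_ ?_
    · intro B hB; exact hmem _ _ (Finset.mem_filter.1 hB).2.1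
    · intro B hB; exact hmem _ _ (Finset.mem_filter.1 hB).2.2
    · intro B hB; exact hmem _ _ (Finset.mem_filter.1 hB).2.1
    · intro B hB; exact hmem _ _ (Finset.mem_filter.1 hB).2.2

end cnt

section fin
variable {V : Type} [DecidableEq V] {G : SimpleGraph V}

lemma ext_path {A B : Set V} {u b : V} (p : G.Walk u b) (hp : p.IsPath) (hb : b ∈ B) (huB : u ∉ B)
    (hAB : ∀ v ∈ p.support, v ∈ A → v ∉ B) :
    (∃ b' ∈ B, b' ∈ p.support ∧ ∃ T, Lk G u b' T ∧ ∀ t ∈ T, t ∈ p.support ∧ t ≠ u ∧ t ∉ A ∧ t ∉ B) ∨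
    (∃ a' ∈ A, a' ∈ p.support ∧ ∃ b' ∈ B, b' ∈ p.support ∧ ∃ T, Lk G a' b' T ∧
      ∀ t ∈ T, t ∈ p.support ∧ t ∉ A ∧ t ∉ B) := by
  induction p with
  | nil => exact absurd hb huB
  | @cons u v w h p ih =>
    rw [Walk.cons_isPath_iff] at hp
    have hsub : ∀ t, t ∈ p.support → t ∈ (Walk.cons h p).support := by
      intro t ht
      rw [Walk.support_cons]
      exact List.mem_cons_of_mem _ ht
    by_cases hv : v ∈ B
    · exact Or.inl ⟨v, hv, hsub _ (Walk.start_mem_support p), ∅, Or.inl ⟨rfl, h⟩, by simp⟩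
    rcases ih hp.1 hb hv (fun t ht => hAB t (hsub t ht)) with
      ⟨b', hb', hs, T, hl, hT⟩ | ⟨a', ha', hs', b', hb', hs, T, hl, hT⟩
    · by_cases hvA : v ∈ A
      · exact Or.inr ⟨v, hvA, hsub _ (Walk.start_mem_support p), b', hb', hsub _ hs, T, hl,
          fun t ht => ⟨hsub _ (hT t ht).1, (hT t ht).2.2⟩⟩
      · refine Or.inl ⟨b', hb', hsub _ hs, {v} ∪ T, ?_, ?_⟩
        · have h1 : HP G v v {v} 1 := ⟨by simp, Walk.nil, by simp, by simp⟩
          rcases hl with ⟨rfl, e⟩ | ⟨a, c, n, e1, e2, e3⟩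
          · exact Or.inr ⟨v, v, 1, h, by simpa using h1, e⟩
          · refine Or.inr ⟨v, c, _, h, h1.join e1 e2 ?_, e3⟩
            rw [Finset.disjoint_singleton_left]
            exact fun hh => (hT v hh).2.1 rfl
        · intro t ht
          rw [Finset.mem_union, Finset.mem_singleton] at ht
          rcases ht with rfl | ht
          · exact ⟨hsub _ (Walk.start_mem_support p), h.ne', hvA, hv⟩
          · refine ⟨hsub _ (hT t ht).1, ?_, (hT t ht).2.2⟩
            rintro rfl
            exact hp.2 (hT t ht).1
    · exact Or.inr ⟨a', ha', hsub _ hs', b', hb', hsub _ hs, T, hl,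
        fun t ht => ⟨hsub _ (hT t ht).1, (hT t ht).2⟩⟩

lemma ext_link {A B P : Set V} {a b : V} (p : G.Walk a b) (ha : a ∈ A) (hb : b ∈ B)
    (hP : ∀ v ∈ p.support, v ∈ P) (hAB : ∀ v ∈ P, v ∈ A → v ∉ B) :
    ∃ a' ∈ A, a' ∈ P ∧ ∃ b' ∈ B, b' ∈ P ∧ ∃ T, Lk G a' b' T ∧ ∀ t ∈ T, t ∈ P ∧ t ∉ A ∧ t ∉ B := by
  have hs : ∀ v ∈ p.bypass.support, v ∈ P := fun v hv => hP v (p.support_bypass_subset_support hv)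
  rcases ext_path p.bypass p.bypass_isPath hb
    (hAB a (hs a (Walk.start_mem_support _)) ha) (fun v hv => hAB v (hs v hv)) with
      ⟨b', hb', h1, T, hl, hT⟩ | ⟨a', ha', h0, b', hb', h1, T, hl, hT⟩
  · exact ⟨a, ha, hs _ (Walk.start_mem_support _), b', hb', hs _ h1, T, hl,
      fun t ht => ⟨hs _ (hT t ht).1, (hT t ht).2.2⟩⟩
  · exact ⟨a', ha', hs _ h0, b', hb', hs _ h1, T, hl,
      fun t ht => ⟨hs _ (hT t ht).1, (hT t ht).2⟩⟩

lemma half {N : ℕ} {x : ℕ → V} (hx : PthF G N x) {p : ℕ} (hp : p < N) :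
    ∃ i j, i ≤ j ∧ j < N ∧ ∃ u n, HP G u (x p) (img x i j) n ∧ N + 1 ≤ 2 * n := by
  rcases le_total (N + 1) (2 * (p + 1)) with h | h
  · exact ⟨0, p, by omega, hp, _, _, hx.hp (Nat.zero_le p) hp, by omega⟩
  · exact ⟨p, N - 1, by omega, by omega, _, _, (hx.hp (show p ≤ N - 1 by omega) (by omega)).symm,
      by omega⟩

lemma cfg_zero {ι : Type} {N : ℕ} {x y : ℕ → V} {px py : ι → ℕ} {T : ι → Finset V}
    (c : Cfg G N x y px py T) (e : ι) (hd : ∀ i < N, ∀ j < N, x i ≠ y j) : False := by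
  obtain ⟨i, j, hij, hj, u, n, h, hn⟩ := half c.hx (c.pxN e)
  obtain ⟨i', j', hij', hj', u', n', h', hn'⟩ := half c.hy (c.pyN e)
  have := h.splice (c.lk e) h'.symm (img_disj (c.Tx e) hj) (by
    apply img_disj (N := N) _ hj
    intro r hr hm
    simp only [img, Finset.mem_image, Finset.mem_Icc] at hm
    obtain ⟨s, hs, hs'⟩ := hm
    exact hd r hr s (by omega) hs'.symm) (img_disj (c.Ty e) hj').symm
  have := c.hmax _ _ _ _ this
  omega

lemma seg_le {N : ℕ} {x y : ℕ → V} (hx : ∀ i j, i < N → j < N → x i = x j → i = j) (M : Finset V)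
    (hM : ∀ v, v ∈ M ↔ (∃ i < N, x i = v) ∧ (∃ i < N, y i = v)) : seg N x y N ≤ M.card := by
  classical
  unfold seg
  apply Finset.card_le_card_of_injOn x
  · intro q hq
    simp only [Finset.coe_filter, Finset.mem_range, Set.mem_ofPred_eq] at hq
    obtain ⟨h, j, hj, hh⟩ := hq
    exact (hM _).2 ⟨⟨q, h, rfl⟩, ⟨j, hj, hh.symm⟩⟩
  · intro q hq r hr h
    simp only [Finset.coe_filter, Finset.mem_range, Set.mem_ofPred_eq] at hq hr
    exact hx _ _ hq.1 hr.1 h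

lemma paths_bound {N : ℕ} {x y : ℕ → V} (hx : PthF G N x) (hy : PthF G N y)
    (hmax : ∀ u v S n, HP G u v S n → n ≤ N) (M : Finset V)
    (hM : ∀ v, v ∈ M ↔ (∃ i < N, x i = v) ∧ (∃ i < N, y i = v)) (k : ℕ)
    (hk : MPaths G {v | ∃ i < N, x i = v} {v | ∃ i < N, y i = v} k) :
    (M.card = 0 → k = 0) ∧ ∃ t, k ≤ M.card + t ∧ t ^ 2 ≤ 10 * (M.card + 1) ^ 3 := by
  classical
  obtain ⟨P, hPd, hP⟩ := hk
  let good : Fin k → Prop := fun i => ∀ v ∈ P i, v ∈ {v | ∃ i < N, x i = v} → v ∉ {v | ∃ i < N, y i = v}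
  have key : ∀ e : {i // good i}, ∃ p q T, p < N ∧ q < N ∧ x p ∈ P e.1 ∧ y q ∈ P e.1 ∧
      Lk G (x p) (y q) T ∧ ∀ t ∈ T, t ∈ P e.1 ∧ (∀ i < N, x i ≠ t) ∧ (∀ i < N, y i ≠ t) := by
    rintro ⟨i, hi⟩
    obtain ⟨a, ha, b, hb, p, hp⟩ := hP i
    obtain ⟨_, ⟨p, hp, rfl⟩, h1, _, ⟨q, hq, rfl⟩, h2, T, hl, hT⟩ := ext_link p ha hb hp hi
    refine ⟨p, q, T, hp, hq, h1, h2, hl, ?_⟩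
    intro t ht
    obtain ⟨h3, h4, h5⟩ := hT t ht
    exact ⟨h3, fun i hi h => h4 ⟨i, hi, h⟩, fun i hi h => h5 ⟨i, hi, h⟩⟩
  choose px py T k1 k2 k3 k4 k5 k6 using key
  have same : ∀ (e f : {i // good i}) (v : V), v ∈ P e.1 → v ∈ P f.1 → e = f := by
    intro e f v h1 h2
    by_contra h
    exact Set.disjoint_left.1 (hPd e.1 f.1 (fun hh => h (Subtype.ext hh))) h1 h2
  have c : Cfg G N x y px py T :=
    { hx := hx
      hy := hy
      hmax := hmax
      pxN := k1
      pyN := k2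
      pxi := fun e f h => same e f _ (k3 e) (h ▸ k3 f)
      pyi := fun e f h => same e f _ (k4 e) (h ▸ k4 f)
      lk := k5
      Tx := fun e i hi h => (k6 e _ h).2.1 i hi rfl
      Ty := fun e i hi h => (k6 e _ h).2.2 i hi rfl
      Td := by
        intro e f hef
        rw [Finset.disjoint_left]
        intro v h1 h2
        exact hef (same e f v (k6 e v h1).1 (k6 f v h2).1)
      nx := fun e i hi h => e.2 _ (k3 e) ⟨_, k1 e, rfl⟩ ⟨i, hi, h.symm⟩
      ny := fun e i hi h => e.2 _ (k4 e) ⟨i, hi, h.symm⟩ ⟨_, k2 e, rfl⟩ }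
  have hbad : Fintype.card {i // ¬ good i} ≤ M.card := by
    have : ∀ i : {i // ¬ good i}, ∃ v, v ∈ P i.1 ∧ v ∈ M := by
      rintro ⟨i, hi⟩
      simp only [good, not_forall, not_not] at hi
      obtain ⟨v, h1, h2, h3⟩ := hi
      exact ⟨v, h1, (hM v).2 ⟨h2, h3⟩⟩
    choose f hf1 hf2 using this
    rw [← Finset.card_univ]
    apply Finset.card_le_card_of_injOn f
    · intro i _; exact hf2 i
    · intro i _ j _ hij
      by_contra h
      exact Set.disjoint_left.1 (hPd i.1 j.1 (fun hh => h (Subtype.ext hh))) (hf1 i) (hij ▸ hf1 j)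
  have hsum := Fintype.card_subtype_compl good
  have hle := Fintype.card_subtype_le good
  rw [Fintype.card_fin] at hsum hle
  refine ⟨?_, Fintype.card {i // good i}, by omega, ?_⟩
  · intro h0
    by_contra hk
    have hpos : 0 < Fintype.card {i // good i} := by omega
    obtain ⟨e⟩ := Fintype.card_pos_iff.1 hpos
    refine cfg_zero c e ?_
    intro i hi j hj hij
    have : x i ∈ M := (hM _).2 ⟨⟨i, hi, rfl⟩, ⟨j, hj, hij.symm⟩⟩
    rw [Finset.card_eq_zero.1 h0] at this
    simp at this
  · exact cfg_bound c _ (seg_le hx.1 M hM) (seg_le hy.1 M (fun v => (hM v).trans and_comm))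

lemma walk_pthF {a b : V} (X : G.Walk a b) (hX : X.IsPath) : PthF G (X.length + 1) X.getVert := by
  constructor
  · intro i j hi hj h
    exact hX.getVert_injOn (by simp; omega) (by simp; omega) h
  · intro i hi
    exact X.adj_getVert_succ (by omega)

lemma mem_walk {a b : V} (X : G.Walk a b) (v : V) :
    v ∈ X.support ↔ ∃ i < X.length + 1, X.getVert i = v := by
  rw [Walk.mem_support_iff_exists_getVert]
  constructor
  · rintro ⟨n, h, hn⟩; exact ⟨n, by omega, h⟩
  · rintro ⟨n, hn, h⟩; exact ⟨n, h, by omega⟩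

lemma real_bound {k m : ℕ} (h0 : m = 0 → k = 0)
    (h : ∃ t, k ≤ m + t ∧ t ^ 2 ≤ 10 * (m + 1) ^ 3) :
    (k : ℝ) ≤ 10 * (m : ℝ) ^ ((3 : ℝ) / 2) := by
  rcases Nat.eq_zero_or_pos m with hm | hm
  · rw [h0 hm]
    simp only [Nat.cast_zero]
    positivity
  obtain ⟨t, h1, h2⟩ := h
  have hm1 : (1 : ℝ) ≤ m := by exact_mod_cast hm
  set r : ℝ := (m : ℝ) ^ ((3 : ℝ) / 2) with hr
  have hr2 : r ^ 2 = (m : ℝ) ^ 3 := by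
    rw [hr, ← Real.rpow_natCast, ← Real.rpow_mul (by positivity), ← Real.rpow_natCast]
    norm_num
  have hr0 : 0 ≤ r := by positivity
  have hmr : (m : ℝ) ≤ r := by
    have := Real.rpow_le_rpow_of_exponent_le hm1 (show (1 : ℝ) ≤ 3 / 2 by norm_num)
    rwa [Real.rpow_one] at this
  have h3 : (t : ℝ) ^ 2 ≤ 10 * ((m : ℝ) + 1) ^ 3 := by exact_mod_cast h2
  have h4 : ((m : ℝ) + 1) ^ 3 ≤ (2 * m) ^ 3 := by
    apply pow_le_pow_left₀ (by positivity)
    linarith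
  have h5 : (t : ℝ) ≤ 9 * r := by
    apply le_of_sq_le_sq _ (by positivity)
    nlinarith [pow_nonneg hr0 2]
  have h6 : (k : ℝ) ≤ m + t := by exact_mod_cast h1
  linarith

end fin

theorem stmt_15 :
    ∃ C : ℝ, 0 < C ∧
      ∀ (V : Type) [Fintype V] [DecidableEq V] (G : SimpleGraph V),
        ∀ {a b c d : V} (X : G.Walk a b) (Y : G.Walk c d),
          IsLongestPath G X → IsLongestPath G Y →
          ∀ m : ℕ, (X.support.toFinset ∩ Y.support.toFinset).card = m →
          ∃ S : Finset V, (S.card : ℝ) ≤ C * (m : ℝ) ^ ((3 : ℝ) / 2) ∧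
            Separates G {v | v ∈ X.support} {v | v ∈ Y.support} (↑S : Set V) := by
  refine ⟨10, by norm_num, ?_⟩
  intro V _ _ G a b c d X Y hX hY m hm
  have hlen : Y.length = X.length := le_antisymm (hX.2 _ _ Y hY.1) (hY.2 _ _ X hX.1)
  set A : Set V := {v | v ∈ X.support} with hA
  set B : Set V := {v | v ∈ Y.support} with hB
  classical
  have hex : ∃ k, ∃ S : Finset V, S.card = k ∧ WSep G A B S :=
    ⟨_, Finset.univ, rfl, fun a _ b _ p => ⟨a, by simp, by simp⟩⟩
  obtain ⟨S, hS, hsep⟩ := Nat.find_spec hex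
  have hmin : ∀ S' : Finset V, WSep G A B S' → S.card ≤ S'.card := by
    intro S' h'
    rw [hS]
    exact Nat.find_min' hex ⟨S', rfl, h'⟩
  have hmp := menger_s15 G A B S.card hmin
  refine ⟨S, ?_, ?_⟩
  · have hx := walk_pthF X hX.1
    have hy := walk_pthF Y hY.1
    have mX := mem_walk X
    have mY := mem_walk Y
    rw [hlen] at hy mY
    have hb := paths_bound hx hy (by
      rintro u v S n ⟨rfl, p, hp, rfl⟩
      rw [List.toFinset_card_of_nodup hp.support_nodup, Walk.length_support]
      have := hX.2 _ _ p hp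
      omega) (X.support.toFinset ∩ Y.support.toFinset) (by
      intro v
      rw [Finset.mem_inter, List.mem_toFinset, List.mem_toFinset, mX, mY]) S.card (by
      have e1 : A = {v | ∃ i < X.length + 1, X.getVert i = v} := Set.ext mX
      have e2 : B = {v | ∃ i < X.length + 1, Y.getVert i = v} := Set.ext mY
      rw [← e1, ← e2]
      exact hmp)
    rw [hm] at hb
    exact real_bound hb.1 hb.2
  · intro a b p hp
    exact hsep a hp.2.1 b hp.2.2.1 p
end
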